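/- arXiv:1509.06505 — 2 statements merged into one kernel-verified Lean document; each statement's English description precedes it below -/
import Mathlib

section
/- Let A_n be a sequence of n×n real matrices with Tr(A_n A_nᵀ) = n and Σ_i A_{ii}/n → s. Let M be an n×n Haar-distributed orthogonal matrix and P an independent uniformly random n×n permutation matrix. Let Z ~ N(0, 1 − s²) and Y ~ Poisson(1) be independent. Then Tr(A_n M P Mᵀ) converges in distribution to Z + s·Y as n → ∞. -/
open MeasureTheory Matrix

/-- Matrices are measurable as functions to functions (pi measurable structure). -/
instance matrixMeasurableSpace (n : ℕ) : MeasurableSpace (Matrix (Fin n) (Fin n) ℝ) :=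
  inferInstanceAs (MeasurableSpace ((Fin n) → (Fin n) → ℝ))

/-- `μ` is the Haar probability measure on the orthogonal group `O(n)`, viewed as a
measure on `n × n` real matrices: it is a probability measure concentrated on
orthogonal matrices which is invariant under left and right translation by
orthogonal matrices. -/
structure IsHaarOrthogonal (n : ℕ) (μ : Measure (Matrix (Fin n) (Fin n) ℝ)) : Prop where
  isProb : IsProbabilityMeasure μ
  ae_orth : ∀ᵐ M ∂μ, M * Mᵀ = 1
  left_inv : ∀ V : Matrix (Fin n) (Fin n) ℝ, V * Vᵀ = 1 → μ.map (fun M => V * M) = μ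
  right_inv : ∀ V : Matrix (Fin n) (Fin n) ℝ, V * Vᵀ = 1 → μ.map (fun M => M * V) = μ

open ProbabilityTheory BoundedContinuousFunction


namespace Aux18

open scoped BigOperators

lemma card_fix {n : ℕ} (S : Finset (Fin n)) :
    (Finset.univ.filter (fun σ : Equiv.Perm (Fin n) => ∀ x ∈ S, σ x = x)).card
      = (n - S.card).factorial := by
  have h := Fintype.card_congr (Equiv.Perm.subtypeEquivSubtypePerm (fun x : Fin n => x ∉ S))
  rw [Fintype.card_perm] at h
  have h2 : Fintype.card {x : Fin n // x ∉ S} = n - S.card := by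
    rw [Fintype.card_subtype_compl]; simp
  rw [h2] at h
  rw [h, Fintype.card_subtype]
  congr 1
  ext σ
  simp

lemma sum_pow_fix {n : ℕ} (z : ℂ) :
    ∑ σ : Equiv.Perm (Fin n), z ^ (Finset.univ.filter (fun i => σ i = i)).card
      = (n.factorial : ℂ) * ∑ k ∈ Finset.range (n+1), (z - 1) ^ k / (k.factorial : ℂ) := by
  have h1 : ∀ σ : Equiv.Perm (Fin n), z ^ (Finset.univ.filter (fun i => σ i = i)).card
      = ∑ S : Finset (Fin n), if (∀ x ∈ S, σ x = x) then (z-1)^S.card else 0 := by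
    intro σ
    have := Finset.sum_pow_mul_eq_add_pow (z-1) (1:ℂ) (Finset.univ.filter (fun i => σ i = i))
    simp only [sub_add_cancel, one_pow, mul_one] at this
    rw [← this, ← Finset.sum_filter]
    apply Finset.sum_congr _ (fun _ _ => rfl)
    ext S
    simp [Finset.subset_iff]
  simp_rw [h1]
  rw [Finset.sum_comm]
  have h2 : ∀ S : Finset (Fin n), (∑ σ : Equiv.Perm (Fin n),
      if (∀ x ∈ S, σ x = x) then (z-1)^S.card else 0) = ((n - S.card).factorial : ℂ) * (z-1)^S.card := by
    intro S
    rw [← Finset.sum_filter, Finset.sum_const, card_fix, nsmul_eq_mul]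
  simp_rw [h2]
  have h3 := Finset.sum_powerset_apply_card (fun k => ((n - k).factorial : ℂ) * (z-1)^k)
    (x := (Finset.univ : Finset (Fin n)))
  rw [Finset.powerset_univ] at h3
  rw [h3, Finset.mul_sum]
  simp only [Finset.card_univ, Fintype.card_fin]
  apply Finset.sum_congr rfl
  intro k hk
  have hk' : k ≤ n := by simpa [Nat.lt_succ_iff] using hk
  have h4 : ((n.choose k : ℂ)) * (k.factorial) * ((n-k).factorial) = n.factorial := by
    exact_mod_cast Nat.choose_mul_factorial_mul_factorial hk'
  have : (k.factorial : ℂ) ≠ 0 := by exact_mod_cast Nat.factorial_ne_zero k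
  rw [nsmul_eq_mul, ← h4]
  field_simp

lemma expect_fix_tendsto (z : ℂ) :
    Filter.Tendsto (fun n : ℕ => 𝔼 σ : Equiv.Perm (Fin n),
        z ^ (Finset.univ.filter (fun i => σ i = i)).card) Filter.atTop
      (nhds (Complex.exp (z - 1))) := by
  have h : ∀ n : ℕ, (𝔼 σ : Equiv.Perm (Fin n), z ^ (Finset.univ.filter (fun i => σ i = i)).card)
      = ∑ k ∈ Finset.range (n+1), (z - 1) ^ k / (k.factorial : ℂ) := by
    intro n
    rw [Fintype.expect_eq_sum_div_card, sum_pow_fix, Fintype.card_perm, Fintype.card_fin]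
    have : (n.factorial : ℂ) ≠ 0 := by exact_mod_cast Nat.factorial_ne_zero n
    field_simp
  simp_rw [h]
  have := (NormedSpace.expSeries_div_hasSum_exp (z-1)).tendsto_sum_nat
  rw [← Complex.exp_eq_exp_ℂ] at this
  exact this.comp (Filter.tendsto_add_atTop_nat 1)

lemma card_one {n : ℕ} (i a : Fin n) :
    (Finset.univ.filter (fun σ : Equiv.Perm (Fin n) => σ i = a)).card = (n-1).factorial := by
  have h := card_fix ({i} : Finset (Fin n))
  rw [Finset.card_singleton] at h
  rw [← h]
  symm
  refine Finset.card_bij (fun σ _ => Equiv.swap i a * σ) ?_ ?_ ?_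
  · intro σ hσ; simp at hσ ⊢; rw [hσ]; simp
  · intro σ _ τ _ h; exact mul_left_cancel h
  · intro σ hσ
    refine ⟨Equiv.swap i a * σ, ?_, ?_⟩
    · simp at hσ ⊢; rw [hσ]; simp
    · simp [← mul_assoc]

lemma card_two {n : ℕ} {i j a b : Fin n} (hij : i ≠ j) (hab : a ≠ b) :
    (Finset.univ.filter (fun σ : Equiv.Perm (Fin n) => σ i = a ∧ σ j = b)).card
      = (n-2).factorial := by
  have h := card_fix ({i, j} : Finset (Fin n))
  rw [Finset.card_pair hij] at h
  rw [← h]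
  symm
  obtain ⟨π, hi, hj⟩ : ∃ π : Equiv.Perm (Fin n), π i = a ∧ π j = b := by
    refine ⟨Equiv.swap (Equiv.swap i a j) b * Equiv.swap i a, ?_, ?_⟩
    · simp only [Equiv.Perm.mul_apply, Equiv.swap_apply_left]
      apply Equiv.swap_apply_of_ne_of_ne _ hab
      intro h
      have := congrArg (Equiv.swap i a) h
      simp at this
      exact hij this
    · simp
  refine Finset.card_bij (fun σ _ => π * σ) ?_ ?_ ?_
  · intro σ hσ; simp at hσ ⊢; rw [hσ.1, hσ.2]; exact ⟨hi, hj⟩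
  · intro σ _ τ _ h; exact mul_left_cancel h
  · intro σ hσ
    refine ⟨π⁻¹ * σ, ?_, ?_⟩
    · simp at hσ ⊢; rw [hσ.1, hσ.2, ← hi, ← hj]; simp
    · simp [← mul_assoc]

lemma expect_one {n : ℕ} (i : Fin n) (f : Fin n → ℝ) :
    𝔼 σ : Equiv.Perm (Fin n), f (σ i) = (∑ a, f a) / n := by
  have hn : 0 < n := i.pos
  rw [Fintype.expect_eq_sum_div_card, Fintype.card_perm, Fintype.card_fin]
  have h1 : ∀ σ : Equiv.Perm (Fin n), f (σ i) = ∑ a, if σ i = a then f a else 0 := by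
    intro σ; simp
  simp_rw [h1]
  rw [Finset.sum_comm]
  simp_rw [← Finset.sum_filter, Finset.sum_const, card_one, nsmul_eq_mul, ← Finset.mul_sum]
  have : (n.factorial : ℝ) = n * (n-1).factorial := by
    exact_mod_cast (Nat.mul_factorial_pred hn.ne').symm
  rw [this]
  have : ((n-1).factorial : ℝ) ≠ 0 := by exact_mod_cast Nat.factorial_ne_zero _
  have : (n:ℝ) ≠ 0 := by exact_mod_cast hn.ne'
  field_simp

lemma expect_two {n : ℕ} {i j : Fin n} (hij : i ≠ j) (f : Fin n → Fin n → ℝ) :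
    𝔼 σ : Equiv.Perm (Fin n), f (σ i) (σ j)
      = (∑ a, ∑ b, if a ≠ b then f a b else 0) / (n * (n - 1)) := by
  have hn : 2 ≤ n := by
    have h1 := i.isLt
    have h2 := j.isLt
    have : (i:ℕ) ≠ j := fun h => hij (Fin.ext h)
    omega
  rw [Fintype.expect_eq_sum_div_card, Fintype.card_perm, Fintype.card_fin]
  have h1 : ∀ σ : Equiv.Perm (Fin n), f (σ i) (σ j)
      = ∑ a, ∑ b, if σ i = a ∧ σ j = b then f a b else 0 := by
    intro σ
    rw [Finset.sum_eq_single (σ i), Finset.sum_eq_single (σ j)]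
    · simp
    · intro b _ hb; simp [hb.symm]
    · simp
    · intro b _ hb; simp [hb.symm]
    · simp
  simp_rw [h1]
  rw [Finset.sum_comm]
  have h2 : ∀ a, (∑ σ : Equiv.Perm (Fin n), ∑ b, if σ i = a ∧ σ j = b then f a b else 0)
      = (n-2).factorial * ∑ b, if a ≠ b then f a b else 0 := by
    intro a
    rw [Finset.sum_comm, Finset.mul_sum]
    apply Finset.sum_congr rfl
    intro b _
    by_cases hab : a = b
    · subst hab
      simp only [ne_eq, not_true_eq_false, if_false, mul_zero]
      apply Finset.sum_eq_zero
      intro σ _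
      rw [if_neg]
      rintro ⟨h3, h4⟩
      exact hij (σ.injective (h3.trans h4.symm))
    · rw [← Finset.sum_filter, Finset.sum_const, card_two hij hab, nsmul_eq_mul, if_pos hab]
  simp_rw [h2]
  rw [← Finset.mul_sum]
  have h5 : (n.factorial : ℝ) = n * (n-1) * (n-2).factorial := by
    obtain ⟨m, rfl⟩ : ∃ m, n = m + 2 := ⟨n-2, by omega⟩
    rw [Nat.factorial_succ, Nat.factorial_succ]
    push_cast; ring_nf
  rw [h5]
  have : ((n-2).factorial : ℝ) ≠ 0 := by exact_mod_cast Nat.factorial_ne_zero _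
  have : (n:ℝ) ≠ 0 := by positivity
  have : (n:ℝ) - 1 ≠ 0 := by
    have : (2:ℝ) ≤ n := by exact_mod_cast hn
    linarith
  field_simp


/-- the real sign attached to a coordinate -/
noncomputable def sg {n : ℕ} (ε : Fin n → ℤˣ) (i : Fin n) : ℝ := ((ε i : ℤ) : ℝ)

lemma sg_mul_self {n : ℕ} (ε : Fin n → ℤˣ) (i : Fin n) : sg ε i * sg ε i = 1 := by
  unfold sg
  rcases Int.units_eq_one_or (ε i) with h | h <;> simp [h]

lemma abs_sg {n : ℕ} (ε : Fin n → ℤˣ) (i : Fin n) : |sg ε i| = 1 := by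
  unfold sg
  rcases Int.units_eq_one_or (ε i) with h | h <;> simp [h]

/-- flip the `i`-th sign -/
def flip {n : ℕ} (i : Fin n) (ε : Fin n → ℤˣ) : Fin n → ℤˣ := Pi.mulSingle i (-1) * ε

lemma sg_flip {n : ℕ} (i j : Fin n) (ε : Fin n → ℤˣ) :
    sg (flip i ε) j = if j = i then - sg ε j else sg ε j := by
  unfold sg flip
  by_cases h : j = i
  · subst h; simp
  · simp [h]

lemma expect_flip {n : ℕ} {E : Type*} [AddCommMonoid E] [Module ℚ≥0 E] (i : Fin n)
    (f : (Fin n → ℤˣ) → E) : 𝔼 ε, f (flip i ε) = 𝔼 ε, f ε :=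
  Fintype.expect_equiv (Equiv.mulLeft (Pi.mulSingle i (-1))) _ _ (fun _ => rfl)

/-- the quadratic form -/
noncomputable def W {n : ℕ} (σ : Equiv.Perm (Fin n)) (d : Fin n → ℝ) (ε : Fin n → ℤˣ) : ℝ :=
  ∑ i, d i * (sg ε i * sg ε (σ i))

noncomputable def xx {n : ℕ} (σ : Equiv.Perm (Fin n)) (d : Fin n → ℝ) (i : Fin n)
    (ε : Fin n → ℤˣ) : ℝ := d i * (sg ε i * sg ε (σ i))

noncomputable def yy {n : ℕ} (σ : Equiv.Perm (Fin n)) (d : Fin n → ℝ) (i : Fin n)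
    (ε : Fin n → ℤˣ) : ℝ :=
  d i * (sg ε i * sg ε (σ i)) + d (σ.symm i) * (sg ε (σ.symm i) * sg ε i)

lemma xx_flip {n : ℕ} (σ : Equiv.Perm (Fin n)) (d : Fin n → ℝ) (hd : ∀ i, σ i = i → d i = 0)
    (i : Fin n) (ε : Fin n → ℤˣ) : xx σ d i (flip i ε) = - xx σ d i ε := by
  unfold xx
  rw [sg_flip, sg_flip]
  by_cases h : σ i = i
  · simp [hd i h]
  · simp [h]

lemma W_flip {n : ℕ} (σ : Equiv.Perm (Fin n)) (d : Fin n → ℝ) (hd : ∀ i, σ i = i → d i = 0)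
    (i : Fin n) (ε : Fin n → ℤˣ) : W σ d (flip i ε) = W σ d ε - 2 * yy σ d i ε := by
  unfold W yy
  have h1 : ∀ k, d k * (sg (flip i ε) k * sg (flip i ε) (σ k))
      = d k * (sg ε k * sg ε (σ k)) - ((if k = i then 2 * (d k * (sg ε k * sg ε (σ k))) else 0)
        + (if k = σ.symm i then 2 * (d k * (sg ε k * sg ε (σ k))) else 0)) := by
    intro k
    rw [sg_flip, sg_flip]
    have h2 : k = σ.symm i ↔ σ k = i := Equiv.eq_symm_apply σ
    simp only [h2]
    by_cases h3 : k = i <;> by_cases h4 : σ k = i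
    · have := hd k (by rw [h4, h3]); simp [this]
    · simp [h3]; subst h3; simp [h4]; ring
    · simp [h3, h4]; ring
    · simp [h3, h4]
  rw [Finset.sum_congr rfl (fun k _ => h1 k), Finset.sum_sub_distrib, Finset.sum_add_distrib,
    Finset.sum_ite_eq' , Finset.sum_ite_eq']
  simp
  ring

lemma xx_mul_yy {n : ℕ} (σ : Equiv.Perm (Fin n)) (d : Fin n → ℝ)
    (i : Fin n) (ε : Fin n → ℤˣ) : xx σ d i ε * yy σ d i ε
      = d i ^ 2 + d i * d (σ.symm i) * (sg ε (σ i) * sg ε (σ.symm i)) := by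
  unfold xx yy
  have h1 := sg_mul_self ε i
  have h2 := sg_mul_self ε (σ i)
  linear_combination (d i ^ 2 * (sg ε (σ i) * sg ε (σ i)) + d i * d (σ.symm i) * (sg ε (σ i) * sg ε (σ.symm i))) * h1 + d i ^ 2 * h2

lemma abs_xx {n : ℕ} (σ : Equiv.Perm (Fin n)) (d : Fin n → ℝ)
    (i : Fin n) (ε : Fin n → ℤˣ) : |xx σ d i ε| = |d i| := by
  unfold xx; simp [abs_mul, abs_sg]

lemma abs_yy {n : ℕ} (σ : Equiv.Perm (Fin n)) (d : Fin n → ℝ)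
    (i : Fin n) (ε : Fin n → ℤˣ) : |yy σ d i ε| ≤ |d i| + |d (σ.symm i)| := by
  unfold yy
  refine (abs_add_le _ _).trans ?_
  simp [abs_mul, abs_sg]

lemma second_moment {n : ℕ} (τ : Equiv.Perm (Fin n)) (b : Fin n → ℝ)
    (hb : ∀ i, τ i = i → b i = 0) : 𝔼 ε, (W τ b ε) ^ 2 ≤ 2 * ∑ i, b i ^ 2 := by
  have h1 : ∀ i, 𝔼 ε, xx τ b i ε * W τ b ε = 𝔼 ε, xx τ b i ε * yy τ b i ε := by
    intro i
    have h := expect_flip i (fun ε => xx τ b i ε * W τ b ε)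
    simp only [xx_flip τ b hb, W_flip τ b hb] at h
    have h2 : 𝔼 ε, -xx τ b i ε * (W τ b ε - 2 * yy τ b i ε)
      = - (𝔼 ε, xx τ b i ε * W τ b ε) + 2 * 𝔼 ε, xx τ b i ε * yy τ b i ε := by
      rw [Finset.mul_expect, ← Finset.expect_neg_distrib, ← Finset.expect_add_distrib]
      congr 1; ext ε; ring
    linarith
  have h2 : 𝔼 ε, (W τ b ε) ^ 2 = ∑ i, 𝔼 ε, xx τ b i ε * yy τ b i ε := by
    rw [← Finset.sum_congr rfl (fun i _ => h1 i), ← Finset.expect_sum_comm]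
    congr 1; ext ε
    rw [← Finset.sum_mul, sq]; rfl
  have h3 : ∀ i, 𝔼 ε, xx τ b i ε * yy τ b i ε ≤ (3/2) * b i ^ 2 + (1/2) * b (τ.symm i) ^ 2 := by
    intro i
    apply Finset.expect_le Finset.univ_nonempty
    intro ε _
    rw [xx_mul_yy]
    have : b i * b (τ.symm i) * (sg ε (τ i) * sg ε (τ.symm i)) ≤ |b i| * |b (τ.symm i)| := by
      refine (le_abs_self _).trans ?_
      simp [abs_mul, abs_sg]
    nlinarith [sq_nonneg (|b i| - |b (τ.symm i)|), sq_abs (b i), sq_abs (b (τ.symm i))]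
  rw [h2]
  refine (Finset.sum_le_sum (fun i _ => h3 i)).trans ?_
  rw [Finset.sum_add_distrib, ← Finset.mul_sum, ← Finset.mul_sum,
    Equiv.sum_comp τ.symm (fun i => b i ^ 2)]
  linarith

/-- the cross term -/
lemma cross_term {n : ℕ} (σ : Equiv.Perm (Fin n)) (d : Fin n → ℝ) (η : ℝ) (hη : 0 < η) :
    𝔼 ε, |∑ i, d i * d (σ.symm i) * (sg ε (σ i) * sg ε (σ.symm i))|
      ≤ (∑ i, if σ (σ i) = i then d i ^ 2 else 0) + (η + (2 * ∑ i, d i ^ 4) / η) := by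
  set τ := σ * σ with hτ
  set b : Fin n → ℝ := fun j => if τ j = j then 0 else d j * d (σ j) with hb
  have h1 : ∀ ε : Fin n → ℤˣ, ∑ i, d i * d (σ.symm i) * (sg ε (σ i) * sg ε (σ.symm i))
      = (∑ j, if τ j = j then d j * d (σ j) else 0) + W τ b ε := by
    intro ε
    rw [← Equiv.sum_comp σ]
    unfold W
    rw [← Finset.sum_add_distrib]
    apply Finset.sum_congr rfl
    intro j _
    simp only [Equiv.symm_apply_apply, hb]
    have : σ (σ j) = τ j := rfl
    rw [this]
    by_cases h : τ j = j
    · simp [h, sg_mul_self]; ring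
    · simp [h]; ring
  have h2 : |∑ j, if τ j = j then d j * d (σ j) else 0| ≤ ∑ i, if σ (σ i) = i then d i ^ 2 else 0 := by
    have e1 : ∑ j, (if τ j = j then d (σ j) ^ 2 else 0) = ∑ i, if σ (σ i) = i then d i ^ 2 else 0 := by
      rw [← Equiv.sum_comp σ (fun i => if σ (σ i) = i then d i ^ 2 else 0)]
      apply Finset.sum_congr rfl
      intro j _
      have : σ (σ (σ j)) = σ j ↔ τ j = j := σ.injective.eq_iff
      simp only [this]
    have e2 : ∑ j, (if τ j = j then (d j ^ 2 + d (σ j) ^ 2)/2 else 0)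
        = ∑ i, if σ (σ i) = i then d i ^ 2 else 0 := by
      have : ∀ j, (if τ j = j then (d j ^ 2 + d (σ j) ^ 2)/2 else 0)
        = (if σ (σ j) = j then d j ^ 2 else 0) / 2 + (if τ j = j then d (σ j) ^ 2 else 0) / 2 := by
        intro j
        have : σ (σ j) = τ j := rfl
        rw [this]
        by_cases h : τ j = j <;> simp [h]; ring
      rw [Finset.sum_congr rfl (fun j _ => this j), Finset.sum_add_distrib, ← Finset.sum_div,
        ← Finset.sum_div, e1]
      ring
    rw [← e2]
    refine (Finset.abs_sum_le_sum_abs _ _).trans (Finset.sum_le_sum ?_)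
    intro j _
    by_cases h : τ j = j
    · simp only [h, if_true, abs_mul]
      nlinarith [sq_nonneg (|d j| - |d (σ j)|), sq_abs (d j), sq_abs (d (σ j))]
    · simp [h]
  have h3 := second_moment τ b (by intro i hi; simp [hb, hi])
  have h4 : ∑ i, b i ^ 2 ≤ ∑ i, d i ^ 4 := by
    have : ∀ i, b i ^ 2 ≤ d i ^ 4 / 2 + d (σ i) ^ 4 / 2 := by
      intro i
      by_cases h : τ i = i
      · simp only [hb, h, if_true, ne_eq, OfNat.ofNat_ne_zero, not_false_eq_true, zero_pow]; positivity
      · simp only [hb, h, if_false]; nlinarith [sq_nonneg (d i ^ 2 - d (σ i) ^ 2)]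
    refine (Finset.sum_le_sum (fun i _ => this i)).trans ?_
    rw [Finset.sum_add_distrib, ← Finset.sum_div, ← Finset.sum_div,
      Equiv.sum_comp σ (fun i => d i ^ 4)]
    linarith
  have h5 : ∀ ε : Fin n → ℤˣ, |∑ i, d i * d (σ.symm i) * (sg ε (σ i) * sg ε (σ.symm i))|
      ≤ ((∑ i, if σ (σ i) = i then d i ^ 2 else 0) + η) + (W τ b ε) ^ 2 / η := by
    intro ε
    rw [h1]
    refine (abs_add_le _ _).trans ?_
    have : |W τ b ε| ≤ η + (W τ b ε) ^ 2 / η := by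
      rw [← sub_nonneg]
      have : η + (W τ b ε) ^ 2 / η - |W τ b ε| = ((|W τ b ε| - η)^2 + η * |W τ b ε|) / η := by
        field_simp; nlinarith [sq_abs (W τ b ε)]
      rw [this]; positivity
    linarith
  refine (Finset.expect_le_expect (fun ε _ => h5 ε)).trans ?_
  rw [Finset.expect_add_distrib, Finset.expect_const Finset.univ_nonempty, ← Finset.expect_div,
    add_assoc]
  gcongr
  linarith

lemma exp_bound (x : ℝ) : ‖Complex.exp (Complex.I * x) - 1 - Complex.I * x‖ ≤ 2 * x ^ 2 := by
  by_cases h : |x| ≤ 1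
  · have := Complex.norm_exp_sub_one_sub_id_le (x := Complex.I * x) (by simpa using h)
    simp at this
    nlinarith [sq_nonneg x]
  · have h1 := Real.norm_exp_I_mul_ofReal_sub_one_le (x := x)
    have h2 := norm_sub_le (Complex.exp (Complex.I * x) - 1) (Complex.I * x)
    simp at h1 h2
    push Not at h
    nlinarith [sq_abs x]


lemma stein_one {n : ℕ} (σ : Equiv.Perm (Fin n)) (d : Fin n → ℝ)
    (hd : ∀ i, σ i = i → d i = 0) (t : ℝ) (i : Fin n) :
    ‖(𝔼 ε, (xx σ d i ε : ℂ) * Complex.exp (Complex.I * (t * W σ d ε : ℝ)))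
      - Complex.I * t * 𝔼 ε, ((xx σ d i ε * yy σ d i ε : ℝ) : ℂ)
          * Complex.exp (Complex.I * (t * W σ d ε : ℝ))‖
      ≤ 4 * t ^ 2 * (4 * |d i| ^ 3 + 2 * |d (σ.symm i)| ^ 3) := by
  have h := expect_flip i (fun ε => (xx σ d i ε : ℂ) * Complex.exp (Complex.I * (t * W σ d ε : ℝ)))
  simp only [xx_flip σ d hd, W_flip σ d hd] at h
  set E1 := 𝔼 ε, (xx σ d i ε : ℂ) * Complex.exp (Complex.I * (t * W σ d ε : ℝ)) with hE1
  have h1 : E1 = (1/2 : ℂ) * (E1 + E1) := by ring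
  rw [h1]
  nth_rewrite 2 [← h]
  rw [hE1, ← Finset.expect_add_distrib, Finset.mul_expect, Finset.mul_expect,
    ← Finset.expect_sub_distrib]
  refine (RCLike.norm_expect_le (K := ℂ)).trans ?_
  apply Finset.expect_le Finset.univ_nonempty
  intro ε _
  set x := xx σ d i ε with hx
  set y := yy σ d i ε with hy
  set w := W σ d ε with hw
  have e1 : Complex.exp (Complex.I * ((t * (w - 2 * y) : ℝ) : ℂ))
      = Complex.exp (Complex.I * (t * w : ℝ)) * Complex.exp (Complex.I * ((-(2 * t * y) : ℝ) : ℂ)) := by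
    rw [← Complex.exp_add]; congr 1; push_cast; ring
  rw [e1]
  have e2 : (1/2 : ℂ) * ((x:ℂ) * Complex.exp (Complex.I * (t * w : ℝ))
      + ((-x : ℝ) : ℂ) * (Complex.exp (Complex.I * (t * w : ℝ)) * Complex.exp (Complex.I * ((-(2 * t * y) : ℝ) : ℂ))))
      - Complex.I * t * (((x * y : ℝ) : ℂ) * Complex.exp (Complex.I * (t * w : ℝ)))
      = (-(1/2 : ℂ) * x) * Complex.exp (Complex.I * (t * w : ℝ)) *
        (Complex.exp (Complex.I * ((-(2 * t * y) : ℝ) : ℂ)) - 1 - Complex.I * ((-(2 * t * y) : ℝ) : ℂ)) := by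
    push_cast; ring
  rw [e2, norm_mul, norm_mul, Complex.norm_exp_I_mul_ofReal, norm_mul]
  have e3 := exp_bound (-(2 * t * y))
  have e4 : ‖-(1/2 : ℂ)‖ = 1/2 := by simp
  rw [e4, Complex.norm_real, Real.norm_eq_abs, hx, abs_xx]
  have e5 := abs_yy σ d i ε
  rw [← hy] at e5
  set a := |d i| with ha
  set c := |d (σ.symm i)| with hc
  have ha0 : 0 ≤ a := abs_nonneg _
  have hc0 : 0 ≤ c := abs_nonneg _
  have e6 : y ^ 2 ≤ (a + c) ^ 2 := by rw [← sq_abs y]; gcongr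
  have e7 : a * y ^ 2 ≤ 4 * a ^ 3 + 2 * c ^ 3 := by
    have : a * y ^ 2 ≤ a * (a + c) ^ 2 := by gcongr
    have h8 : 0 ≤ (a + c) * (a - c) ^ 2 := by positivity
    have h9 : 0 ≤ a * (a - c) ^ 2 := by positivity
    have h10 : 0 ≤ c ^ 3 := by positivity
    have h11 : 0 ≤ a ^ 3 := by positivity
    nlinarith
  calc 1/2 * a * 1 * _ ≤ 1/2 * a * 1 * (2 * (-(2 * t * y)) ^ 2) := by gcongr
    _ = 4 * t ^ 2 * (a * y ^ 2) := by ring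
    _ ≤ _ := by gcongr

lemma stein {n : ℕ} (σ : Equiv.Perm (Fin n)) (d : Fin n → ℝ)
    (hd : ∀ i, σ i = i → d i = 0) (t : ℝ) (η : ℝ) (hη : 0 < η) :
    ‖(𝔼 ε, Complex.I * (W σ d ε : ℂ) * Complex.exp (Complex.I * (t * W σ d ε : ℝ)))
      + t * (∑ i, d i ^ 2 : ℝ) * 𝔼 ε, Complex.exp (Complex.I * (t * W σ d ε : ℝ))‖
      ≤ |t| * ((∑ i, if σ (σ i) = i then d i ^ 2 else 0) + (η + (2 * ∑ i, d i ^ 4) / η))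
        + 24 * t ^ 2 * ∑ i, |d i| ^ 3 := by
  set X := fun ε => Complex.exp (Complex.I * (t * W σ d ε : ℝ)) with hX
  set R := fun ε : Fin n → ℤˣ => ∑ i, d i * d (σ.symm i) * (sg ε (σ i) * sg ε (σ.symm i)) with hR
  have h1 : (𝔼 ε, Complex.I * (W σ d ε : ℂ) * X ε) + t * (∑ i, d i ^ 2 : ℝ) * 𝔼 ε, X ε
    = Complex.I * (∑ i, ((𝔼 ε, (xx σ d i ε : ℂ) * X ε)
      - Complex.I * t * 𝔼 ε, ((xx σ d i ε * yy σ d i ε : ℝ) : ℂ) * X ε))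
      - t * 𝔼 ε, (R ε : ℂ) * X ε := by
    rw [Finset.sum_sub_distrib, ← Finset.expect_sum_comm, ← Finset.mul_sum, ← Finset.expect_sum_comm]
    have e1 : ∀ ε, ∑ i, (xx σ d i ε : ℂ) * X ε = W σ d ε * X ε := by
      intro ε; rw [← Finset.sum_mul]; congr 1; unfold W xx; push_cast; rfl
    have e2 : ∀ ε, ∑ i, ((xx σ d i ε * yy σ d i ε : ℝ) : ℂ) * X ε
        = (∑ i, d i ^ 2 : ℝ) * X ε + R ε * X ε := by
      intro ε; rw [← Finset.sum_mul, ← add_mul]; congr 1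
      simp_rw [xx_mul_yy]; rw [← Complex.ofReal_sum, Finset.sum_add_distrib, Complex.ofReal_add]
    simp_rw [e1, e2, mul_assoc]
    rw [Finset.expect_add_distrib, ← Finset.mul_expect, ← Finset.mul_expect]
    linear_combination (t * (∑ i, d i ^ 2 : ℝ) * (𝔼 ε, X ε) + t * 𝔼 ε, (R ε : ℂ) * X ε) * Complex.I_mul_I
  rw [h1]
  refine (norm_sub_le _ _).trans ?_
  rw [add_comm]
  gcongr
  · rw [norm_mul, Complex.norm_real, Real.norm_eq_abs]
    gcongr
    refine le_trans ?_ (cross_term σ d η hη)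
    refine (RCLike.norm_expect_le (K := ℂ)).trans ?_
    apply Finset.expect_le_expect
    intro ε _
    rw [norm_mul, hX, Complex.norm_exp_I_mul_ofReal, Complex.norm_real, Real.norm_eq_abs, mul_one]
  · rw [norm_mul, Complex.norm_I, one_mul]
    refine (norm_sum_le _ _).trans ?_
    refine (Finset.sum_le_sum (fun i _ => stein_one σ d hd t i)).trans ?_
    rw [← Finset.mul_sum, Finset.sum_add_distrib, ← Finset.mul_sum, ← Finset.mul_sum,
      Equiv.sum_comp σ.symm (fun i => |d i| ^ 3)]
    apply le_of_eq; ring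

lemma sign_clt {n : ℕ} (σ : Equiv.Perm (Fin n)) (d : Fin n → ℝ)
    (hd : ∀ i, σ i = i → d i = 0) (t : ℝ) (η : ℝ) (hη : 0 < η) :
    ‖(𝔼 ε, Complex.exp (Complex.I * (t * W σ d ε : ℝ)))
      - (Real.exp (- (∑ i, d i ^ 2) * t ^ 2 / 2) : ℂ)‖
      ≤ |t| * (|t| * ((∑ i, if σ (σ i) = i then d i ^ 2 else 0) + (η + (2 * ∑ i, d i ^ 4) / η))
        + 24 * t ^ 2 * ∑ i, |d i| ^ 3) := by
  set V := ∑ i, d i ^ 2 with hV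
  have hV0 : 0 ≤ V := by positivity
  set B := (∑ i, if σ (σ i) = i then d i ^ 2 else 0) + (η + (2 * ∑ i, d i ^ 4) / η) with hB
  have hB0 : 0 ≤ B := by
    have : 0 ≤ ∑ i, if σ (σ i) = i then d i ^ 2 else 0 :=
      Finset.sum_nonneg (fun i _ => by split_ifs <;> positivity)
    positivity
  set T := ∑ i, |d i| ^ 3 with hT
  have hT0 : 0 ≤ T := by positivity
  set K := |t| * B + 24 * t ^ 2 * T with hK
  set g : ℝ → ℂ := fun u => 𝔼 ε, Complex.exp (Complex.I * (u * W σ d ε : ℝ)) with hg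
  set g' : ℝ → ℂ := fun u => 𝔼 ε, Complex.I * (W σ d ε : ℂ) * Complex.exp (Complex.I * (u * W σ d ε : ℝ)) with hg'
  have hder : ∀ u, HasDerivAt g (g' u) u := by
    intro u
    rw [hg, hg']
    simp only [Fintype.expect_eq_sum_div_card]
    apply HasDerivAt.div_const
    apply HasDerivAt.fun_sum
    intro ε _
    have e1 : HasDerivAt (fun u : ℝ => ((u * W σ d ε : ℝ) : ℂ)) ((W σ d ε : ℝ) : ℂ) u := by
      apply HasDerivAt.ofReal_comp
      simpa using (hasDerivAt_id u).mul_const (W σ d ε)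
    have e2 := (e1.const_mul Complex.I).cexp
    exact e2.congr_deriv (by ring)
  set G : ℝ → ℂ := fun u => ((Real.exp (V * u ^ 2 / 2) : ℝ) : ℂ) with hG
  have hGd : ∀ u, HasDerivAt G (u * V * G u) u := by
    intro u
    have e1 : HasDerivAt (fun u : ℝ => Real.exp (V * u ^ 2 / 2)) (Real.exp (V * u ^ 2 / 2) * (V * (2 * u) / 2)) u := by
      apply HasDerivAt.exp
      apply HasDerivAt.div_const
      apply HasDerivAt.const_mul
      simpa using hasDerivAt_pow 2 u
    have e2 := e1.ofReal_comp
    convert e2 using 1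
    rw [hG]; push_cast; ring
  have hH : ∀ u ∈ Set.Icc (-|t|) |t|, HasDerivWithinAt (fun u => g u * G u)
      ((g' u + u * V * g u) * G u) (Set.Icc (-|t|) |t|) u := by
    intro u _
    have := ((hder u).mul (hGd u)).hasDerivWithinAt (s := Set.Icc (-|t|) |t|)
    exact this.congr_deriv (by ring)
  have hbd : ∀ u ∈ Set.Icc (-|t|) |t|, ‖(g' u + u * V * g u) * G u‖ ≤ K * Real.exp (V * t ^ 2 / 2) := by
    intro u hu
    have hut : |u| ≤ |t| := abs_le.2 hu
    have hut2 : u ^ 2 ≤ t ^ 2 := sq_le_sq.2 hut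
    rw [norm_mul]
    have e1 := stein σ d hd u η hη
    have e2 : ‖G u‖ ≤ Real.exp (V * t ^ 2 / 2) := by
      rw [hG, Complex.norm_real, Real.norm_eq_abs, Real.abs_exp]
      gcongr
    have e3 : ‖g' u + u * V * g u‖ ≤ K := by
      refine e1.trans ?_
      rw [hK]
      gcongr
    gcongr
  have hmv := Convex.norm_image_sub_le_of_norm_hasDerivWithin_le hH hbd (convex_Icc _ _)
    (x := 0) (y := t) ⟨by simp, by simp⟩ ⟨neg_abs_le t, le_abs_self t⟩
  have g0 : g 0 * G 0 = 1 := by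
    simp [hg, hG]
  rw [g0, sub_zero, Real.norm_eq_abs] at hmv
  have hfin : g t - (Real.exp (- V * t ^ 2 / 2) : ℂ) = (g t * G t - 1) * (Real.exp (- V * t ^ 2 / 2) : ℂ) := by
    have : G t * (Real.exp (- V * t ^ 2 / 2) : ℂ) = 1 := by
      rw [hG]; simp only []
      rw [← Complex.ofReal_mul, ← Real.exp_add]
      have : V * t ^ 2 / 2 + -V * t ^ 2 / 2 = 0 := by ring
      rw [this]; simp
    linear_combination (-g t) * this
  rw [hfin, norm_mul, Complex.norm_real, Real.norm_eq_abs, Real.abs_exp]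
  have h5 : Real.exp (V * t ^ 2 / 2) * Real.exp (-V * t ^ 2 / 2) = 1 := by
    rw [← Real.exp_add]
    have : V * t ^ 2 / 2 + -V * t ^ 2 / 2 = 0 := by ring
    rw [this]; simp
  calc _ ≤ (K * Real.exp (V * t ^ 2 / 2) * |t|) * Real.exp (-V * t ^ 2 / 2) := by gcongr
    _ = |t| * K := by linear_combination (K * |t|) * h5



lemma expect_sum_perm {n : ℕ} (c : Fin n → Fin n → ℝ) :
    𝔼 σ : Equiv.Perm (Fin n), ∑ i, c (σ i) i = (∑ i, ∑ a, c a i) / n := by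
  rw [Finset.expect_sum_comm, Finset.sum_div]
  exact Finset.sum_congr rfl (fun i _ => expect_one i (fun a => c a i))

lemma expect_sum_perm_sq {n : ℕ} (hn : 2 ≤ n) (c : Fin n → Fin n → ℝ) (hc : ∀ i j, 0 ≤ c i j) :
    𝔼 σ : Equiv.Perm (Fin n), (∑ i, c (σ i) i) ^ 2
      ≤ (∑ i, ∑ a, c a i ^ 2) / n + (∑ i, ∑ a, c a i) ^ 2 / (n * (n - 1)) := by
  have hn' : (0:ℝ) < n * (n - 1) := by
    have : (2:ℝ) ≤ n := by exact_mod_cast hn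
    nlinarith
  have h1 : ∀ σ : Equiv.Perm (Fin n), (∑ i, c (σ i) i) ^ 2
      = ∑ i, ∑ j, c (σ i) i * c (σ j) j := by
    intro σ; rw [sq, Finset.sum_mul_sum]
  simp_rw [h1]
  rw [Finset.expect_sum_comm]
  simp_rw [Finset.expect_sum_comm]
  have h2 : ∀ i j, 𝔼 σ : Equiv.Perm (Fin n), c (σ i) i * c (σ j) j
      ≤ (if i = j then (∑ a, c a i ^ 2) / n else 0)
        + (∑ a, c a i) * (∑ a, c a j) / (n * (n-1)) := by
    intro i j
    by_cases hij : i = j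
    · subst hij
      have := expect_one i (fun a => c a i ^ 2)
      simp_rw [← sq, this, if_true]
      have : 0 ≤ (∑ a, c a i) ^ 2 / (n * (n-1)) := by positivity
      linarith
    · rw [expect_two hij (fun a b => c a i * c b j), if_neg hij, zero_add, Finset.sum_mul_sum]
      gcongr with a _ b _
      split_ifs
      · exact le_rfl
      · exact mul_nonneg (hc _ _) (hc _ _)
  refine (Finset.sum_le_sum (fun i _ => Finset.sum_le_sum (fun j _ => h2 i j))).trans ?_
  simp_rw [Finset.sum_add_distrib]
  apply le_of_eq
  congr 1
  · rw [Finset.sum_div]; apply Finset.sum_congr rfl; intro i _; simp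
  · simp_rw [← Finset.sum_div]; rw [sq, Finset.sum_mul_sum]

lemma expect_two_cycles {n : ℕ} (c : Fin n → Fin n → ℝ) (h0 : ∀ i, c i i = 0) :
    𝔼 σ : Equiv.Perm (Fin n), ∑ i, (if σ (σ i) = i then c (σ i) i else 0)
      = (∑ i, ∑ a, c a i) / (n * (n - 1)) := by
  have h1 : ∀ σ : Equiv.Perm (Fin n), ∀ i, (if σ (σ i) = i then c (σ i) i else 0)
      = ∑ a, c a i * (if σ i = a ∧ σ a = i then 1 else 0) := by
    intro σ i
    rw [Finset.sum_eq_single (σ i)]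
    · simp
    · intro b _ hb; simp [hb.symm]
    · simp
  simp_rw [h1]
  rw [Finset.expect_sum_comm]
  simp_rw [Finset.expect_sum_comm, ← Finset.mul_expect]
  rw [Finset.sum_div]
  apply Finset.sum_congr rfl
  intro i _
  rw [Finset.sum_div]
  apply Finset.sum_congr rfl
  intro a _
  by_cases hia : i = a
  · subst hia; simp [h0]
  · rw [expect_two hia (fun x y => if x = a ∧ y = i then (1:ℝ) else 0)]
    have : (∑ x, ∑ y, if x ≠ y then (if x = a ∧ y = i then (1:ℝ) else 0) else 0) = 1 := by
      rw [Finset.sum_eq_single a, Finset.sum_eq_single i]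
      · simp [Ne.symm hia]
      · intro b _ hb; simp [hb]
      · simp
      · intro b _ hb; simp [hb]
      · simp
    rw [this]; ring

lemma young (x η : ℝ) (hη : 0 < η) : |x| ≤ η + x ^ 2 / η := by
  rw [← sub_nonneg]
  have : η + x ^ 2 / η - |x| = ((|x| - η)^2 + η * |x|) / η := by
    field_simp; nlinarith [sq_abs x]
  rw [this]; positivity

lemma exp_diff (θ φ x y : ℝ) (hx : 0 ≤ x) (hy : 0 ≤ y) :
    ‖Complex.exp (Complex.I * θ) * (Real.exp (-x) : ℂ) - Complex.exp (Complex.I * φ) * (Real.exp (-y) : ℂ)‖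
      ≤ |θ - φ| + |x - y| := by
  have e : Complex.exp (Complex.I * θ) * (Real.exp (-x) : ℂ) - Complex.exp (Complex.I * φ) * (Real.exp (-y) : ℂ)
    = Complex.exp (Complex.I * φ) * (Complex.exp (Complex.I * ((θ - φ : ℝ) : ℂ)) - 1) * (Real.exp (-x) : ℂ)
      + Complex.exp (Complex.I * φ) * ((Real.exp (-x) - Real.exp (-y) : ℝ) : ℂ) := by
    have : Complex.exp (Complex.I * θ) = Complex.exp (Complex.I * φ) * Complex.exp (Complex.I * ((θ - φ : ℝ) : ℂ)) := by
      rw [← Complex.exp_add]; congr 1; push_cast; ring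
    rw [this]; push_cast; ring
  rw [e]
  refine (norm_add_le _ _).trans ?_
  rw [norm_mul, norm_mul, norm_mul, Complex.norm_exp_I_mul_ofReal, Complex.norm_real, Complex.norm_real,
    one_mul, one_mul]
  have h1 := Real.norm_exp_I_mul_ofReal_sub_one_le (x := θ - φ)
  rw [Real.norm_eq_abs] at *
  have h2 : |Real.exp (-x)| ≤ 1 := by rw [Real.abs_exp]; simpa using hx
  have h3 : |Real.exp (-x) - Real.exp (-y)| ≤ |x - y| := by
    have key : ∀ u v : ℝ, 0 ≤ u → u ≤ v → Real.exp (-u) - Real.exp (-v) ≤ v - u := by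
      intro u v hu huv
      have h4 := Real.add_one_le_exp (-(v-u))
      have h5 : Real.exp (-v) = Real.exp (-u) * Real.exp (-(v-u)) := by
        rw [← Real.exp_add]; congr 1; ring
      have h6 : Real.exp (-u) ≤ 1 := by simpa using hu
      have h7 := Real.exp_pos (-u)
      rw [h5]; nlinarith
    rcases le_total x y with h | h
    · rw [abs_of_nonneg (by simpa using h), abs_sub_comm, abs_of_nonneg (by linarith)]
      exact key x y hx h
    · rw [abs_sub_comm, abs_of_nonneg (by simpa using h), abs_of_nonneg (by linarith)]
      exact key y x hy h
  have : ‖Complex.exp (Complex.I * ((θ - φ : ℝ) : ℂ)) - 1‖ * |Real.exp (-x)| ≤ |θ - φ| * 1 := by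
    gcongr
  rw [Real.norm_eq_abs]
  linarith


/-- number of fixed points -/
def fixn {n : ℕ} (σ : Equiv.Perm (Fin n)) : ℕ := (Finset.univ.filter (fun i => σ i = i)).card

noncomputable def offd {n : ℕ} (D : Matrix (Fin n) (Fin n) ℝ) (σ : Equiv.Perm (Fin n)) (i : Fin n) : ℝ :=
  if σ i = i then 0 else D (σ i) i

noncomputable def diagpart {n : ℕ} (D : Matrix (Fin n) (Fin n) ℝ) (σ : Equiv.Perm (Fin n)) : ℝ :=
  ∑ i, if σ i = i then D i i else 0

lemma split_W {n : ℕ} (D : Matrix (Fin n) (Fin n) ℝ) (σ : Equiv.Perm (Fin n)) (ε : Fin n → ℤˣ) :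
    ∑ i, D (σ i) i * (sg ε i * sg ε (σ i)) = diagpart D σ + W σ (offd D σ) ε := by
  unfold diagpart W offd
  rw [← Finset.sum_add_distrib]
  apply Finset.sum_congr rfl
  intro i _
  by_cases h : σ i = i
  · simp [h, sg_mul_self]
  · simp [h]

/-- pointwise (in the permutation) estimate -/
lemma perm_bound {n : ℕ} (D : Matrix (Fin n) (Fin n) ℝ) (σ : Equiv.Perm (Fin n)) (s t η : ℝ)
    (hη : 0 < η) (hs : s ^ 2 ≤ 1) :
    ‖(𝔼 ε : Fin n → ℤˣ, Complex.exp (Complex.I * (t * ∑ i, D (σ i) i * (sg ε i * sg ε (σ i)) : ℝ)))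
      - Complex.exp (Complex.I * (t * (s * fixn σ) : ℝ)) * (Real.exp (-((1 - s^2) * t ^ 2 / 2)) : ℂ)‖
      ≤ |t| * (|t| * ((∑ i, if σ (σ i) = i then offd D σ i ^ 2 else 0)
          + (η + (2 * ∑ i, offd D σ i ^ 4) / η))
        + 24 * t ^ 2 * (η * (∑ i, offd D σ i ^ 2) + (∑ i, offd D σ i ^ 4) / η))
        + |t| * (∑ i, if σ i = i then |D i i - s| else 0)
        + t ^ 2 / 2 * (η + ((∑ i, offd D σ i ^ 2) - (1 - s^2)) ^ 2 / η) := by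
  set V := ∑ i, offd D σ i ^ 2 with hV
  have hV0 : 0 ≤ V := by positivity
  have h1 := sign_clt σ (offd D σ) (by intro i hi; simp [offd, hi]) t η hη
  rw [← hV] at h1
  have h2 : (𝔼 ε : Fin n → ℤˣ, Complex.exp (Complex.I * (t * ∑ i, D (σ i) i * (sg ε i * sg ε (σ i)) : ℝ)))
      = Complex.exp (Complex.I * (t * diagpart D σ : ℝ)) *
        𝔼 ε : Fin n → ℤˣ, Complex.exp (Complex.I * (t * W σ (offd D σ) ε : ℝ)) := by
    rw [Finset.mul_expect]
    apply Finset.expect_congr rfl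
    intro ε _
    rw [split_W, ← Complex.exp_add]; congr 1; push_cast; ring
  rw [h2]
  set g := 𝔼 ε : Fin n → ℤˣ, Complex.exp (Complex.I * (t * W σ (offd D σ) ε : ℝ)) with hg
  have h3 := exp_diff (t * diagpart D σ) (t * (s * fixn σ)) (V * t ^ 2 / 2) ((1 - s^2) * t ^ 2 / 2)
    (by positivity) (by have : 0 ≤ 1 - s^2 := by linarith
                        positivity)
  have h4 : ∑ i, |offd D σ i| ^ 3 ≤ η * V + (∑ i, offd D σ i ^ 4) / η := by
    rw [hV, Finset.mul_sum, Finset.sum_div, ← Finset.sum_add_distrib]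
    apply Finset.sum_le_sum
    intro i _
    set x := offd D σ i
    have := young x η hη
    calc |x| ^ 3 = x ^ 2 * |x| := by rw [← sq_abs x]; ring
      _ ≤ x ^ 2 * (η + x ^ 2 / η) := by gcongr
      _ = _ := by ring
  have h5 : |t * diagpart D σ - t * (s * fixn σ)| ≤ |t| * (∑ i, if σ i = i then |D i i - s| else 0) := by
    rw [← mul_sub, abs_mul]
    gcongr
    have : diagpart D σ - s * fixn σ = ∑ i, if σ i = i then (D i i - s) else 0 := by
      unfold diagpart fixn
      rw [Finset.card_filter]
      push_cast
      rw [Finset.mul_sum, ← Finset.sum_sub_distrib]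
      apply Finset.sum_congr rfl
      intro i _
      by_cases h : σ i = i <;> simp [h]
    rw [this]
    refine (Finset.abs_sum_le_sum_abs _ _).trans (Finset.sum_le_sum ?_)
    intro i _
    by_cases h : σ i = i <;> simp [h]
  have h6 : |V * t ^ 2 / 2 - (1 - s^2) * t ^ 2 / 2| ≤ t ^ 2 / 2 * (η + (V - (1 - s^2)) ^ 2 / η) := by
    have : V * t ^ 2 / 2 - (1 - s^2) * t ^ 2 / 2 = t ^ 2 / 2 * (V - (1 - s^2)) := by ring
    rw [this, abs_mul, abs_of_nonneg (by positivity : 0 ≤ t ^ 2 / 2)]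
    gcongr
    exact young _ η hη
  set R2 := ∑ i, if σ (σ i) = i then offd D σ i ^ 2 else 0
  set S4 := ∑ i, offd D σ i ^ 4
  have h7 : Complex.exp (Complex.I * (t * diagpart D σ : ℝ)) * g
      - Complex.exp (Complex.I * (t * (s * fixn σ) : ℝ)) * (Real.exp (-((1 - s^2) * t ^ 2 / 2)) : ℂ)
    = Complex.exp (Complex.I * (t * diagpart D σ : ℝ)) * (g - (Real.exp (-V * t ^ 2 / 2) : ℂ))
      + (Complex.exp (Complex.I * (t * diagpart D σ : ℝ)) * (Real.exp (-(V * t ^ 2 / 2)) : ℂ)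
        - Complex.exp (Complex.I * (t * (s * fixn σ) : ℝ)) * (Real.exp (-((1 - s^2) * t ^ 2 / 2)) : ℂ)) := by
    have : -V * t ^ 2 / 2 = -(V * t ^ 2 / 2) := by ring
    rw [this]; ring
  rw [h7]
  refine (norm_add_le _ _).trans ?_
  rw [norm_mul, Complex.norm_exp_I_mul_ofReal, one_mul]
  have h8 : |t| * (|t| * (R2 + (η + 2 * S4 / η)) + 24 * t ^ 2 * ∑ i, |offd D σ i| ^ 3)
    ≤ |t| * (|t| * (R2 + (η + 2 * S4 / η)) + 24 * t ^ 2 * (η * V + S4 / η)) := by gcongr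
  linarith

set_option maxHeartbeats 1000000 in
lemma matrix_bound {n : ℕ} (hn : 2 ≤ n) (D : Matrix (Fin n) (Fin n) ℝ) (s t η : ℝ)
    (hη : 0 < η) (hη1 : η ≤ 1) (hs : s ^ 2 ≤ 1) (hD : ∑ i, ∑ j, D i j ^ 2 = n) :
    ‖(𝔼 σ : Equiv.Perm (Fin n), 𝔼 ε : Fin n → ℤˣ,
        Complex.exp (Complex.I * (t * ∑ i, D (σ i) i * (sg ε i * sg ε (σ i)) : ℝ)))
      - (𝔼 σ : Equiv.Perm (Fin n), Complex.exp (Complex.I * (t * (s * fixn σ) : ℝ)))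
        * (Real.exp (-((1 - s^2) * t ^ 2 / 2)) : ℂ)‖
      ≤ (4 * t ^ 2 + 24 * |t| ^ 3 + |t|) * (η + (2 * ((∑ i, (D i i - s) ^ 2) / n)
        + (∑ i, ∑ j, if i = j then 0 else D i j ^ 4) / n + 1 / ((n:ℝ) - 1)
        + 2 * |s| * |(∑ i, D i i) / n - s|) / η) := by
  have hn2 : (2:ℝ) ≤ n := by exact_mod_cast hn
  have hn0 : (0:ℝ) < n := by linarith
  have hn1 : (0:ℝ) < (n:ℝ) - 1 := by linarith
  set a := (∑ i, (D i i - s) ^ 2) / n with ha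
  set b := (∑ i, ∑ j, if i = j then 0 else D i j ^ 4) / n with hb
  set m := (∑ i, D i i) / n with hm
  set c : Fin n → Fin n → ℝ := fun i j => if i = j then 0 else D i j ^ 2 with hc
  set Q := ∑ i, ∑ a, c a i with hQ
  have ha0 : 0 ≤ a := by positivity
  have hb0 : 0 ≤ b := by
    have : ∀ i j, 0 ≤ (if i = j then 0 else D i j ^ 4) := by
      intro i j; split_ifs <;> positivity
    rw [hb]
    exact div_nonneg (Finset.sum_nonneg (fun i _ => Finset.sum_nonneg (fun j _ => this i j))) hn0.le
  have hc0 : ∀ i j, 0 ≤ c i j := by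
    intro i j; simp only [hc]; split_ifs <;> positivity
  have hQ0 : 0 ≤ Q := Finset.sum_nonneg (fun i _ => Finset.sum_nonneg (fun j _ => hc0 _ _))
  have hQe : Q = n - ∑ i, D i i ^ 2 := by
    rw [← hD, hQ, Finset.sum_comm, ← Finset.sum_sub_distrib]
    apply Finset.sum_congr rfl
    intro i _
    rw [← Finset.sum_erase_add Finset.univ (fun j => D i j ^ 2) (Finset.mem_univ i),
      ← Finset.sum_erase_add Finset.univ (fun j => c i j) (Finset.mem_univ i)]
    simp only [add_sub_cancel_right, hc, if_true, add_zero]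
    apply Finset.sum_congr rfl
    intro j hj
    rw [if_neg (Finset.ne_of_mem_erase hj).symm]
  have hdiag0 : 0 ≤ ∑ i, D i i ^ 2 := by positivity
  have hQn : Q ≤ n := by linarith
  have hdd : (∑ i, D i i ^ 2) / n = a + 2 * s * m - s ^ 2 := by
    have : ∑ i, (D i i - s) ^ 2 = ∑ i, D i i ^ 2 - 2 * s * ∑ i, D i i + n * s ^ 2 := by
      simp_rw [sub_sq, Finset.sum_add_distrib, Finset.sum_sub_distrib]
      simp [Finset.mul_sum]
      apply Finset.sum_congr rfl; intro i _; ring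
    rw [ha, hm, this]; field_simp; ring
  -- expectation facts
  have hd2 : ∀ σ : Equiv.Perm (Fin n), ∀ i, offd D σ i ^ 2 = c (σ i) i := by
    intro σ i; unfold offd; simp only [hc]; split_ifs <;> simp
  have f1 : 𝔼 σ : Equiv.Perm (Fin n), ∑ i, offd D σ i ^ 2 = Q / n := by
    simp_rw [hd2]; exact expect_sum_perm c
  have hcb : (∑ i, ∑ a, c a i ^ 2) / n = b := by
    rw [hb, Finset.sum_comm]
    congr 1
    refine Finset.sum_congr rfl (fun i _ => Finset.sum_congr rfl (fun j _ => ?_))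
    simp only [hc]; split_ifs
    · simp
    · ring
  have f2 : 𝔼 σ : Equiv.Perm (Fin n), ∑ i, offd D σ i ^ 4 = b := by
    have : ∀ σ : Equiv.Perm (Fin n), ∀ i, offd D σ i ^ 4 = c (σ i) i ^ 2 := by
      intro σ i; rw [← hd2]; ring
    simp_rw [this]
    rw [expect_sum_perm (fun a i => c a i ^ 2), hcb]
  have f3 : 𝔼 σ : Equiv.Perm (Fin n), (∑ i, if σ (σ i) = i then offd D σ i ^ 2 else 0)
      ≤ 1 / ((n:ℝ) - 1) := by
    simp_rw [hd2]
    rw [expect_two_cycles c (by intro i; simp [hc])]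
    rw [div_le_div_iff₀ (by positivity) hn1]
    nlinarith
  have f4 : 𝔼 σ : Equiv.Perm (Fin n), (∑ i, offd D σ i ^ 2) ^ 2 ≤ b + Q ^ 2 / (n * (n - 1)) := by
    simp_rw [hd2]
    refine (expect_sum_perm_sq hn c hc0).trans ?_
    rw [hcb]
  have f5 : 𝔼 σ : Equiv.Perm (Fin n), (∑ i, if σ i = i then |D i i - s| else 0) ≤ η + a / η := by
    have e := expect_sum_perm (fun x i : Fin n => if x = i then |D i i - s| else 0)
    have e' : ∀ i, (∑ x, if x = i then |D i i - s| else 0) = |D i i - s| := by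
      intro i
      generalize |D i i - s| = u
      simp
    refine e.le.trans ?_
    simp_rw [e']
    rw [div_le_iff₀ hn0]
    refine (Finset.sum_le_sum (fun i _ => young (D i i - s) η hη)).trans ?_
    rw [Finset.sum_add_distrib, ← Finset.sum_div, ha]
    simp
    apply le_of_eq
    field_simp
  have f6 : 𝔼 σ : Equiv.Perm (Fin n), ((∑ i, offd D σ i ^ 2) - (1 - s^2)) ^ 2
      ≤ b + 1 / ((n:ℝ) - 1) + (a + 2 * |s| * |m - s|) := by
    have e1 : 𝔼 σ : Equiv.Perm (Fin n), ((∑ i, offd D σ i ^ 2) - (1 - s^2)) ^ 2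
      = 𝔼 σ : Equiv.Perm (Fin n), (∑ i, offd D σ i ^ 2) ^ 2 - 2 * (1 - s^2) * (Q / n) + (1-s^2)^2 := by
      rw [← f1, Finset.mul_expect, ← Finset.expect_sub_distrib]
      nth_rewrite 1 [← Finset.expect_const (Finset.univ_nonempty (α := Equiv.Perm (Fin n))) ((1 - s^2)^2)]
      rw [← Finset.expect_add_distrib]
      apply Finset.expect_congr rfl; intro σ _; ring
    rw [e1]
    have e2 : Q ^ 2 / (n * (n - 1)) ≤ (Q / n) ^ 2 + 1 / ((n:ℝ) - 1) := by
      have : (Q / n) ^ 2 + 1 / ((n:ℝ) - 1) - Q ^ 2 / (n * (n - 1)) = (n^2 - Q^2) / (n^2 * (n-1)) := by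
        field_simp; ring
      have h9 : 0 ≤ (n^2 - Q^2) / (n^2 * ((n:ℝ)-1)) := by
        apply div_nonneg _ (by positivity)
        nlinarith
      linarith
    set q := Q / n with hq
    have hq0 : 0 ≤ q := by positivity
    have hq1 : q ≤ 1 := by rw [hq, div_le_one hn0]; exact hQn
    have e3 : q - (1 - s^2) = -(a + 2 * s * (m - s)) := by
      have : q = 1 - (∑ i, D i i ^ 2) / n := by rw [hq, hQe]; field_simp
      rw [this, hdd]; ring
    have e4 : (q - (1 - s^2)) ^ 2 ≤ |q - (1 - s^2)| := by
      rw [← sq_abs]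
      have : |q - (1 - s^2)| ≤ 1 := by
        rw [abs_le]; constructor <;> linarith [sq_nonneg s]
      calc |q - (1 - s^2)| ^ 2 = |q - (1 - s^2)| * |q - (1 - s^2)| := by ring
        _ ≤ |q - (1 - s^2)| * 1 := by gcongr
        _ = _ := mul_one _
    have e5 : |q - (1 - s^2)| ≤ a + 2 * |s| * |m - s| := by
      rw [e3, abs_neg]
      refine (abs_add_le _ _).trans ?_
      rw [abs_of_nonneg ha0, abs_mul, abs_mul]; simp
    have e6 : (q-(1-s^2))^2 = q^2 - 2*(1-s^2)*q + (1-s^2)^2 := by ring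
    linarith
  rw [Finset.expect_mul, ← Finset.expect_sub_distrib]
  refine (RCLike.norm_expect_le (K := ℂ)).trans ?_
  refine (Finset.expect_le_expect (fun σ _ => perm_bound D σ s t η hη hs)).trans ?_
  simp only [Finset.expect_add_distrib, ← Finset.mul_expect, ← Finset.expect_div, f1, f2,
    Finset.expect_const (Finset.univ_nonempty (α := Equiv.Perm (Fin n)))]
  set E3 := 𝔼 σ : Equiv.Perm (Fin n), (∑ i, if σ (σ i) = i then offd D σ i ^ 2 else 0)
  set E5 := 𝔼 σ : Equiv.Perm (Fin n), (∑ i, if σ i = i then |D i i - s| else 0)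
  set E6 := 𝔼 σ : Equiv.Perm (Fin n), ((∑ i, offd D σ i ^ 2) - (1 - s^2)) ^ 2
  set κ := 1 / ((n:ℝ) - 1) with hκ
  have hκ0 : 0 ≤ κ := by positivity
  set ρ := 2 * |s| * |m - s| with hρ
  have hρ0 : 0 ≤ ρ := by positivity
  have g1 : Q / n ≤ 1 := by rw [div_le_one hn0]; exact hQn
  have g2 : κ ≤ κ / η := by rw [le_div_iff₀ hη]; nlinarith
  set T := (2 * a + b + κ + ρ) / η with hT
  have g3 : T = 2 * (a / η) + b / η + κ / η + ρ / η := by rw [hT]; ring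
  have k1 : 0 ≤ a / η := by positivity
  have k2 : 0 ≤ b / η := by positivity
  have k3 : 0 ≤ κ / η := by positivity
  have k4 : 0 ≤ ρ / η := by positivity
  have j1 : E3 + (η + 2 * b / η) ≤ 2 * (η + T) := by
    have : 2 * b / η = 2 * (b / η) := by ring
    rw [this]; linarith
  have j2 : η * (Q / n) + b / η ≤ η + T := by nlinarith
  have j3 : E5 ≤ η + T := by linarith
  have j4 : η + E6 / η ≤ η + T := by
    have : E6 / η ≤ (b + κ + (a + ρ)) / η := by gcongr
    have e : (b + κ + (a + ρ)) / η = b / η + κ / η + a / η + ρ / η := by ring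
    linarith
  calc _ ≤ |t| * (|t| * (2 * (η + T)) + 24 * t ^ 2 * (η + T)) + |t| * (η + T) + t ^ 2 / 2 * (η + T) := by
        gcongr
    _ = (2 * |t| ^ 2 + 24 * |t| * t ^ 2 + |t| + t ^ 2 / 2) * (η + T) := by ring
    _ = (2.5 * t ^ 2 + 24 * |t| ^ 3 + |t|) * (η + T) := by
      have : |t| ^ 3 = |t| * t ^ 2 := by rw [← sq_abs t]; ring
      rw [this, sq_abs]; ring
    _ ≤ _ := by
      have : 0 ≤ T := by linarith
      gcongr
      norm_num


instance matBorel (n : ℕ) : BorelSpace (Matrix (Fin n) (Fin n) ℝ) :=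
  inferInstanceAs (BorelSpace ((Fin n) → (Fin n) → ℝ))

instance matSecond (n : ℕ) : SecondCountableTopology (Matrix (Fin n) (Fin n) ℝ) :=
  inferInstanceAs (SecondCountableTopology ((Fin n) → (Fin n) → ℝ))

lemma entry_bound {n : ℕ} (M : Matrix (Fin n) (Fin n) ℝ) (h : M * Mᵀ = 1) (i j : Fin n) :
    M i j ∈ Set.Icc (-1:ℝ) 1 := by
  have h1 : ∑ k, M i k * M i k = 1 := by
    have := congrFun (congrFun h i) i
    rw [Matrix.mul_apply] at this
    simpa using this
  have h2 : M i j * M i j ≤ 1 := by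
    rw [← h1]
    exact Finset.single_le_sum (f := fun k => M i k * M i k) (fun k _ => mul_self_nonneg _)
      (Finset.mem_univ j)
  rw [Set.mem_Icc, ← abs_le]
  exact abs_le_one_iff_mul_self_le_one.mpr h2

lemma integ {n : ℕ} {μ : Measure (Matrix (Fin n) (Fin n) ℝ)} (hμ : IsHaarOrthogonal n μ)
    {E : Type*} [NormedAddCommGroup E] [SecondCountableTopology E]
    (f : Matrix (Fin n) (Fin n) ℝ → E) (hf : Continuous f) : Integrable f μ := by
  have := hμ.isProb
  have hK : IsCompact (Set.pi Set.univ (fun _ : Fin n => Set.pi Set.univ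
      (fun _ : Fin n => Set.Icc (-1:ℝ) 1))) :=
    isCompact_univ_pi (fun _ => isCompact_univ_pi (fun _ => isCompact_Icc))
  obtain ⟨C, hC⟩ := hK.exists_bound_of_continuousOn (f := f) hf.continuousOn
  refine Integrable.of_bound hf.aestronglyMeasurable C ?_
  filter_upwards [hμ.ae_orth] with M hM
  apply hC
  intro i _ j _
  exact entry_bound M hM i j

lemma invar {n : ℕ} {μ : Measure (Matrix (Fin n) (Fin n) ℝ)} (hμ : IsHaarOrthogonal n μ)
    {E : Type*} [NormedAddCommGroup E] [NormedSpace ℝ E] [SecondCountableTopology E]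
    (f : Matrix (Fin n) (Fin n) ℝ → E) (hf : Continuous f)
    (V : Matrix (Fin n) (Fin n) ℝ) (hV : V * Vᵀ = 1) :
    ∫ M, f (M * V) ∂μ = ∫ M, f M ∂μ := by
  have hc : Continuous (fun M : Matrix (Fin n) (Fin n) ℝ => M * V) := by fun_prop
  conv_rhs => rw [← hμ.right_inv V hV]
  rw [integral_map hc.measurable.aemeasurable hf.aestronglyMeasurable]

/-- conjugate -/
def cj {n : ℕ} (A M : Matrix (Fin n) (Fin n) ℝ) : Matrix (Fin n) (Fin n) ℝ := Mᵀ * A * M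

lemma cj_cont {n : ℕ} (A : Matrix (Fin n) (Fin n) ℝ) : Continuous (fun M => cj A M) := by
  unfold cj; fun_prop

lemma cj_entry {n : ℕ} (A : Matrix (Fin n) (Fin n) ℝ) (i j : Fin n) :
    Continuous (fun M => cj A M i j) := by
  have := cj_cont A
  fun_prop

lemma cj_mul {n : ℕ} (A M V : Matrix (Fin n) (Fin n) ℝ) : cj A (M * V) = Vᵀ * cj A M * V := by
  unfold cj; rw [Matrix.transpose_mul]; simp only [Matrix.mul_assoc]

lemma orth_comm {n : ℕ} {M : Matrix (Fin n) (Fin n) ℝ} (h : M * Mᵀ = 1) : Mᵀ * M = 1 :=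
  mul_eq_one_comm.mp h

lemma cj_trace {n : ℕ} (A M : Matrix (Fin n) (Fin n) ℝ) (h : M * Mᵀ = 1) :
    ∑ i, cj A M i i = ∑ i, A i i := by
  change Matrix.trace (cj A M) = Matrix.trace A
  unfold cj
  rw [Matrix.trace_mul_comm, ← Matrix.mul_assoc, h, Matrix.one_mul]

lemma trace_sq {n : ℕ} (A : Matrix (Fin n) (Fin n) ℝ) :
    Matrix.trace (A * Aᵀ) = ∑ i, ∑ j, A i j ^ 2 := by
  simp [Matrix.trace, Matrix.mul_apply, sq]

lemma cj_cjT {n : ℕ} (A M : Matrix (Fin n) (Fin n) ℝ) (h : M * Mᵀ = 1) :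
    cj A M * (cj A M)ᵀ = cj (A * Aᵀ) M := by
  unfold cj
  simp only [Matrix.transpose_mul, Matrix.transpose_transpose, Matrix.mul_assoc]
  rw [← Matrix.mul_assoc M Mᵀ, h, Matrix.one_mul]

lemma cj_row {n : ℕ} (A M : Matrix (Fin n) (Fin n) ℝ) (h : M * Mᵀ = 1) (i : Fin n) :
    ∑ j, cj A M i j ^ 2 = cj (A * Aᵀ) M i i := by
  rw [← cj_cjT A M h, Matrix.mul_apply]
  simp [sq]

lemma cj_frob {n : ℕ} (A M : Matrix (Fin n) (Fin n) ℝ) (h : M * Mᵀ = 1) :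
    ∑ i, ∑ j, cj A M i j ^ 2 = ∑ i, ∑ j, A i j ^ 2 := by
  simp_rw [cj_row A M h]
  rw [cj_trace _ _ h, ← trace_sq]; rfl

/-- mixing of two columns -/
noncomputable def mix {n : ℕ} (i j : Fin n) : Matrix (Fin n) (Fin n) ℝ :=
  fun k l => if l = i then (if k = i then 1 else if k = j then 1 else 0) / √2
    else if l = j then (if k = i then 1 else if k = j then -1 else 0) / √2
    else if k = l then 1 else 0

lemma mix_i {n : ℕ} {i j : Fin n} (hij : i ≠ j) (D : Matrix (Fin n) (Fin n) ℝ) (a : Fin n) :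
    (D * mix i j) a i = (D a i + D a j) / √2 := by
  rw [Matrix.mul_apply, Finset.sum_eq_add_of_mem i j (Finset.mem_univ _) (Finset.mem_univ _) hij]
  · simp [mix, hij.symm]; ring
  · intro k _ hk; simp [mix, hk.1, hk.2]

lemma mix_j {n : ℕ} {i j : Fin n} (hij : i ≠ j) (D : Matrix (Fin n) (Fin n) ℝ) (a : Fin n) :
    (D * mix i j) a j = (D a i - D a j) / √2 := by
  rw [Matrix.mul_apply, Finset.sum_eq_add_of_mem i j (Finset.mem_univ _) (Finset.mem_univ _) hij]
  · simp [mix, hij.symm]; ring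
  · intro k _ hk; simp [mix, hk.1, hk.2, hij.symm]

lemma mix_o {n : ℕ} {i j l : Fin n} (hi : l ≠ i) (hj : l ≠ j) (D : Matrix (Fin n) (Fin n) ℝ)
    (a : Fin n) : (D * mix i j) a l = D a l := by
  rw [Matrix.mul_apply, Finset.sum_eq_single l]
  · simp [mix, hi, hj]
  · intro k _ hk; simp [mix, hi, hj, hk]
  · simp

lemma mix_symm {n : ℕ} {i j : Fin n} (hij : i ≠ j) : (mix i j)ᵀ = mix i j := by
  ext k l
  rw [Matrix.transpose_apply]
  unfold mix
  by_cases h1 : k = i <;> by_cases h2 : k = j <;> by_cases h3 : l = i <;> by_cases h4 : l = j <;>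
    by_cases h5 : k = l <;> subst_vars <;> simp_all [eq_comm]

lemma sqrt2 : √(2:ℝ) * √2 = 2 := Real.mul_self_sqrt (by norm_num)

lemma mix_orth {n : ℕ} {i j : Fin n} (hij : i ≠ j) : mix i j * (mix i j)ᵀ = 1 := by
  rw [mix_symm hij]
  have h2 := sqrt2
  have h3 : √(2:ℝ) ≠ 0 := by positivity
  ext a b
  by_cases h : b = i
  · subst h; rw [mix_i hij]
    by_cases h1 : a = b
    · subst h1; simp [mix, hij.symm]; field_simp; nlinarith
    · by_cases h4 : a = j
      · subst h4; simp [mix, hij.symm]; ring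
      · simp [mix, h1, h4, hij.symm]
  · by_cases h' : b = j
    · subst h'; rw [mix_j hij]
      by_cases h1 : a = i
      · subst h1; simp [mix, hij.symm, hij]
      · by_cases h4 : a = b
        · subst h4; simp [mix, hij.symm]; field_simp; nlinarith
        · simp [mix, h1, h4, hij.symm]
    · rw [mix_o h h']
      simp [mix, h, h', Matrix.one_apply]

lemma mixT {n : ℕ} (i j : Fin n) (D : Matrix (Fin n) (Fin n) ℝ) (a b : Fin n) :
    ((mix i j)ᵀ * D) a b = (Dᵀ * mix i j) b a := by
  rw [← Matrix.transpose_apply (Dᵀ * mix i j), Matrix.transpose_mul, Matrix.transpose_transpose]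

lemma diag_pair {n : ℕ} {μ : Measure (Matrix (Fin n) (Fin n) ℝ)} (hμ : IsHaarOrthogonal n μ)
    (A : Matrix (Fin n) (Fin n) ℝ) {i j : Fin n} (hij : i ≠ j) :
    ∫ M, (cj A M i i - cj A M j j) ^ 2 ∂μ ≤ ∫ M, 2 * (cj A M i j ^ 2 + cj A M j i ^ 2) ∂μ := by
  have hc := cj_entry A
  rw [← invar hμ (fun M => 2 * (cj A M i j ^ 2 + cj A M j i ^ 2)) (by fun_prop) _ (mix_orth hij)]
  apply integral_mono (integ hμ _ (by fun_prop)) (integ hμ _ (by fun_prop))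
  intro M
  simp only [cj_mul, mixT, mix_i hij, mix_j hij, Matrix.transpose_apply]
  have h2 := sqrt2
  have h3 : √(2:ℝ) ≠ 0 := by positivity
  have e : ∀ x y : ℝ, (x / √2 + y / √2) / √2 = (x + y) / 2 := by
    intro x y; rw [← add_div, div_div, h2]
  have e' : ∀ x y : ℝ, (x / √2 - y / √2) / √2 = (x - y) / 2 := by
    intro x y; rw [← sub_div, div_div, h2]
  rw [e, e']
  nlinarith [sq_nonneg (cj A M i j - cj A M j i)]

lemma off_pair {n : ℕ} {μ : Measure (Matrix (Fin n) (Fin n) ℝ)} (hμ : IsHaarOrthogonal n μ)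
    (A : Matrix (Fin n) (Fin n) ℝ) {i j k : Fin n} (hij : j ≠ i) (hik : k ≠ i) :
    ∫ M, (cj A M i j ^ 4 + cj A M i k ^ 4) ∂μ ≤ ∫ M, 6 * (cj A M i j ^ 2 * cj A M i k ^ 2) ∂μ := by
  have hc := cj_entry A
  by_cases hjk : j = k
  · subst hjk
    apply integral_mono (integ hμ _ (by fun_prop)) (integ hμ _ (by fun_prop))
    intro M
    have : 0 ≤ cj A M i j ^ 4 := by positivity
    simp only
    nlinarith
  have h1 := invar hμ (fun M => (cj A M i j ^ 4 + cj A M i k ^ 4)) (by fun_prop) _ (mix_orth hjk)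
  have h2 := sqrt2
  have e4 : √(2:ℝ) ^ 4 = 4 := by nlinarith
  have e : ∀ M, cj A (M * mix j k) i j ^ 4 + cj A (M * mix j k) i k ^ 4
      = (1/2) * (cj A M i j ^ 4 + cj A M i k ^ 4) + (1/2) * (6 * (cj A M i j ^ 2 * cj A M i k ^ 2)) := by
    intro M
    simp only [cj_mul, mixT, mix_i hjk, mix_j hjk, Matrix.transpose_apply, mix_o hij.symm hik.symm,
      div_pow, e4]
    ring
  simp only [e] at h1
  rw [integral_add (integ hμ _ (by fun_prop)) (integ hμ _ (by fun_prop)), integral_const_mul,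
    integral_const_mul] at h1
  linarith

lemma diag_bound {n : ℕ} {μ : Measure (Matrix (Fin n) (Fin n) ℝ)} (hμ : IsHaarOrthogonal n μ)
    (A : Matrix (Fin n) (Fin n) ℝ) :
    n * ∫ M, ∑ i, cj A M i i ^ 2 ∂μ ≤ (∑ i, A i i) ^ 2 + 2 * ∑ i, ∑ j, A i j ^ 2 := by
  have := hμ.isProb
  have hc := cj_entry A
  have h1 : ∫ M, ∑ i, ∑ j, (cj A M i i - cj A M j j) ^ 2 ∂μ
      ≤ ∫ M, ∑ i, ∑ j, 2 * (cj A M i j ^ 2 + cj A M j i ^ 2) ∂μ := by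
    rw [integral_finsetSum _ (fun i _ => integ hμ _ (by fun_prop)),
      integral_finsetSum _ (fun i _ => integ hμ _ (by fun_prop))]
    apply Finset.sum_le_sum; intro i _
    rw [integral_finsetSum _ (fun i _ => integ hμ _ (by fun_prop)),
      integral_finsetSum _ (fun i _ => integ hμ _ (by fun_prop))]
    apply Finset.sum_le_sum; intro j _
    by_cases hij : i = j
    · subst hij
      apply integral_mono (integ hμ _ (by fun_prop)) (integ hμ _ (by fun_prop))
      intro M
      simp only [sub_self]
      have : 0 ≤ cj A M i i ^ 2 := sq_nonneg _
      linarith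
    · exact diag_pair hμ A hij
  have h2 : ∫ M, ∑ i, ∑ j, 2 * (cj A M i j ^ 2 + cj A M j i ^ 2) ∂μ
      = 4 * ∑ i, ∑ j, A i j ^ 2 := by
    have : ∀ᵐ M ∂μ, ∑ i, ∑ j, 2 * (cj A M i j ^ 2 + cj A M j i ^ 2) = 4 * ∑ i, ∑ j, A i j ^ 2 := by
      filter_upwards [hμ.ae_orth] with M hM
      rw [← cj_frob A M hM]
      simp_rw [mul_add, Finset.sum_add_distrib]
      rw [Finset.sum_comm (f := fun i j => 2 * cj A M j i ^ 2)]
      simp_rw [← Finset.mul_sum]; ring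
    rw [integral_congr_ae this]; simp
  have h3 : ∫ M, ∑ i, ∑ j, (cj A M i i - cj A M j j) ^ 2 ∂μ
      = 2 * (n * ∫ M, ∑ i, cj A M i i ^ 2 ∂μ) - 2 * (∑ i, A i i) ^ 2 := by
    have : ∀ᵐ M ∂μ, ∑ i, ∑ j, (cj A M i i - cj A M j j) ^ 2
        = (2 * n) * (∑ i, cj A M i i ^ 2) - 2 * (∑ i, A i i) ^ 2 := by
      filter_upwards [hμ.ae_orth] with M hM
      rw [← cj_trace A M hM]
      simp_rw [sub_sq, Finset.sum_add_distrib, Finset.sum_sub_distrib]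
      simp_rw [← Finset.mul_sum, mul_assoc, ← Finset.mul_sum, ← Finset.sum_mul]
      simp [← Finset.mul_sum]
      ring
    rw [integral_congr_ae this, integral_sub (integ hμ _ (by fun_prop)) (integ hμ _ (by fun_prop)),
      integral_const_mul]
    simp; ring
  linarith

lemma frob_AAT {n : ℕ} (A : Matrix (Fin n) (Fin n) ℝ) :
    ∑ i, ∑ j, (A * Aᵀ) i j ^ 2 ≤ (∑ i, ∑ j, A i j ^ 2) ^ 2 := by
  rw [sq (∑ i, ∑ j, A i j ^ 2), Finset.sum_mul_sum]
  refine Finset.sum_le_sum (fun i _ => Finset.sum_le_sum (fun j _ => ?_))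
  rw [Matrix.mul_apply]
  exact Finset.sum_mul_sq_le_sq_mul_sq _ _ _

set_option maxHeartbeats 2000000 in
lemma off_bound {n : ℕ} (hn : 2 ≤ n) {μ : Measure (Matrix (Fin n) (Fin n) ℝ)}
    (hμ : IsHaarOrthogonal n μ) (A : Matrix (Fin n) (Fin n) ℝ)
    (hA : ∑ i, ∑ j, A i j ^ 2 = n) :
    ((n:ℝ) - 1) * ∫ M, ∑ i, ∑ j, (if i = j then 0 else cj A M i j ^ 4) ∂μ ≤ 9 * n := by
  have := hμ.isProb
  have hc := cj_entry A
  have hc' := cj_entry (A * Aᵀ)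
  have hn0 : (0:ℝ) < n := by positivity
  have hq : ∀ M i, ∑ j, (if i = j then 0 else cj A M i j ^ 4) = ∑ j ∈ Finset.univ.erase i, cj A M i j ^ 4 := by
    intro M i
    rw [← Finset.sum_erase_add Finset.univ _ (Finset.mem_univ i)]
    simp only [if_true, add_zero]
    apply Finset.sum_congr rfl
    intro j hj
    rw [if_neg (Finset.ne_of_mem_erase hj).symm]
  simp_rw [hq]
  have h1 : ∀ i, 2 * (((n:ℝ) - 1) * ∫ M, ∑ j ∈ Finset.univ.erase i, cj A M i j ^ 4 ∂μ)
      ≤ 6 * ∫ M, (cj (A * Aᵀ) M i i) ^ 2 ∂μ := by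
    intro i
    have e1 : ∀ M, ∑ j ∈ Finset.univ.erase i, ∑ k ∈ Finset.univ.erase i, (cj A M i j ^ 4 + cj A M i k ^ 4)
        = (2 * ((n:ℝ) - 1)) * ∑ j ∈ Finset.univ.erase i, cj A M i j ^ 4 := by
      intro M
      simp only [Finset.sum_add_distrib, Finset.sum_const, Finset.card_erase_of_mem (Finset.mem_univ i),
        Finset.card_univ, Fintype.card_fin, nsmul_eq_mul]
      rw [← Finset.mul_sum, Nat.cast_sub (by omega)]
      push_cast; ring
    have e2 : ∫ M, ∑ j ∈ Finset.univ.erase i, ∑ k ∈ Finset.univ.erase i, (cj A M i j ^ 4 + cj A M i k ^ 4) ∂μ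
        ≤ ∫ M, ∑ j ∈ Finset.univ.erase i, ∑ k ∈ Finset.univ.erase i, 6 * (cj A M i j ^ 2 * cj A M i k ^ 2) ∂μ := by
      rw [integral_finsetSum _ (fun i _ => integ hμ _ (by fun_prop)),
        integral_finsetSum _ (fun i _ => integ hμ _ (by fun_prop))]
      apply Finset.sum_le_sum; intro j hj
      rw [integral_finsetSum _ (fun i _ => integ hμ _ (by fun_prop)),
        integral_finsetSum _ (fun i _ => integ hμ _ (by fun_prop))]
      apply Finset.sum_le_sum; intro k hk
      exact off_pair hμ A (Finset.ne_of_mem_erase hj) (Finset.ne_of_mem_erase hk)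
    have e3 : ∫ M, ∑ j ∈ Finset.univ.erase i, ∑ k ∈ Finset.univ.erase i, 6 * (cj A M i j ^ 2 * cj A M i k ^ 2) ∂μ
        ≤ ∫ M, 6 * (cj (A * Aᵀ) M i i) ^ 2 ∂μ := by
      apply integral_mono_ae (integ hμ _ (by fun_prop)) (integ hμ _ (by fun_prop))
      filter_upwards [hμ.ae_orth] with M hM
      rw [← cj_row A M hM, sq, Finset.sum_mul_sum]
      simp_rw [← Finset.mul_sum]
      have hsub : ∑ j ∈ Finset.univ.erase i, cj A M i j ^ 2 ≤ ∑ j, cj A M i j ^ 2 :=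
        Finset.sum_le_sum_of_subset_of_nonneg (Finset.erase_subset _ _) (fun _ _ _ => sq_nonneg _)
      simp_rw [← Finset.sum_mul]
      have h0 : 0 ≤ ∑ j ∈ Finset.univ.erase i, cj A M i j ^ 2 := by positivity
      gcongr
    simp_rw [e1] at e2
    rw [integral_const_mul] at e2 e3
    linarith
  have h2 : 2 * (((n:ℝ) - 1) * ∫ M, ∑ i, ∑ j ∈ Finset.univ.erase i, cj A M i j ^ 4 ∂μ)
      ≤ 6 * ∫ M, ∑ i, (cj (A * Aᵀ) M i i) ^ 2 ∂μ := by
    rw [integral_finsetSum _ (fun i _ => integ hμ _ (by fun_prop)),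
        integral_finsetSum _ (fun i _ => integ hμ _ (by fun_prop))]
    rw [Finset.mul_sum, Finset.mul_sum, Finset.mul_sum]
    exact Finset.sum_le_sum (fun i _ => h1 i)
  have h3 := diag_bound hμ (A * Aᵀ)
  have h4 := frob_AAT A
  have h5 : ∑ i, (A * Aᵀ) i i = n := by rw [← hA, ← trace_sq]; rfl
  rw [hA] at h4
  rw [h5] at h3
  have h6 : ∫ M, ∑ i, (cj (A * Aᵀ) M i i) ^ 2 ∂μ ≤ 3 * n := by
    have : n * ∫ M, ∑ i, (cj (A * Aᵀ) M i i) ^ 2 ∂μ ≤ n * (3 * n) := by nlinarith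
    exact le_of_mul_le_mul_left this hn0
  linarith

lemma sign_orth {n : ℕ} (ε : Fin n → ℤˣ) :
    Matrix.diagonal (sg ε) * (Matrix.diagonal (sg ε))ᵀ = 1 := by
  rw [Matrix.diagonal_transpose, Matrix.diagonal_mul_diagonal, ← Matrix.diagonal_one]
  congr 1; funext i; exact sg_mul_self ε i

lemma cj_sign {n : ℕ} (A M : Matrix (Fin n) (Fin n) ℝ) (ε : Fin n → ℤˣ) (i j : Fin n) :
    cj A (M * Matrix.diagonal (sg ε)) i j = cj A M i j * (sg ε j * sg ε i) := by
  rw [cj_mul, Matrix.diagonal_transpose, Matrix.mul_diagonal, Matrix.diagonal_mul]; ring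

lemma trace_eq {n : ℕ} (A M : Matrix (Fin n) (Fin n) ℝ) (σ : Equiv.Perm (Fin n)) :
    Matrix.trace (A * M * σ.permMatrix ℝ * Mᵀ) = ∑ i, cj A M (σ i) i := by
  rw [Matrix.trace_mul_comm, ← Matrix.mul_assoc, ← Matrix.mul_assoc]
  change Matrix.trace (cj A M * σ.permMatrix ℝ) = _
  rw [Matrix.trace_mul_comm]
  simp only [Matrix.trace, Matrix.diag_apply, Matrix.mul_apply, Equiv.Perm.permMatrix,
    PEquiv.toMatrix_apply, Equiv.toPEquiv_apply]
  simp

/-- the characteristic function of the trace -/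
noncomputable def phi {n : ℕ} (μ : Measure (Matrix (Fin n) (Fin n) ℝ)) (A : Matrix (Fin n) (Fin n) ℝ)
    (t : ℝ) : ℂ :=
  𝔼 σ : Equiv.Perm (Fin n), ∫ M, Complex.exp (Complex.I * (t * ∑ i, cj A M (σ i) i : ℝ)) ∂μ

lemma phi_eq {n : ℕ} {μ : Measure (Matrix (Fin n) (Fin n) ℝ)} (hμ : IsHaarOrthogonal n μ)
    (A : Matrix (Fin n) (Fin n) ℝ) (t : ℝ) :
    phi μ A t = ∫ M, 𝔼 σ : Equiv.Perm (Fin n), 𝔼 ε : Fin n → ℤˣ,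
        Complex.exp (Complex.I * (t * ∑ i, cj A M (σ i) i * (sg ε i * sg ε (σ i)) : ℝ)) ∂μ := by
  have hc := cj_entry A
  have hcont : ∀ (σ : Equiv.Perm (Fin n)) (ε : Fin n → ℤˣ), Continuous (fun M =>
      Complex.exp (Complex.I * (t * ∑ i, cj A M (σ i) i * (sg ε i * sg ε (σ i)) : ℝ))) := by
    intro σ ε
    have : Continuous (fun M => (t * ∑ i, cj A M (σ i) i * (sg ε i * sg ε (σ i)) : ℝ)) := by fun_prop
    fun_prop
  have hcont0 : ∀ (σ : Equiv.Perm (Fin n)), Continuous (fun M =>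
      Complex.exp (Complex.I * (t * ∑ i, cj A M (σ i) i : ℝ))) := by
    intro σ
    have : Continuous (fun M => (t * ∑ i, cj A M (σ i) i : ℝ)) := by fun_prop
    fun_prop
  have key : ∀ (σ : Equiv.Perm (Fin n)) (ε : Fin n → ℤˣ),
      ∫ M, Complex.exp (Complex.I * (t * ∑ i, cj A M (σ i) i : ℝ)) ∂μ
      = ∫ M, Complex.exp (Complex.I * (t * ∑ i, cj A M (σ i) i * (sg ε i * sg ε (σ i)) : ℝ)) ∂μ := by
    intro σ ε
    rw [← invar hμ _ (hcont0 σ) _ (sign_orth ε)]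
    simp only [cj_sign]
  have exI : ∀ {ι : Type} [Fintype ι] (f : ι → Matrix (Fin n) (Fin n) ℝ → ℂ),
      (∀ i, Integrable (f i) μ) → ∫ M, 𝔼 i, f i M ∂μ = 𝔼 i, ∫ M, f i M ∂μ := by
    intro ι _ f hf
    simp only [Finset.expect, ← NNRat.cast_smul_eq_nnqsmul ℝ]
    rw [integral_smul, integral_finsetSum _ (fun i _ => hf i)]
  have hi : ∀ (σ : Equiv.Perm (Fin n)), Integrable (fun M => 𝔼 ε : Fin n → ℤˣ,
      Complex.exp (Complex.I * (t * ∑ i, cj A M (σ i) i * (sg ε i * sg ε (σ i)) : ℝ))) μ := by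
    intro σ
    simp only [Finset.expect, ← NNRat.cast_smul_eq_nnqsmul ℝ]
    exact (integrable_finset_sum _ (fun ε _ => integ hμ _ (hcont σ ε))).smul _
  rw [exI _ hi]
  unfold phi
  apply Finset.expect_congr rfl
  intro σ _
  rw [exI _ (fun ε => integ hμ _ (hcont σ ε))]
  rw [← Finset.expect_congr rfl (fun ε _ => key σ ε)]
  rw [Finset.expect_const Finset.univ_nonempty]

lemma phi_bound {n : ℕ} (hn : 2 ≤ n) {μ : Measure (Matrix (Fin n) (Fin n) ℝ)}
    (hμ : IsHaarOrthogonal n μ) (A : Matrix (Fin n) (Fin n) ℝ)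
    (hA : ∑ i, ∑ j, A i j ^ 2 = n) (s t η : ℝ)
    (hη : 0 < η) (hη1 : η ≤ 1) (hs : s ^ 2 ≤ 1) :
    ‖phi μ A t - (𝔼 σ : Equiv.Perm (Fin n), Complex.exp (Complex.I * (t * (s * fixn σ) : ℝ)))
        * (Real.exp (-((1 - s^2) * t ^ 2 / 2)) : ℂ)‖
      ≤ (4 * t ^ 2 + 24 * |t| ^ 3 + |t|) * (η + (2 * (((∑ i, A i i) / n - s) ^ 2 + 2 / n)
        + 9 / ((n:ℝ) - 1) + 1 / ((n:ℝ) - 1)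
        + 2 * |s| * |(∑ i, A i i) / n - s|) / η) := by
  have := hμ.isProb
  have hc := cj_entry A
  have hn2 : (2:ℝ) ≤ n := by exact_mod_cast hn
  have hn0 : (0:ℝ) < n := by linarith
  have hn1 : (0:ℝ) < (n:ℝ) - 1 := by linarith
  set K := (𝔼 σ : Equiv.Perm (Fin n), Complex.exp (Complex.I * (t * (s * fixn σ) : ℝ)))
        * (Real.exp (-((1 - s^2) * t ^ 2 / 2)) : ℂ) with hK
  set C := 4 * t ^ 2 + 24 * |t| ^ 3 + |t| with hC
  have hC0 : 0 ≤ C := by positivity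
  set T := ∑ i, A i i with hT
  set F : Matrix (Fin n) (Fin n) ℝ → ℂ := fun M => 𝔼 σ : Equiv.Perm (Fin n), 𝔼 ε : Fin n → ℤˣ,
        Complex.exp (Complex.I * (t * ∑ i, cj A M (σ i) i * (sg ε i * sg ε (σ i)) : ℝ)) with hF
  have hFc : Continuous F := by
    simp only [hF, Finset.expect, ← NNRat.cast_smul_eq_nnqsmul ℝ]
    have : ∀ (σ : Equiv.Perm (Fin n)) (ε : Fin n → ℤˣ), Continuous (fun M => (t * ∑ i, cj A M (σ i) i * (sg ε i * sg ε (σ i)) : ℝ)) := by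
      intro σ ε; fun_prop
    fun_prop
  have hphi : phi μ A t - K = ∫ M, (F M - K) ∂μ := by
    rw [integral_sub (integ hμ _ hFc) (integrable_const _), phi_eq hμ]
    simp [hF]
  set a : Matrix (Fin n) (Fin n) ℝ → ℝ := fun M => ∑ i, (cj A M i i - s) ^ 2 with ha
  set b : Matrix (Fin n) (Fin n) ℝ → ℝ := fun M => ∑ i, ∑ j, if i = j then 0 else cj A M i j ^ 4 with hb
  have hac : Continuous a := by fun_prop
  have hbc : Continuous b := by
    refine continuous_finset_sum _ (fun i _ => continuous_finset_sum _ (fun j _ => ?_))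
    by_cases h : i = j
    · simp only [h, if_true]; exact continuous_const
    · simp only [h, if_false]; fun_prop
  set R := 1 / ((n:ℝ) - 1) + 2 * |s| * |T / n - s| with hR
  have h1 : ‖phi μ A t - K‖ ≤ ∫ M, C * (η + (2 * (a M / n) + b M / n + R) / η) ∂μ := by
    rw [hphi]
    apply norm_integral_le_of_norm_le (integ hμ _ (by fun_prop))
    filter_upwards [hμ.ae_orth] with M hM
    have := matrix_bound hn (cj A M) s t η hη hη1 hs (by rw [cj_frob A M hM, hA])
    rw [cj_trace A M hM] at this
    refine this.trans (le_of_eq ?_)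
    simp only [hR, ha, hb, hC, hT]
    ring
  have h2 : ∫ M, C * (η + (2 * (a M / n) + b M / n + R) / η) ∂μ
      = C * (η + (2 * ((∫ M, a M ∂μ) / n) + (∫ M, b M ∂μ) / n + R) / η) := by
    have i1 := integ hμ a hac
    have i2 := integ hμ b hbc
    rw [integral_const_mul, integral_add (integrable_const _) (integ hμ _ (by fun_prop)), integral_div,
      integral_add (integ hμ _ (by fun_prop)) (integrable_const _),
      integral_add (integ hμ _ (by fun_prop)) (integ hμ _ (by fun_prop)),
      integral_const_mul, integral_div, integral_div]
    simp
  have h3 : (∫ M, b M ∂μ) / n ≤ 9 / ((n:ℝ) - 1) := by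
    have := off_bound hn hμ A hA
    rw [div_le_div_iff₀ hn0 hn1]
    linarith
  have h4 : (∫ M, a M ∂μ) / n ≤ (T / n - s) ^ 2 + 2 / n := by
    have e := diag_bound hμ A
    have e1 : ∫ M, a M ∂μ = (∫ M, ∑ i, cj A M i i ^ 2 ∂μ) - 2 * s * T + n * s ^ 2 := by
      have : ∀ᵐ M ∂μ, a M = (∑ i, cj A M i i ^ 2) + (- 2 * s * T + n * s ^ 2) := by
        filter_upwards [hμ.ae_orth] with M hM
        rw [hT, ← cj_trace A M hM]
        simp only [ha, sub_sq, Finset.sum_add_distrib, Finset.sum_sub_distrib, ← Finset.sum_mul,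
          ← Finset.mul_sum]
        simp; ring
      rw [integral_congr_ae this, integral_add (integ hμ _ (by fun_prop)) (integrable_const _)]
      simp; ring
    rw [hA, ← hT] at e
    rw [e1, div_le_iff₀ hn0]
    have e2 : ((T / n - s) ^ 2 + 2 / n) * n = (T ^ 2 + 2 * n) / n - 2 * s * T + n * s ^ 2 := by
      field_simp; ring
    have e3 : ∫ M, ∑ i, cj A M i i ^ 2 ∂μ ≤ (T ^ 2 + 2 * n) / n := by
      rw [le_div_iff₀ hn0]; linarith
    rw [e2]; linarith
  refine h1.trans (h2.le.trans ?_)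
  have : 2 * ((T / n - s) ^ 2 + 2 / n) + 9 / ((n:ℝ) - 1) + 1 / ((n:ℝ) - 1) + 2 * |s| * |T / n - s|
    = 2 * ((T / n - s) ^ 2 + 2 / n) + 9 / ((n:ℝ) - 1) + R := by rw [hR]; ring
  rw [this]
  gcongr

lemma mean_sq_le {n : ℕ} (A : Matrix (Fin n) (Fin n) ℝ) (hA : ∑ i, ∑ j, A i j ^ 2 = n) :
    ((∑ i, A i i) / n) ^ 2 ≤ 1 := by
  have h1 : (∑ i, A i i) ^ 2 ≤ n * ∑ i, A i i ^ 2 := by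
    simpa using sq_sum_le_card_mul_sum_sq (s := Finset.univ) (f := fun i => A i i)
  have h2 : ∑ i, A i i ^ 2 ≤ n := by
    rw [← hA]
    exact Finset.sum_le_sum (fun i _ => Finset.single_le_sum (f := fun j => A i j ^ 2)
      (fun j _ => sq_nonneg _) (Finset.mem_univ i))
  rw [div_pow]
  apply div_le_one_of_le₀ _ (by positivity)
  have : (0:ℝ) ≤ n := by positivity
  nlinarith

lemma phi_tendsto (A : ∀ n : ℕ, Matrix (Fin n) (Fin n) ℝ)
    (hA : ∀ n, ∑ i, ∑ j, A n i j ^ 2 = n) (s : ℝ)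
    (hs : Filter.Tendsto (fun n => (∑ i, A n i i) / (n : ℝ)) Filter.atTop (nhds s))
    (μ : ∀ n : ℕ, Measure (Matrix (Fin n) (Fin n) ℝ))
    (hμ : ∀ n, IsHaarOrthogonal n (μ n)) (hs1 : s ^ 2 ≤ 1) (t : ℝ) :
    Filter.Tendsto (fun n => phi (μ n) (A n) t) Filter.atTop
      (nhds (Complex.exp (Complex.exp (Complex.I * (t * s : ℝ)) - 1)
        * (Real.exp (-((1 - s^2) * t ^ 2 / 2)) : ℂ))) := by
  have h1 : Filter.Tendsto (fun n => (𝔼 σ : Equiv.Perm (Fin n),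
      Complex.exp (Complex.I * (t * (s * fixn σ) : ℝ))) * (Real.exp (-((1 - s^2) * t ^ 2 / 2)) : ℂ))
      Filter.atTop (nhds (Complex.exp (Complex.exp (Complex.I * (t * s : ℝ)) - 1)
        * (Real.exp (-((1 - s^2) * t ^ 2 / 2)) : ℂ))) := by
    apply Filter.Tendsto.mul_const
    have e := expect_fix_tendsto (Complex.exp (Complex.I * (t * s : ℝ)))
    refine e.congr ?_
    intro n
    apply Finset.expect_congr rfl
    intro σ _
    rw [← Complex.exp_nat_mul]
    congr 1
    unfold fixn
    push_cast; ring
  set C := 4 * t ^ 2 + 24 * |t| ^ 3 + |t| with hC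
  have hC0 : 0 ≤ C := by positivity
  have hn1 : Filter.Tendsto (fun n : ℕ => (n:ℝ) - 1) Filter.atTop Filter.atTop :=
    Filter.tendsto_atTop_add_const_right _ (-1) tendsto_natCast_atTop_atTop
  have hr : Filter.Tendsto (fun n : ℕ => 2 * (((∑ i, A n i i) / n - s) ^ 2 + 2 / n)
        + 9 / ((n:ℝ) - 1) + 1 / ((n:ℝ) - 1) + 2 * |s| * |(∑ i, A n i i) / n - s|)
        Filter.atTop (nhds (2 * ((s - s) ^ 2 + 0) + 0 + 0 + 2 * |s| * |s - s|)) := by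
    have t0 := hs.sub_const s
    refine Filter.Tendsto.add (Filter.Tendsto.add (Filter.Tendsto.add (Filter.Tendsto.const_mul _
      (Filter.Tendsto.add (t0.pow 2) ?_)) ?_) ?_) (Filter.Tendsto.const_mul _ t0.abs)
    · exact tendsto_natCast_atTop_atTop.const_div_atTop 2
    · exact hn1.const_div_atTop 9
    · exact hn1.const_div_atTop 1
  simp only [sub_self, abs_zero, mul_zero, add_zero, ne_eq, OfNat.ofNat_ne_zero, not_false_eq_true,
    zero_pow] at hr
  have h2 : Filter.Tendsto (fun n => phi (μ n) (A n) t - (𝔼 σ : Equiv.Perm (Fin n),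
      Complex.exp (Complex.I * (t * (s * fixn σ) : ℝ))) * (Real.exp (-((1 - s^2) * t ^ 2 / 2)) : ℂ))
      Filter.atTop (nhds 0) := by
    rw [Metric.tendsto_nhds]
    intro δ hδ
    set η := min 1 (δ / (2 * (C + 1))) with hη
    have hη0 : 0 < η := by positivity
    have hη1 : η ≤ 1 := min_le_left _ _
    have hη2 : C * η < δ := by
      have e : η ≤ δ / (2 * (C + 1)) := min_le_right _ _
      rw [le_div_iff₀ (by positivity)] at e
      nlinarith
    have lim := ((hr.div_const η).const_add η).const_mul C
    rw [zero_div, add_zero] at lim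
    filter_upwards [lim.eventually_lt_const hη2, Filter.eventually_ge_atTop 2] with n hn hn2
    rw [dist_zero_right]
    exact (phi_bound hn2 (hμ n) (A n) (hA n) s t η hη0 hη1 hs1).trans_lt hn
  have h3 := h2.add h1
  simpa using h3

/-- the law of the trace -/
noncomputable def lawW {n : ℕ} (μ : Measure (Matrix (Fin n) (Fin n) ℝ)) (A : Matrix (Fin n) (Fin n) ℝ) :
    Measure ℝ :=
  ((n.factorial : ENNReal)⁻¹) • ∑ σ : Equiv.Perm (Fin n), μ.map (fun M => ∑ i, cj A M (σ i) i)

lemma W_cont {n : ℕ} (A : Matrix (Fin n) (Fin n) ℝ) (σ : Equiv.Perm (Fin n)) :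
    Continuous (fun M => ∑ i, cj A M (σ i) i) := by
  have hc := cj_entry A
  fun_prop

lemma lawW_prob {n : ℕ} {μ : Measure (Matrix (Fin n) (Fin n) ℝ)} (hμ : IsHaarOrthogonal n μ)
    (A : Matrix (Fin n) (Fin n) ℝ) : IsProbabilityMeasure (lawW μ A) := by
  have := hμ.isProb
  constructor
  unfold lawW
  rw [Measure.smul_apply, Measure.finsetSum_apply]
  have : ∀ σ : Equiv.Perm (Fin n), (μ.map (fun M => ∑ i, cj A M (σ i) i)) Set.univ = 1 := by
    intro σ
    rw [Measure.map_apply (W_cont A σ).measurable MeasurableSet.univ]; simp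
  simp only [this]
  simp only [Finset.sum_const, Finset.card_univ, Fintype.card_perm, Fintype.card_fin, smul_eq_mul,
    nsmul_eq_mul, mul_one]
  exact ENNReal.inv_mul_cancel (by exact_mod_cast (Nat.factorial_ne_zero n)) (ENNReal.natCast_ne_top _)

lemma lawW_integral {n : ℕ} {μ : Measure (Matrix (Fin n) (Fin n) ℝ)} (hμ : IsHaarOrthogonal n μ)
    (A : Matrix (Fin n) (Fin n) ℝ) {E : Type*} [NormedAddCommGroup E] [NormedSpace ℝ E]
    [SecondCountableTopology E] (f : ℝ → E) (hf : Continuous f) :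
    ∫ x, f x ∂(lawW μ A) = (1 / (n.factorial : ℝ)) •
      ∑ σ : Equiv.Perm (Fin n), ∫ M, f (∑ i, cj A M (σ i) i) ∂μ := by
  unfold lawW
  rw [integral_smul_measure, integral_finsetSum_measure]
  · simp only [ENNReal.toReal_inv, ENNReal.toReal_natCast, one_div]
    congr 1
    apply Finset.sum_congr rfl
    intro σ _
    rw [integral_map (W_cont A σ).measurable.aemeasurable hf.aestronglyMeasurable]
  · intro σ _
    rw [integrable_map_measure hf.aestronglyMeasurable (W_cont A σ).measurable.aemeasurable]
    exact integ hμ _ (hf.comp (W_cont A σ))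

lemma lawW_charFun {n : ℕ} {μ : Measure (Matrix (Fin n) (Fin n) ℝ)} (hμ : IsHaarOrthogonal n μ)
    (A : Matrix (Fin n) (Fin n) ℝ) (t : ℝ) : charFun (lawW μ A) t = phi μ A t := by
  rw [charFun_apply_real, lawW_integral hμ A _ (by fun_prop)]
  unfold phi
  rw [Finset.expect, ← NNRat.cast_smul_eq_nnqsmul ℝ]
  simp only [Finset.card_univ, Fintype.card_perm, Fintype.card_fin, NNRat.cast_inv, NNRat.cast_natCast,
    one_div]
  congr 1
  apply Finset.sum_congr rfl
  intro σ _
  congr 1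
  funext M
  congr 1
  push_cast; ring

/-- the limit law -/
noncomputable def limLaw (s : ℝ) : Measure ℝ :=
  ((gaussianReal 0 (Real.toNNReal (1 - s ^ 2))).prod (poissonMeasure 1)).map
    (fun p : ℝ × ℕ => p.1 + s * p.2)

lemma lim_meas (s : ℝ) : Measurable (fun p : ℝ × ℕ => p.1 + s * (p.2 : ℝ)) := by
  have : Measurable (fun k : ℕ => (k:ℝ)) := measurable_from_top
  fun_prop

lemma limLaw_prob (s : ℝ) : IsProbabilityMeasure (limLaw s) :=
  Measure.isProbabilityMeasure_map (lim_meas s).aemeasurable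

lemma limLaw_charFun (s t : ℝ) (hs1 : s ^ 2 ≤ 1) : charFun (limLaw s) t =
    Complex.exp (Complex.exp (Complex.I * (t * s : ℝ)) - 1)
        * (Real.exp (-((1 - s^2) * t ^ 2 / 2)) : ℂ) := by
  rw [charFun_apply_real]
  unfold limLaw
  rw [integral_map (lim_meas s).aemeasurable
    (Continuous.aestronglyMeasurable (by fun_prop))]
  have e : ∀ p : ℝ × ℕ, Complex.exp (t * ((p.1 + s * (p.2:ℝ) : ℝ) : ℂ) * Complex.I)
      = Complex.exp (t * (p.1 : ℂ) * Complex.I)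
        * (fun k : ℕ => Complex.exp ((t * s : ℝ) * ((k : ℝ) : ℂ) * Complex.I)) p.2 := by
    intro p
    rw [← Complex.exp_add]; congr 1; push_cast; ring
  simp_rw [e]
  rw [integral_prod_mul (fun x : ℝ => Complex.exp (t * (x : ℂ) * Complex.I))
    (fun k : ℕ => Complex.exp ((t * s : ℝ) * ((k : ℝ) : ℂ) * Complex.I))]
  rw [← charFun_apply_real, charFun_gaussianReal]
  have h := charFun_map_cast_poissonMeasure 1 (t * s)
  rw [charFun_apply_real, integral_map .of_discrete (Continuous.aestronglyMeasurable (by fun_prop))] at h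
  rw [h, mul_comm]
  have h0 : (0:ℝ) ≤ 1 - s ^ 2 := by linarith
  have h1 : (((Real.toNNReal (1 - s ^ 2) : NNReal) : ℝ)) = 1 - s ^ 2 := Real.coe_toNNReal _ h0
  congr 1
  · congr 1; simp; ring_nf
  · rw [Complex.ofReal_exp, h1]; congr 1; push_cast; ring

end Aux18

/-- with `Tr(A_n A_nᵀ) = n`, `∑_i A_{ii}/n → s`, `M` Haar on `O(n)` and `P`
an independent uniform random permutation matrix, `Tr(A_n M P Mᵀ)` converges in
distribution to `Z + s·Y` with `Z ~ N(0, 1 − s²)` and `Y ~ Poisson(1)` independent.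
The law of `Tr(A_n M P Mᵀ)` is the uniform mixture over `σ ∈ S_n`. -/
theorem stmt18 (A : ∀ n : ℕ, Matrix (Fin n) (Fin n) ℝ)
    (hA : ∀ n, Matrix.trace (A n * (A n)ᵀ) = (n : ℝ))
    (s : ℝ)
    (hs : Filter.Tendsto (fun n => (∑ i, A n i i) / (n : ℝ)) Filter.atTop (nhds s))
    (μ : ∀ n : ℕ, Measure (Matrix (Fin n) (Fin n) ℝ))
    (hμ : ∀ n, IsHaarOrthogonal n (μ n)) :
    ∀ g : ℝ →ᵇ ℝ,
      Filter.Tendsto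
        (fun n => (1 / (Nat.factorial n : ℝ)) *
          ∑ σ : Equiv.Perm (Fin n),
            ∫ M, g (Matrix.trace (A n * M * σ.permMatrix ℝ * Mᵀ)) ∂(μ n))
        Filter.atTop
        (nhds (∫ p : ℝ × ℕ, g (p.1 + s * p.2)
          ∂((gaussianReal 0 (Real.toNNReal (1 - s ^ 2))).prod (poissonMeasure 1)))) := by
  intro g
  have hA' : ∀ n, ∑ i, ∑ j, A n i j ^ 2 = n := fun n => by rw [← hA n, Aux18.trace_sq]
  have hs1 : s ^ 2 ≤ 1 :=
    le_of_tendsto (hs.pow 2) (Filter.Eventually.of_forall (fun n => Aux18.mean_sq_le (A n) (hA' n)))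
  let ν : ℕ → ProbabilityMeasure ℝ := fun n =>
    ⟨Aux18.lawW (μ n) (A n), Aux18.lawW_prob (hμ n) (A n)⟩
  let ν₀ : ProbabilityMeasure ℝ := ⟨Aux18.limLaw s, Aux18.limLaw_prob s⟩
  have key : Filter.Tendsto ν Filter.atTop (nhds ν₀) := by
    rw [ProbabilityMeasure.tendsto_iff_tendsto_charFun]
    intro t
    change Filter.Tendsto (fun n => charFun (Aux18.lawW (μ n) (A n)) t) Filter.atTop
      (nhds (charFun (Aux18.limLaw s) t))
    rw [Aux18.limLaw_charFun s t hs1]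
    simp_rw [fun n => Aux18.lawW_charFun (hμ n) (A n) t]
    exact Aux18.phi_tendsto A hA' s hs μ hμ hs1 t
  rw [ProbabilityMeasure.tendsto_iff_forall_integral_tendsto] at key
  have h := key g
  change Filter.Tendsto (fun n => ∫ x, g x ∂(Aux18.lawW (μ n) (A n))) Filter.atTop
      (nhds (∫ x, g x ∂(Aux18.limLaw s))) at h
  simp_rw [fun n => Aux18.lawW_integral (hμ n) (A n) g g.continuous, smul_eq_mul] at h
  rw [Aux18.limLaw, integral_map (Aux18.lim_meas s).aemeasurable
    g.continuous.aestronglyMeasurable] at h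
  simp_rw [Aux18.trace_eq]
  exact h
end

section
/- Let 0 < α ≤ 1 and let A_n be the diagonal n×n matrix with A_{ii} = 1/√α for 1 ≤ i ≤ ⌊αn⌋ and 0 otherwise (normalized so Tr(A_n A_nᵀ) = n). Let M be Haar-distributed on O(n) and P an independent uniform random permutation matrix. Then Tr(A_n M P Mᵀ) converges in distribution to Z + √α · Y, where Z ~ N(0, 1 − α) and Y ~ Poisson(1) are independent. -/
open MeasureTheory Matrix

open ProbabilityTheory BoundedContinuousFunction

namespace HaarAux

instance matrixBorel (n : ℕ) : BorelSpace (Matrix (Fin n) (Fin n) ℝ) :=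
  inferInstanceAs (BorelSpace ((Fin n) → (Fin n) → ℝ))

abbrev Mat (n : ℕ) := Matrix (Fin n) (Fin n) ℝ

lemma compact_orth (n : ℕ) : IsCompact {M : Mat n | M * Mᵀ = 1} := by
  have h1 : IsCompact (Set.pi Set.univ fun _ : Fin n => Set.pi Set.univ fun _ : Fin n =>
      Set.Icc (-1 : ℝ) 1) :=
    isCompact_univ_pi fun _ => isCompact_univ_pi fun _ => isCompact_Icc
  refine h1.of_isClosed_subset ?_ ?_
  · exact isClosed_eq (by fun_prop) continuous_const
  · intro M0 hM i _ j _
    let M : Mat n := M0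
    change M i j ∈ _
    have h2 : (M * Mᵀ) i i = 1 := by rw [show M * Mᵀ = 1 from hM]; simp
    rw [Matrix.mul_apply] at h2
    have h3 : M i j * M i j ≤ 1 := by
      rw [← h2]
      exact Finset.single_le_sum (f := fun j => M i j * Mᵀ j i)
        (fun k _ => mul_self_nonneg (M i k)) (Finset.mem_univ j)
    rw [Set.mem_Icc]
    constructor <;> nlinarith

variable {n : ℕ} {μ : Measure (Mat n)} {E : Type*} [NormedAddCommGroup E] 

lemma exists_bound {F : Mat n → E} (hF : Continuous F) :
    ∃ C, ∀ M : Mat n, M * Mᵀ = 1 → ‖F M‖ ≤ C := by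
  obtain ⟨C, hC⟩ := (compact_orth n).exists_bound_of_continuousOn hF.continuousOn
  exact ⟨C, fun M hM => hC M hM⟩

lemma integrable_cont [SecondCountableTopology E] [MeasurableSpace E] [BorelSpace E]
    (hμ : IsHaarOrthogonal n μ) {F : Mat n → E} (hF : Continuous F) :
    Integrable F μ := by
  have := hμ.isProb
  obtain ⟨C, hC⟩ := exists_bound hF
  refine Integrable.of_bound hF.measurable.aestronglyMeasurable C ?_
  filter_upwards [hμ.ae_orth] with M hM using hC M hM

end HaarAux

namespace HaarAux
variable {n : ℕ} {μ : Measure (Mat n)} 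

section rot
open scoped Matrix.Norms.Operator

noncomputable def rot (X : Mat n) (θ : ℝ) : Mat n := NormedSpace.exp (θ • X)

lemma rot_zero (X : Mat n) : rot X 0 = 1 := by simp [rot]

lemma rot_add (X : Mat n) (s t : ℝ) : rot X (s + t) = rot X s * rot X t := by
  unfold rot
  rw [add_smul, Matrix.exp_add_of_commute]
  exact (Commute.refl X).smul_left s |>.smul_right t

lemma rot_orth (X : Mat n) (hX : Xᵀ = -X) (t : ℝ) : rot X t * (rot X t)ᵀ = 1 := by
  have : (rot X t)ᵀ = rot X (-t) := by
    unfold rot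
    rw [← Matrix.exp_transpose, transpose_smul, hX, smul_neg, neg_smul]
  rw [this, ← rot_add, add_neg_cancel, rot_zero]

lemma rot_deriv (X : Mat n) (c d : Fin n) :
    HasDerivAt (fun θ => rot X θ c d) (X c d) 0 := by
  have h := hasDerivAt_exp_smul_const (𝕂 := ℝ) X (0 : ℝ)
  simp only [zero_smul, NormedSpace.exp_zero, one_mul] at h
  have h2 := (LinearMap.toContinuousLinearMap (Matrix.entryLinearMap ℝ ℝ c d)).hasFDerivAt.comp_hasDerivAt (0 : ℝ) h
  exact h2

lemma rot_cont (X : Mat n) : Continuous (rot X) := by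
  unfold rot
  have : Continuous (NormedSpace.exp : Mat n → Mat n) := NormedSpace.exp_continuous
  exact this.comp (by fun_prop)

end rot

lemma rot_conj_deriv (X B : Mat n) (hX : Xᵀ = -X) (c d : Fin n) :
    HasDerivAt (fun θ => (rot X θ * B * (rot X θ)ᵀ) c d) ((X * B - B * X) c d) 0 := by
  have h : HasDerivAt (fun θ => ∑ l, (∑ k, rot X θ c k * B k l) * rot X θ d l)
      (∑ l, ((∑ k, X c k * B k l) * rot X 0 d l + (∑ k, rot X 0 c k * B k l) * X d l)) 0 := by
    refine HasDerivAt.fun_sum fun l _ => ?_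
    refine HasDerivAt.fun_mul ?_ (rot_deriv X d l)
    refine HasDerivAt.fun_sum fun k _ => ?_
    exact (rot_deriv X c k).mul_const _
  have hX' : ∀ l, X d l = - X l d := fun l => by
    have := congrFun (congrFun hX l) d
    simpa using this
  have e1 : (fun θ => (rot X θ * B * (rot X θ)ᵀ) c d) =
      fun θ => ∑ l, (∑ k, rot X θ c k * B k l) * rot X θ d l := by
    ext θ; simp [Matrix.mul_apply]
  have e2 : (X * B - B * X) c d =
      ∑ l, ((∑ k, X c k * B k l) * rot X 0 d l + (∑ k, rot X 0 c k * B k l) * X d l) := by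
    simp [rot_zero, Matrix.one_apply, Finset.sum_add_distrib, Matrix.sub_apply, Matrix.mul_apply,
      hX', sub_eq_add_neg]
  rw [e1, e2]
  exact h

variable {E : Type*} [NormedAddCommGroup E] [NormedSpace ℝ E] [SecondCountableTopology E]
  [MeasurableSpace E] [BorelSpace E]

/-- Integration by parts on the orthogonal group. -/
lemma ibp (hμ : IsHaarOrthogonal n μ) (X : Mat n) (hX : Xᵀ = -X) (S : Mat n)
    {Φ Φ' : Mat n → E} (hc : Continuous Φ) (hc' : Continuous Φ')
    (hd : ∀ b : ℝ → Mat n, (∀ c d, HasDerivAt (fun θ => b θ c d) ((X * b 0 - b 0 * X) c d) 0) →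
      HasDerivAt (fun θ => Φ (b θ)) (Φ' (b 0)) 0) :
    ∫ M, Φ' (M * S * Mᵀ) ∂μ = 0 := by
  have := hμ.isProb
  obtain ⟨C, hC⟩ := exists_bound (F := fun M : Mat n => Φ' (M * S * Mᵀ)) (by fun_prop)
  have hder : ∀ (M : Mat n) (θ : ℝ), HasDerivAt
      (fun θ => Φ ((rot X θ * M) * S * (rot X θ * M)ᵀ))
      (Φ' ((rot X θ * M) * S * (rot X θ * M)ᵀ)) θ := by
    intro M θ
    have h0 := hd (fun s => rot X s * ((rot X θ * M) * S * (rot X θ * M)ᵀ) * (rot X s)ᵀ) (by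
      intro c d
      have := rot_conj_deriv X ((rot X θ * M) * S * (rot X θ * M)ᵀ) hX c d
      simpa [rot_zero] using this)
    have h1 : HasDerivAt (fun s : ℝ => s - θ) 1 θ := by
      simpa using (hasDerivAt_id θ).sub_const θ
    have h0' : HasDerivAt (fun s => Φ (rot X s * ((rot X θ * M) * S * (rot X θ * M)ᵀ) * (rot X s)ᵀ))
      (Φ' ((rot X θ * M) * S * (rot X θ * M)ᵀ)) (θ - θ) := by
      simpa [rot_zero] using h0
    have h2 := HasDerivAt.scomp (h := fun s : ℝ => s - θ) θ h0' h1
    rw [one_smul] at h2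
    refine h2.congr_of_eventuallyEq (Filter.Eventually.of_forall fun s => ?_)
    simp only [Function.comp]
    have : rot X s = rot X (s - θ) * rot X θ := by rw [← rot_add]; simp
    rw [this]
    simp only [Matrix.transpose_mul, Matrix.mul_assoc]
  have hinv : ∀ θ, ∫ M, Φ ((rot X θ * M) * S * (rot X θ * M)ᵀ) ∂μ = ∫ M, Φ (M * S * Mᵀ) ∂μ := by
    intro θ
    have hcc : Continuous fun M : Mat n => rot X θ * M := by fun_prop
    conv_rhs => rw [← hμ.left_inv (rot X θ) (rot_orth X hX θ)]
    rw [integral_map hcc.measurable.aemeasurable]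
    exact (Continuous.measurable (by fun_prop)).aestronglyMeasurable
  have key := hasDerivAt_integral_of_dominated_loc_of_deriv_le (μ := μ) (x₀ := (0:ℝ))
    (F := fun θ M => Φ ((rot X θ * M) * S * (rot X θ * M)ᵀ))
    (F' := fun θ M => Φ' ((rot X θ * M) * S * (rot X θ * M)ᵀ)) (s := Set.univ) (bound := fun _ => C)
    Filter.univ_mem
    (Filter.Eventually.of_forall fun θ => (Continuous.measurable (by fun_prop)).aestronglyMeasurable)
    (integrable_cont hμ (by fun_prop))
    (Continuous.measurable (by fun_prop)).aestronglyMeasurable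
    (by
      filter_upwards [hμ.ae_orth] with M hM θ _
      apply hC
      rw [transpose_mul, Matrix.mul_assoc, ← Matrix.mul_assoc M, hM, Matrix.one_mul, rot_orth X hX])
    (integrable_const C)
    (Filter.Eventually.of_forall fun M θ _ => hder M θ)
  have h3 := key.2
  simp only [hinv] at h3
  have h4 := h3.unique (hasDerivAt_const _ _)
  simpa [rot_zero] using h4

end HaarAux

namespace HaarAux
variable {n : ℕ} {μ : Measure (Mat n)} 

/-- skew generator -/
def Ek (i j : Fin n) : Mat n := Matrix.single i j 1 - Matrix.single j i 1

lemma Ek_skew (i j : Fin n) : (Ek i j)ᵀ = - Ek i j := by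
  simp [Ek, Matrix.transpose_single]

/-- entries of the commutator -/
def cm (i j : Fin n) (B : Mat n) (c d : Fin n) : ℝ :=
  (if c = i then B j d else 0) - (if c = j then B i d else 0) - (if d = j then B c i else 0)
    + (if d = i then B c j else 0)

lemma Ek_comm (i j : Fin n) (B : Mat n) (c d : Fin n) :
    (Ek i j * B - B * Ek i j) c d = cm i j B c d := by
  simp only [Ek, cm, Matrix.sub_mul, Matrix.mul_sub, Matrix.sub_apply, Matrix.mul_apply,
    Matrix.single_apply]
  simp only [ite_and, ite_mul, mul_ite, one_mul, zero_mul, mul_one, mul_zero]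
  simp [Finset.sum_ite_eq, eq_comm]
  ring

def Wf (p : Fin n → ℝ) (B : Mat n) : ℝ := ∑ i, p i * B i i
def Qf (p : Fin n → ℝ) (B : Mat n) : ℝ := ∑ c, ∑ d, p c * (1 - p d) * (B c d * B c d)
def Gf (p : Fin n → ℝ) (B : Mat n) (i j : Fin n) : ℝ := ∑ d, (1 - 2 * p d) * (B i d * B d j)
def Kf (p : Fin n → ℝ) (B : Mat n) (i j : Fin n) : ℝ :=
  2 * ∑ d, (1 - p d) * (B i d * B j d) - 2 * ∑ c, p c * (B c i * B c j)

@[fun_prop] lemma Wf_cont (p : Fin n → ℝ) : Continuous (Wf p) := by unfold Wf; fun_prop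
@[fun_prop] lemma Qf_cont (p : Fin n → ℝ) : Continuous (Qf p) := by unfold Qf; fun_prop
@[fun_prop] lemma Gf_cont (p : Fin n → ℝ) (i j : Fin n) : Continuous (fun B => Gf p B i j) := by
  unfold Gf; fun_prop
@[fun_prop] lemma Kf_cont (p : Fin n → ℝ) (i j : Fin n) : Continuous (fun B => Kf p B i j) := by
  unfold Kf; fun_prop

section deriv
variable {p : Fin n → ℝ} {i j : Fin n} {b : ℝ → Mat n}

lemma Wf_deriv (hi : p i = 1) (hj : p j = 0)
    (hb : ∀ c d, HasDerivAt (fun θ => b θ c d) (cm i j (b 0) c d) 0) :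
    HasDerivAt (fun θ => Wf p (b θ)) (b 0 i j + b 0 j i) 0 := by
  have h : HasDerivAt (fun θ => Wf p (b θ)) (∑ c, p c * cm i j (b 0) c c) 0 :=
    HasDerivAt.fun_sum fun c _ => (hb c c).const_mul _
  convert h using 1
  simp only [cm, mul_add, mul_sub, Finset.sum_add_distrib, Finset.sum_sub_distrib, mul_ite, mul_zero,
    Finset.sum_ite_eq', Finset.mem_univ, if_true, hi, hj]
  ring

lemma entry_deriv (_hi : p i = 1) (_hj : p j = 0)
    (hb : ∀ c d, HasDerivAt (fun θ => b θ c d) (cm i j (b 0) c d) 0)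
    (hij : i ≠ j) : HasDerivAt (fun θ => b θ i j) (b 0 j j - b 0 i i) 0 := by
  have h := hb i j
  simpa [cm, hij, hij.symm] using h

lemma Qf_deriv (hi : p i = 1) (hj : p j = 0)
    (hb : ∀ c d, HasDerivAt (fun θ => b θ c d) (cm i j (b 0) c d) 0) :
    HasDerivAt (fun θ => Qf p (b θ)) (Kf p (b 0) i j) 0 := by
  have h : HasDerivAt (fun θ => Qf p (b θ)) (∑ c, ∑ d, p c * (1 - p d) *
      (cm i j (b 0) c d * b 0 c d + b 0 c d * cm i j (b 0) c d)) 0 :=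
    HasDerivAt.fun_sum fun c _ => HasDerivAt.fun_sum fun d _ =>
      ((hb c d).fun_mul (hb c d)).const_mul _
  convert h using 1
  have e : ∀ c d, p c * (1 - p d) *
      (cm i j (b 0) c d * b 0 c d + b 0 c d * cm i j (b 0) c d) =
      (if c = i then 2 * ((1 - p d) * (b 0 i d * b 0 j d)) else 0) -
      (if d = j then 2 * (p c * (b 0 c i * b 0 c j)) else 0) := by
    intro c d
    unfold cm
    by_cases h1 : c = i <;> by_cases h2 : c = j <;> by_cases h3 : d = i <;> by_cases h4 : d = j <;>
      simp only [h1, h2, h3, h4, if_true, if_false, hi, hj] <;> first | ring1 | grind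
  simp only [e, Finset.sum_sub_distrib]
  simp [Kf, Finset.mul_sum, Finset.sum_ite_irrel]

lemma Gf_deriv (hi : p i = 1) (hj : p j = 0)
    (hb : ∀ c d, HasDerivAt (fun θ => b θ c d) (cm i j (b 0) c d) 0)
    (hij : i ≠ j) : HasDerivAt (fun θ => Gf p (b θ) i j)
    (Gf p (b 0) j j - Gf p (b 0) i i - 2 * (b 0 i i * b 0 j j) - 2 * (b 0 i j * b 0 i j)) 0 := by
  have h : HasDerivAt (fun θ => Gf p (b θ) i j) (∑ d, (1 - 2 * p d) *
      (cm i j (b 0) i d * b 0 d j + b 0 i d * cm i j (b 0) d j)) 0 :=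
    HasDerivAt.fun_sum fun d _ => ((hb i d).fun_mul (hb d j)).const_mul _
  convert h using 1
  have e : ∀ d, (1 - 2 * p d) *
      (cm i j (b 0) i d * b 0 d j + b 0 i d * cm i j (b 0) d j) =
      (1 - 2 * p d) * (b 0 j d * b 0 d j) - (1 - 2 * p d) * (b 0 i d * b 0 d i)
      + (if d = i then - (b 0 i i * b 0 j j) - b 0 i j * b 0 i j else 0)
      + (if d = j then - (b 0 i i * b 0 j j) - b 0 i j * b 0 i j else 0) := by
    intro d
    unfold cm
    by_cases h3 : d = i <;> by_cases h4 : d = j 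
    · exact absurd (h3.symm.trans h4) hij
    · subst h3; simp only [hi, hij, hij.symm, if_true, if_false]; ring
    · subst h4; simp only [hj, hij, hij.symm, if_true, if_false]; ring
    · simp only [h3, h4, hij, hij.symm, if_true, if_false]; ring
  simp only [e, Finset.sum_sub_distrib, Finset.sum_add_distrib, Finset.sum_ite_eq',
    Finset.mem_univ, if_true, Gf]
  ring

end deriv

/-- trace facts -/
lemma sum_pair (p : Fin n → ℝ) (f : Fin n → ℝ) :
    ∑ i, ∑ j, p i * (1 - p j) * (f j - f i) = (∑ i, p i) * (∑ j, f j) - n * ∑ i, p i * f i := by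
  have e : ∀ i j, p i * (1 - p j) * (f j - f i) =
    p i * f j - (p i * f i) * 1 - p i * (p j * f j) + (p i * f i) * p j := by intros; ring
  simp only [e, Finset.sum_add_distrib, Finset.sum_sub_distrib, ← Finset.mul_sum, ← Finset.sum_mul]
  simp only [Finset.sum_const, Finset.card_univ, Fintype.card_fin, nsmul_eq_mul, mul_one]
  ring

variable {E : Type*} [NormedAddCommGroup E] [NormedSpace ℝ E] [SecondCountableTopology E]
  [MeasurableSpace E] [BorelSpace E]

lemma trace_conj {M S : Mat n} (hM : M * Mᵀ = 1) : trace (M * S * Mᵀ) = trace S := by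
  rw [Matrix.trace_mul_comm, ← Matrix.mul_assoc, mul_eq_one_comm.mp hM, Matrix.one_mul]

lemma ibp1 (hμ : IsHaarOrthogonal n μ) (p : Fin n → ℝ) (hp : ∀ c, p c = 0 ∨ p c = 1)
    (S : Mat n) (hS : Sᵀ = S) (h h' : ℝ → E) (hd : ∀ x, HasDerivAt h (h' x) x)
    (hc' : Continuous h') :
    ∫ M, (((∑ i, p i) * trace S - n * Wf p (M * S * Mᵀ)) • h (Wf p (M * S * Mᵀ))
      + (2 * Qf p (M * S * Mᵀ)) • h' (Wf p (M * S * Mᵀ))) ∂μ = 0 := by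
  have hc : Continuous h := continuous_iff_continuousAt.2 fun x => (hd x).continuousAt
  have step : ∀ i j, ∫ M, (fun b : Mat n => (p i * (1 - p j)) • ((b j j - b i i) • h (Wf p b)
      + (b i j * (b i j + b j i)) • h' (Wf p b))) (M * S * Mᵀ) ∂μ = 0 := by
    intro i j
    rcases hp i with hi | hi
    · simp [hi]
    rcases hp j with hj | hj
    swap
    · simp [hj]
    have hij : i ≠ j := by rintro rfl; linarith
    refine ibp hμ (Ek i j) (Ek_skew i j) S (Φ := fun b => b i j • h (Wf p b))
      (Φ' := fun b : Mat n => (p i * (1 - p j)) • ((b j j - b i i) • h (Wf p b)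
      + (b i j * (b i j + b j i)) • h' (Wf p b))) (by fun_prop) (by fun_prop) ?_
    intro b hb
    simp only [Ek_comm] at hb
    have := (entry_deriv hi hj hb hij).fun_smul ((hd (Wf p (b 0))).scomp 0 (Wf_deriv hi hj hb))
    refine HasDerivAt.congr_deriv (this : HasDerivAt (fun θ => b θ i j • h (Wf p (b θ))) _ 0) ?_
    simp [hi, hj, smul_smul]
    abel
  have hsum : ∫ M, ∑ i, ∑ j, (fun b : Mat n => (p i * (1 - p j)) • ((b j j - b i i) • h (Wf p b)
      + (b i j * (b i j + b j i)) • h' (Wf p b))) (M * S * Mᵀ) ∂μ = 0 := by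
    rw [integral_finsetSum _ fun i _ => integrable_cont hμ (by fun_prop)]
    refine Finset.sum_eq_zero fun i _ => ?_
    rw [integral_finsetSum _ fun j _ => integrable_cont hμ (by fun_prop)]
    exact Finset.sum_eq_zero fun j _ => step i j
  rw [← hsum]
  refine integral_congr_ae ?_
  filter_upwards [hμ.ae_orth] with M hM
  have htr : trace (M * S * Mᵀ) = trace S := trace_conj hM
  have hsym : (M * S * Mᵀ)ᵀ = M * S * Mᵀ := by
    simp [Matrix.transpose_mul, hS, Matrix.mul_assoc]
  have hsym' : ∀ i j, (M * S * Mᵀ) i j = (M * S * Mᵀ) j i := fun i j => by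
    conv_lhs => rw [← hsym]
    rfl
  generalize M * S * Mᵀ = b at *
  simp only [smul_add, smul_smul, Finset.sum_add_distrib, ← Finset.sum_smul, sum_pair p (fun i => b i i)]
  rw [← htr]
  congr 3
  simp only [Qf, Finset.mul_sum]
  refine Finset.sum_congr rfl fun i _ => Finset.sum_congr rfl fun j _ => ?_
  rw [hsym' j i]; ring

lemma ibp2 (hμ : IsHaarOrthogonal n μ) (p : Fin n → ℝ) (hp : ∀ c, p c = 0 ∨ p c = 1)
    (S : Mat n) (hS : Sᵀ = S) (q : ℝ) :
    ∫ M, (((∑ i, p i) * trace (S * S) + (n - 2 * ∑ i, p i) * Wf p (M * (S * S) * Mᵀ)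
      - 2 * n * Qf p (M * S * Mᵀ) - 2 * Qf p (M * S * Mᵀ)
      - 2 * (Wf p (M * S * Mᵀ) * (trace S - Wf p (M * S * Mᵀ)))) * (Qf p (M * S * Mᵀ) - q)
      + 2 * ∑ i, ∑ j, p i * (1 - p j) * (Gf p (M * S * Mᵀ) i j)^2) ∂μ = 0 := by
  have step : ∀ i j, ∫ M, (fun b : Mat n => (p i * (1 - p j)) *
     ((Gf p b j j - Gf p b i i - 2 * (b i i * b j j) - 2 * (b i j * b i j)) * (Qf p b - q)
      + Gf p b i j * Kf p b i j)) (M * S * Mᵀ) ∂μ = 0 := by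
    intro i j
    rcases hp i with hi | hi
    · simp [hi]
    rcases hp j with hj | hj
    swap
    · simp [hj]
    have hij : i ≠ j := by rintro rfl; linarith
    refine ibp hμ (Ek i j) (Ek_skew i j) S (Φ := fun b => Gf p b i j * (Qf p b - q))
      (Φ' := fun b : Mat n => (p i * (1 - p j)) *
     ((Gf p b j j - Gf p b i i - 2 * (b i i * b j j) - 2 * (b i j * b i j)) * (Qf p b - q)
      + Gf p b i j * Kf p b i j)) (by fun_prop) (by fun_prop) ?_
    intro b hb
    simp only [Ek_comm] at hb
    have := (Gf_deriv hi hj hb hij).fun_mul ((Qf_deriv hi hj hb).sub_const q)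
    refine this.congr_deriv ?_
    simp [hi, hj]
  have hsum : ∫ M, ∑ i, ∑ j, (fun b : Mat n => (p i * (1 - p j)) *
     ((Gf p b j j - Gf p b i i - 2 * (b i i * b j j) - 2 * (b i j * b i j)) * (Qf p b - q)
      + Gf p b i j * Kf p b i j)) (M * S * Mᵀ) ∂μ = 0 := by
    rw [integral_finsetSum _ fun i _ => integrable_cont hμ (by fun_prop)]
    refine Finset.sum_eq_zero fun i _ => ?_
    rw [integral_finsetSum _ fun j _ => integrable_cont hμ (by fun_prop)]
    exact Finset.sum_eq_zero fun j _ => step i j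
  rw [← hsum]
  refine integral_congr_ae ?_
  filter_upwards [hμ.ae_orth] with M hM
  have htr : trace (M * S * Mᵀ) = trace S := trace_conj hM
  have hsq : M * (S * S) * Mᵀ = (M * S * Mᵀ) * (M * S * Mᵀ) := by
    have := mul_eq_one_comm.mp hM
    calc M * (S * S) * Mᵀ = M * S * (Mᵀ * M) * S * Mᵀ := by
          rw [this]; simp [Matrix.mul_assoc]
      _ = _ := by simp [Matrix.mul_assoc]
  have htr2 : trace ((M * S * Mᵀ) * (M * S * Mᵀ)) = trace (S * S) := by
    rw [← hsq]; exact trace_conj hM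
  have hsym : (M * S * Mᵀ)ᵀ = M * S * Mᵀ := by
    simp [Matrix.transpose_mul, hS, Matrix.mul_assoc]
  have hsym' : ∀ i j, (M * S * Mᵀ) i j = (M * S * Mᵀ) j i := fun i j => by
    conv_lhs => rw [← hsym]
    rfl
  rw [hsq, ← htr, ← htr2]
  clear htr htr2 hsq hsym
  generalize M * S * Mᵀ = b at *
  have hK : ∀ i j, Kf p b i j = 2 * Gf p b i j := by
    intro i j
    simp only [Kf, Gf, Finset.mul_sum, ← Finset.sum_sub_distrib]
    refine Finset.sum_congr rfl fun d _ => ?_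
    rw [hsym' j d, hsym' d i]; ring
  have hG1 : ∑ i, Gf p b i i = trace (b * b) - 2 * Wf p (b * b) := by
    simp only [Gf, Wf, Matrix.trace, Matrix.diag, Matrix.mul_apply, Finset.mul_sum]
    rw [Finset.sum_comm (f := fun i j => 2 * (p i * (b i j * b j i))), ← Finset.sum_sub_distrib]
    refine Finset.sum_congr rfl fun d _ => ?_
    rw [← Finset.sum_sub_distrib]
    refine Finset.sum_congr rfl fun e _ => ?_
    ring
  have hG2 : ∑ i, p i * Gf p b i i = 2 * Qf p b - Wf p (b * b) := by
    simp only [Gf, Wf, Qf, Matrix.mul_apply, Finset.mul_sum, ← Finset.sum_sub_distrib]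
    refine Finset.sum_congr rfl fun d _ => ?_
    refine Finset.sum_congr rfl fun e _ => ?_
    rw [hsym' e d]; ring
  have hW : ∑ i, ∑ j, p i * (1 - p j) * (b i i * b j j) = Wf p b * (trace b - Wf p b) := by
    simp only [Wf, Matrix.trace, Matrix.diag, ← Finset.sum_sub_distrib, Finset.sum_mul_sum]
    refine Finset.sum_congr rfl fun d _ => Finset.sum_congr rfl fun e _ => ?_
    ring
  have e : ∀ i j, (p i * (1 - p j)) *
     ((Gf p b j j - Gf p b i i - 2 * (b i i * b j j) - 2 * (b i j * b i j)) * (Qf p b - q)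
      + Gf p b i j * Kf p b i j) = p i * (1 - p j) * (Gf p b j j - Gf p b i i) * (Qf p b - q)
      - p i * (1 - p j) * (b i i * b j j) * (2 * (Qf p b - q))
      - p i * (1 - p j) * (b i j * b i j) * (2 * (Qf p b - q))
      + 2 * (p i * (1 - p j) * (Gf p b i j)^2) := by
    intro i j; rw [hK]; ring
  simp only [e, Finset.sum_add_distrib, Finset.sum_sub_distrib, ← Finset.sum_mul, ← Finset.mul_sum,
    sum_pair p (fun i => Gf p b i i), hG1, hG2, hW]
  rw [show ∑ i, ∑ j, p i * (1 - p j) * (b i j * b i j) = Qf p b from rfl]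
  ring

end HaarAux

namespace HaarAux
variable {n : ℕ} {μ : Measure (Mat n)} 

lemma trace_sq (B : Mat n) (hB : Bᵀ = B) : trace (B * B) = ∑ c, ∑ d, B c d ^ 2 := by
  simp only [Matrix.trace, Matrix.diag, Matrix.mul_apply]
  refine Finset.sum_congr rfl fun c _ => Finset.sum_congr rfl fun d _ => ?_
  have : B d c = B c d := congrFun (congrFun hB c) d
  rw [this, sq]

lemma p_nonneg {p : Fin n → ℝ} (hp : ∀ c, p c = 0 ∨ p c = 1) (i j : Fin n) :
    0 ≤ p i * (1 - p j) ∧ p i * (1 - p j) ≤ 1 := by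
  rcases hp i with h | h <;> rcases hp j with h' | h' <;> simp [h, h']

lemma Qf_nonneg {p : Fin n → ℝ} (hp : ∀ c, p c = 0 ∨ p c = 1) (B : Mat n) : 0 ≤ Qf p B :=
  Finset.sum_nonneg fun i _ => Finset.sum_nonneg fun j _ =>
    mul_nonneg (p_nonneg hp i j).1 (mul_self_nonneg _)

lemma Qf_le {p : Fin n → ℝ} (hp : ∀ c, p c = 0 ∨ p c = 1) (B : Mat n) (hB : Bᵀ = B) :
    Qf p B ≤ trace (B * B) := by
  rw [trace_sq B hB]
  refine Finset.sum_le_sum fun i _ => Finset.sum_le_sum fun j _ => ?_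
  rw [← sq]
  exact mul_le_of_le_one_left (sq_nonneg _) (p_nonneg hp i j).2

lemma Gf_sum_le {p : Fin n → ℝ} (hp : ∀ c, p c = 0 ∨ p c = 1) (B : Mat n) (hB : Bᵀ = B) :
    ∑ i, ∑ j, Gf p B i j ^ 2 ≤ trace (B * B) ^ 2 := by
  have hs : ∀ i j, B i j = B j i := fun i j => congrFun (congrFun hB j) i
  rw [trace_sq B hB, sq, Finset.sum_mul_sum]
  refine Finset.sum_le_sum fun i _ => Finset.sum_le_sum fun j _ => ?_
  have h1 := Finset.sum_mul_sq_le_sq_mul_sq Finset.univ (fun d => (1 - 2 * p d) * B i d)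
    (fun d => B d j)
  have e1 : Gf p B i j = ∑ d, (1 - 2 * p d) * B i d * B d j := by
    simp [Gf, mul_assoc]
  rw [e1]
  refine h1.trans (le_of_eq ?_)
  congr 1
  · refine Finset.sum_congr rfl fun d _ => ?_
    rcases hp d with h | h <;> simp [h]; ring
  · exact Finset.sum_congr rfl fun d _ => by rw [hs]

lemma Gf_sum_le' {p : Fin n → ℝ} (hp : ∀ c, p c = 0 ∨ p c = 1) (B : Mat n) (hB : Bᵀ = B) :
    ∑ i, ∑ j, p i * (1 - p j) * Gf p B i j ^ 2 ≤ trace (B * B) ^ 2 := by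
  refine le_trans ?_ (Gf_sum_le hp B hB)
  refine Finset.sum_le_sum fun i _ => Finset.sum_le_sum fun j _ => ?_
  exact mul_le_of_le_one_left (sq_nonneg _) (p_nonneg hp i j).2

lemma sym_sq {S : Mat n} (hS : Sᵀ = S) : (S * S)ᵀ = S * S := by rw [transpose_mul, hS]

lemma sym_conj {S : Mat n} (hS : Sᵀ = S) (M : Mat n) : (M * S * Mᵀ)ᵀ = M * S * Mᵀ := by
  simp [Matrix.transpose_mul, hS, Matrix.mul_assoc]

lemma conj_sq {M S : Mat n} (hM : M * Mᵀ = 1) :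
    (M * S * Mᵀ) * (M * S * Mᵀ) = M * (S * S) * Mᵀ := by
  have := mul_eq_one_comm.mp hM
  calc _ = M * S * (Mᵀ * M) * S * Mᵀ := by simp [Matrix.mul_assoc]
      _ = _ := by rw [this]; simp [Matrix.mul_assoc]

lemma trace_conj_sq {M S : Mat n} (hM : M * Mᵀ = 1) :
    trace ((M * S * Mᵀ) * (M * S * Mᵀ)) = trace (S * S) := by
  rw [conj_sq hM, trace_conj hM]

lemma trace_four (S : Mat n) (hS : Sᵀ = S) : trace ((S * S) * (S * S)) ≤ trace (S * S) ^ 2 := by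
  have h := Gf_sum_le (p := fun _ => 0) (fun _ => Or.inl rfl) S hS
  refine le_trans (le_of_eq ?_) h
  rw [trace_sq _ (sym_sq hS)]
  simp [Gf, Matrix.mul_apply]

lemma var_W (hμ : IsHaarOrthogonal n μ) {p : Fin n → ℝ} (hp : ∀ c, p c = 0 ∨ p c = 1)
    (S : Mat n) (hS : Sᵀ = S) (m : ℝ) (hm : n * m = (∑ i, p i) * trace S) :
    n * ∫ M, (Wf p (M * S * Mᵀ) - m) ^ 2 ∂μ ≤ 2 * trace (S * S) := by
  have := hμ.isProb
  have h := ibp1 hμ p hp S hS (fun x : ℝ => x - m) (fun _ => 1)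
    (fun x => (hasDerivAt_id x).sub_const m) continuous_const
  have h2 : ∫ M, (2 * Qf p (M * S * Mᵀ) - n * (Wf p (M * S * Mᵀ) - m) ^ 2) ∂μ = 0 := by
    rw [← h]
    congr 1; ext M
    simp only [smul_eq_mul, ← hm]; ring
  rw [integral_sub (integrable_cont hμ (by fun_prop)) (integrable_cont hμ (by fun_prop)),
    integral_const_mul (n : ℝ)] at h2
  have h3 : ∫ M, 2 * Qf p (M * S * Mᵀ) ∂μ ≤ ∫ M, 2 * trace (S * S) ∂μ := by
    refine integral_mono_ae (integrable_cont hμ (by fun_prop)) (integrable_const _) ?_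
    filter_upwards [hμ.ae_orth] with M hM
    rw [← trace_conj_sq (S := S) hM]
    linarith [Qf_le hp _ (sym_conj hS M)]
  simp at h3
  linarith

lemma pointwise_bound {n s t1 κ m' x y z Q W G I : ℝ} (hn : 0 ≤ n) (hs : 0 < s)
    (ht1 : 0 ≤ t1) (ht1n : t1 ≤ n) (hκ0 : 0 ≤ κ) (hκ : κ ≤ n) (hm0 : 0 ≤ m') (hm1 : m' ≤ t1)
    (hx : |x| ≤ n) (hQ0 : 0 ≤ Q) (hQ : Q ≤ n) (hW : W = m' + y) (hG : G ≤ n ^ 2)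
    (hI : I = (-2 * n * x + (n - 2 * κ) * z - 2 * Q - 2 * (W * (t1 - W))) * x + 2 * G) :
    2 * n * x ^ 2 ≤ n * (n * (s + z ^ 2 / s) / 2 + 2 * n + 4 * n * t1 + 4 * y ^ 2)
      + 2 * n ^ 2 - I := by
  have hz : |z| ≤ (s + z ^ 2 / s) / 2 := by
    have : 0 ≤ (s - |z|) ^ 2 / s := by positivity
    have e : (s - |z|) ^ 2 / s = s + z ^ 2 / s - 2 * |z| := by
      rw [sub_sq, sq_abs]; field_simp; ring
    linarith
  have hWW : |W * (t1 - W)| ≤ 2 * n * t1 + 2 * y ^ 2 := by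
    have h1 : |W| ≤ t1 + |y| := by
      rw [hW]; exact (abs_add_le _ _).trans (by rw [abs_of_nonneg hm0]; linarith)
    have h2 : |t1 - W| ≤ t1 + |y| := by
      rw [hW, show t1 - (m' + y) = (t1 - m') - y by ring]
      exact (abs_sub _ _).trans (by rw [abs_of_nonneg (by linarith : 0 ≤ t1 - m')]; linarith)
    rw [abs_mul]
    have h3 := mul_le_mul h1 h2 (abs_nonneg _) (by positivity)
    have h4 : t1 * t1 ≤ n * t1 := mul_le_mul_of_nonneg_right ht1n ht1
    nlinarith [sq_nonneg (t1 - |y|), sq_abs y]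
  set r := (n - 2 * κ) * z - 2 * Q - 2 * (W * (t1 - W)) with hr
  have hr1 : |r| ≤ n * |z| + 2 * n + 2 * |W * (t1 - W)| := by
    have a1 : |(n - 2 * κ) * z| ≤ n * |z| := by
      rw [abs_mul]
      exact mul_le_mul_of_nonneg_right (abs_le.2 ⟨by linarith, by linarith⟩) (abs_nonneg _)
    have a2 := abs_le.1 a1
    have a3 := abs_le.1 (le_refl |W * (t1 - W)|)
    rw [abs_le]; constructor <;> rw [hr] <;> linarith [a2.1, a2.2, a3.1, a3.2]
  have hr2 : |r| ≤ n * (s + z ^ 2 / s) / 2 + 2 * n + 4 * n * t1 + 4 * y ^ 2 := by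
    have := mul_le_mul_of_nonneg_left hz hn
    linarith
  have hrx : r * x ≤ n * (n * (s + z ^ 2 / s) / 2 + 2 * n + 4 * n * t1 + 4 * y ^ 2) := by
    calc r * x ≤ |r * x| := le_abs_self _
      _ = |x| * |r| := by rw [abs_mul, mul_comm]
      _ ≤ n * _ := mul_le_mul hx hr2 (abs_nonneg _) hn
  rw [hI]
  nlinarith

lemma var_Q (hμ : IsHaarOrthogonal n μ) {p : Fin n → ℝ} (hp : ∀ c, p c = 0 ∨ p c = 1)
    (S : Mat n) (hS : Sᵀ = S) (hn : 1 ≤ n) (s : ℝ) (hs : 0 < s) (hsn : s ^ 2 = n)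
    (h10 : 0 ≤ trace S) (h1n : trace S ≤ n) (h2n : trace (S * S) ≤ n) (q : ℝ)
    (hq : q = (∑ i, p i) * (n - ∑ i, p i) * trace (S * S) / n ^ 2) :
    ∫ M, (Qf p (M * S * Mᵀ) - q) ^ 2 ∂μ ≤ 7 * (n * s) * (1 + trace S) := by
  have := hμ.isProb
  have hn' : (1 : ℝ) ≤ n := by exact_mod_cast hn
  have hn0 : (0 : ℝ) < n := by linarith
  have hκ0 : 0 ≤ ∑ i, p i := Finset.sum_nonneg fun i _ => by rcases hp i with h | h <;> simp [h]
  have hκn : ∑ i, p i ≤ n := by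
    calc ∑ i, p i ≤ ∑ i : Fin n, (1 : ℝ) := Finset.sum_le_sum fun i _ => by
          rcases hp i with h | h <;> simp [h]
      _ = n := by simp
  have h20 : 0 ≤ trace (S * S) := by rw [trace_sq S hS]; positivity
  have hI := ibp2 hμ p hp S hS q
  set κ := ∑ i, p i with hκ
  set t1 := trace S with ht1
  set t2 := trace (S * S) with ht2
  have hv1 := var_W hμ hp S hS (κ * t1 / n) (by field_simp; rfl)
  have hv2 := var_W hμ hp (S * S) (sym_sq hS) (κ * t2 / n) (by field_simp; rfl)
  have h4 := trace_four S hS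
  have h1s : 1 ≤ s := by nlinarith
  have hq0 : 0 ≤ q := by
    rw [hq]; have : 0 ≤ (n:ℝ) - κ := by linarith
    positivity
  have hqn : q ≤ n := by
    rw [hq, div_le_iff₀ (by positivity)]
    have : κ * (n - κ) ≤ (n:ℝ) ^ 2 := by nlinarith
    calc κ * (n - κ) * t2 ≤ (n:ℝ)^2 * n := mul_le_mul this h2n h20 (by positivity)
      _ = _ := by ring
  have hint : ∫ M, 2 * n * (Qf p (M * S * Mᵀ) - q) ^ 2 ∂μ ≤
      ∫ M, ((n * (n * (s + (Wf p (M * (S * S) * Mᵀ) - κ * t2 / n) ^ 2 / s) / 2 + 2 * n + 4 * n * t1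
        + 4 * (Wf p (M * S * Mᵀ) - κ * t1 / n) ^ 2) + 2 * (n:ℝ) ^ 2) - 
        ((κ * t2 + (n - 2 * κ) * Wf p (M * (S * S) * Mᵀ)
      - 2 * n * Qf p (M * S * Mᵀ) - 2 * Qf p (M * S * Mᵀ)
      - 2 * (Wf p (M * S * Mᵀ) * (t1 - Wf p (M * S * Mᵀ)))) * (Qf p (M * S * Mᵀ) - q)
      + 2 * ∑ i, ∑ j, p i * (1 - p j) * (Gf p (M * S * Mᵀ) i j)^2)) ∂μ := by
    refine integral_mono_ae (integrable_cont hμ (by fun_prop)) (integrable_cont hμ (by fun_prop)) ?_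
    filter_upwards [hμ.ae_orth] with M hM
    have b1 := Qf_nonneg hp (M * S * Mᵀ)
    have b2 := Qf_le hp _ (sym_conj hS M)
    have b3 := Gf_sum_le' hp _ (sym_conj hS M)
    rw [trace_conj_sq hM, ← ht2] at b2 b3
    refine pointwise_bound (κ := κ) (m' := κ * t1 / n) (W := Wf p (M * S * Mᵀ)) hn0.le hs h10 h1n hκ0 hκn (by positivity)
      ?_ ?_ b1 (b2.trans h2n) (by ring) (b3.trans (pow_le_pow_left₀ h20 h2n 2)) ?_
    · rw [div_le_iff₀ hn0, mul_comm]; exact mul_le_mul_of_nonneg_left hκn h10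
    · rw [abs_le]; constructor <;> linarith
    · rw [hq]; field_simp; ring
  have i1 : Integrable (fun M => (Wf p (M * (S * S) * Mᵀ) - κ * t2 / n) ^ 2) μ :=
    integrable_cont hμ (by fun_prop)
  have i2 : Integrable (fun M => (Wf p (M * S * Mᵀ) - κ * t1 / n) ^ 2) μ :=
    integrable_cont hμ (by fun_prop)
  rw [integral_sub (integrable_cont hμ (by fun_prop)) (integrable_cont hμ (by fun_prop)), hI,
    sub_zero, integral_const_mul] at hint
  have e : ∀ M : Mat n, (n * (n * (s + (Wf p (M * (S * S) * Mᵀ) - κ * t2 / n) ^ 2 / s) / 2 + 2 * n + 4 * n * t1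
        + 4 * (Wf p (M * S * Mᵀ) - κ * t1 / n) ^ 2) + 2 * (n:ℝ) ^ 2) = 
      (n ^ 2 / (2 * s)) * (Wf p (M * (S * S) * Mᵀ) - κ * t2 / n) ^ 2
       + (4 * n) * (Wf p (M * S * Mᵀ) - κ * t1 / n) ^ 2 
       + (n * (n * s / 2 + 2 * n + 4 * n * t1) + 2 * (n:ℝ)^2) := by
    intro M; field_simp; ring
  simp only [e] at hint
  rw [integral_add (integrable_cont hμ (by fun_prop)) (integrable_const _),
    integral_add (i1.const_mul _) (i2.const_mul _), integral_const_mul, integral_const_mul] at hint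
  simp only [integral_const, probReal_univ, one_smul] at hint
  set X := ∫ M, (Qf p (M * S * Mᵀ) - q) ^ 2 ∂μ
  set Y := ∫ M, (Wf p (M * S * Mᵀ) - κ * t1 / n) ^ 2 ∂μ
  set Z := ∫ M, (Wf p (M * (S * S) * Mᵀ) - κ * t2 / n) ^ 2 ∂μ
  have hY : Y ≤ 2 := by
    have : n * Y ≤ n * 2 := by linarith
    exact le_of_mul_le_mul_left this hn0
  have hZ : Z ≤ 2 * n := by
    have : n * Z ≤ n * (2 * n) := by nlinarith
    exact le_of_mul_le_mul_left this hn0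
  have hZ2 : n ^ 2 / (2 * s) * Z ≤ n ^ 2 * s := by
    calc n ^ 2 / (2 * s) * Z ≤ n ^ 2 / (2 * s) * (2 * n) := by gcongr
      _ = n ^ 2 * s := by rw [← hsn]; field_simp
  have hfin : n * (2 * X) ≤ n * (n * s + 8 + (n * s / 2 + 2 * n + 4 * n * t1) + 2 * n) := by
    nlinarith
  have hX := le_of_mul_le_mul_left hfin hn0
  have c1 : (n:ℝ) ≤ n * s := by nlinarith
  have c2 : 0 ≤ (n * s - n) * t1 := mul_nonneg (by linarith) h10
  have c3 : 0 ≤ n * t1 := by positivity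
  nlinarith

lemma mean_Q (hμ : IsHaarOrthogonal n μ) {p : Fin n → ℝ} (hp : ∀ c, p c = 0 ∨ p c = 1)
    (S : Mat n) (hS : Sᵀ = S) (hn : 1 ≤ n) (r : ℝ) (hr : 0 < r) (hrn : r ^ 4 = n)
    (h10 : 0 ≤ trace S) (h1n : trace S ≤ n) (h2n : trace (S * S) ≤ n) (q : ℝ)
    (hq : q = (∑ i, p i) * (n - ∑ i, p i) * trace (S * S) / n ^ 2) :
    ∫ M, |Qf p (M * S * Mᵀ) - q| ∂μ ≤ 4 * r ^ 3 * (1 + trace S) := by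
  have := hμ.isProb
  have h := var_Q hμ hp S hS hn (r ^ 2) (by positivity) (by rw [← hrn]; ring) h10 h1n h2n q hq
  have h2 : ∫ M, |Qf p (M * S * Mᵀ) - q| ∂μ ≤
      ∫ M, (r ^ 3 / 2 + (1 / (2 * r ^ 3)) * (Qf p (M * S * Mᵀ) - q) ^ 2) ∂μ := by
    refine integral_mono (integrable_cont hμ (by fun_prop)) (integrable_cont hμ (by fun_prop)) ?_
    intro M
    simp only
    generalize Qf p (M * S * Mᵀ) - q = x
    have h3 : 0 ≤ (r ^ 3 - |x|) ^ 2 / (2 * r ^ 3) := by positivity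
    have e : (r ^ 3 - |x|) ^ 2 / (2 * r ^ 3) = r ^ 3 / 2 + (1 / (2 * r ^ 3)) * x ^ 2 - |x| := by
      rw [sub_sq, sq_abs]; field_simp; ring
    linarith
  rw [integral_add (integrable_const _) (integrable_cont hμ (by fun_prop)), integral_const_mul] at h2
  simp only [integral_const, probReal_univ, one_smul] at h2
  have h4 : (1 / (2 * r ^ 3)) * ∫ M, (Qf p (M * S * Mᵀ) - q) ^ 2 ∂μ ≤
      (1 / (2 * r ^ 3)) * (7 * (n * r ^ 2) * (1 + trace S)) := by gcongr
  have h5 : (1 / (2 * r ^ 3)) * (7 * (n * r ^ 2) * (1 + trace S)) = 7 / 2 * r ^ 3 * (1 + trace S) := by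
    rw [← hrn]; field_simp
  have : 0 ≤ r ^ 3 * trace S := by positivity
  nlinarith

end HaarAux

namespace HaarAux
variable {n : ℕ} {μ : Measure (Mat n)} 

lemma norm_cexp_I (x : ℝ) : ‖Complex.exp (x * Complex.I)‖ = 1 := Complex.norm_exp_ofReal_mul_I x

lemma phi_deriv (hμ : IsHaarOrthogonal n μ) (V : Mat n → ℝ) (hV : Continuous V) (t : ℝ) :
    HasDerivAt (fun s : ℝ => ∫ M, Complex.exp ((s * V M : ℝ) * Complex.I) ∂μ)
      (∫ M, (V M : ℂ) * Complex.I * Complex.exp ((t * V M : ℝ) * Complex.I) ∂μ) t := by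
  have := hμ.isProb
  obtain ⟨C, hC⟩ := exists_bound hV
  refine (hasDerivAt_integral_of_dominated_loc_of_deriv_le (μ := μ) (x₀ := t)
    (F := fun (s : ℝ) M => Complex.exp ((s * V M : ℝ) * Complex.I))
    (F' := fun s M => (V M : ℂ) * Complex.I * Complex.exp ((s * V M : ℝ) * Complex.I))
    (s := Set.univ) (bound := fun _ => C)
    Filter.univ_mem
    (Filter.Eventually.of_forall fun θ => (Continuous.measurable (by fun_prop)).aestronglyMeasurable)
    (integrable_cont hμ (by fun_prop))
    (Continuous.measurable (by fun_prop)).aestronglyMeasurable ?_ (integrable_const C)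
    (Filter.Eventually.of_forall fun M s _ => ?_)).2
  · filter_upwards [hμ.ae_orth] with M hM s _
    rw [norm_mul, norm_cexp_I, norm_mul, Complex.norm_I, mul_one, mul_one, Complex.norm_real]
    exact hC M hM
  · have h1 : HasDerivAt (fun s : ℝ => ((s * V M : ℝ) : ℂ) * Complex.I) ((V M : ℂ) * Complex.I) s := by
      have h0 : HasDerivAt (fun s : ℝ => s * V M) (V M) s := by
        simpa using (hasDerivAt_id s).mul_const (V M)
      exact h0.ofReal_comp.mul_const _
    have := h1.cexp
    rwa [mul_comm] at this

lemma char_bound (hμ : IsHaarOrthogonal n μ) {p : Fin n → ℝ} (hp : ∀ c, p c = 0 ∨ p c = 1)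
    (S : Mat n) (hS : Sᵀ = S) (hn : 1 ≤ n) (a v δ m : ℝ) (hv : 0 ≤ v)
    (hm : n * m = a * ((∑ i, p i) * trace S))
    (hδ : ∫ M, |2 * a ^ 2 / n * Qf p (M * S * Mᵀ) - v| ∂μ ≤ δ) (t : ℝ) :
    ‖(∫ M, Complex.exp ((t * (a * Wf p (M * S * Mᵀ)) : ℝ) * Complex.I) ∂μ) -
      Complex.exp ((m * t : ℝ) * Complex.I - (v * t ^ 2 / 2 : ℝ))‖ ≤ t ^ 2 * δ := by
  have := hμ.isProb
  have hn0 : (n : ℝ) ≠ 0 := by positivity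
  have hn0' : (n : ℂ) ≠ 0 := by exact_mod_cast hn0
  set φ : ℝ → ℂ := fun t => ∫ M, Complex.exp ((t * (a * Wf p (M * S * Mᵀ)) : ℝ) * Complex.I) ∂μ
    with hφ
  have hφd := fun s => phi_deriv hμ (fun M => a * Wf p (M * S * Mᵀ)) (by fun_prop) s
  -- derivative identity
  have hid : ∀ s : ℝ, (∫ M, ((a * Wf p (M * S * Mᵀ) : ℝ) : ℂ) * Complex.I *
      Complex.exp ((s * (a * Wf p (M * S * Mᵀ)) : ℝ) * Complex.I) ∂μ)
      + (-(m : ℂ) * Complex.I + (v * s : ℝ)) * φ s =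
      - (s : ℂ) * ∫ M, ((2 * a ^ 2 / n * Qf p (M * S * Mᵀ) - v : ℝ) : ℂ) *
        Complex.exp ((s * (a * Wf p (M * S * Mᵀ)) : ℝ) * Complex.I) ∂μ := by
    intro s
    have h := ibp1 hμ p hp S hS (fun x : ℝ => Complex.exp ((s * (a * x) : ℝ) * Complex.I))
      (fun x : ℝ => ((s * a : ℝ) * Complex.I) * Complex.exp ((s * (a * x) : ℝ) * Complex.I))
      (fun x => by
        have h0 : HasDerivAt (fun x : ℝ => s * (a * x)) (s * a) x := by
          simpa using ((hasDerivAt_id x).const_mul a).const_mul s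
        have := (h0.ofReal_comp.mul_const Complex.I).cexp
        rwa [mul_comm] at this) (by fun_prop)
    have h2 : (a / n * Complex.I : ℂ) * ∫ M, (((∑ i, p i) * trace S - n * Wf p (M * S * Mᵀ)) •
        Complex.exp ((s * (a * Wf p (M * S * Mᵀ)) : ℝ) * Complex.I)
      + (2 * Qf p (M * S * Mᵀ)) • (((s * a : ℝ) * Complex.I) *
        Complex.exp ((s * (a * Wf p (M * S * Mᵀ)) : ℝ) * Complex.I))) ∂μ = 0 := by
      rw [h, mul_zero]
    rw [← integral_const_mul] at h2
    rw [hφ, ← integral_const_mul, ← integral_const_mul,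
      ← integral_add (integrable_cont hμ (by fun_prop)) (integrable_cont hμ (by fun_prop)),
      ← sub_eq_zero, ← integral_sub (integrable_cont hμ (by fun_prop)) (integrable_cont hμ (by fun_prop)),
      ← neg_eq_zero, ← integral_neg, ← h2]
    congr 1
    ext M
    have hm' : (m : ℂ) = a * (((∑ i, p i : ℝ) : ℂ) * (trace S : ℝ)) / n := by
      rw [eq_div_iff hn0', mul_comm]; exact_mod_cast hm
    rw [hm']
    simp only [Complex.real_smul]
    generalize Complex.exp ((s * (a * Wf p (M * S * Mᵀ)) : ℝ) * Complex.I) = e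
    push_cast
    field_simp
    ring_nf
    simp only [Complex.I_sq]
    ring
  have hδ0 : 0 ≤ δ := le_trans (integral_nonneg fun _ => abs_nonneg _) hδ
  have hnb : ∀ s : ℝ, ‖(∫ M, ((a * Wf p (M * S * Mᵀ) : ℝ) : ℂ) * Complex.I *
      Complex.exp ((s * (a * Wf p (M * S * Mᵀ)) : ℝ) * Complex.I) ∂μ)
      + (-(m : ℂ) * Complex.I + (v * s : ℝ)) * φ s‖ ≤ |s| * δ := by
    intro s
    rw [hid, norm_mul, norm_neg, Complex.norm_real, Real.norm_eq_abs]
    refine mul_le_mul_of_nonneg_left ?_ (abs_nonneg s)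
    refine (norm_integral_le_integral_norm _).trans (le_trans (le_of_eq ?_) hδ)
    congr 1; ext M
    rw [norm_mul, norm_cexp_I, mul_one, Complex.norm_real, Real.norm_eq_abs]
  set ψ : ℝ → ℂ := fun s => φ s * Complex.exp (-(((m * s : ℝ) : ℂ) * Complex.I - (v * s ^ 2 / 2 : ℝ)))
    with hψ
  have hψd : ∀ s : ℝ, HasDerivAt ψ (((∫ M, ((a * Wf p (M * S * Mᵀ) : ℝ) : ℂ) * Complex.I *
      Complex.exp ((s * (a * Wf p (M * S * Mᵀ)) : ℝ) * Complex.I) ∂μ)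
      + (-(m : ℂ) * Complex.I + (v * s : ℝ)) * φ s) *
      Complex.exp (-(((m * s : ℝ) : ℂ) * Complex.I - (v * s ^ 2 / 2 : ℝ)))) s := by
    intro s
    have h1 : HasDerivAt (fun s : ℝ => m * s) m s := by
      simpa using (hasDerivAt_id s).const_mul m
    have h2 : HasDerivAt (fun s : ℝ => v * s ^ 2 / 2) (v * s) s := by
      refine (((hasDerivAt_pow 2 s).const_mul v).div_const 2).congr_deriv ?_
      simp; ring
    have h3 := ((h1.ofReal_comp.mul_const Complex.I).sub h2.ofReal_comp).neg.cexp
    refine ((hφd s).mul h3).congr_deriv ?_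
    simp only [hφ, Pi.neg_apply, Pi.sub_apply]
    ring
  have hne : ∀ s : ℝ, ‖Complex.exp (-(((m * s : ℝ) : ℂ) * Complex.I - (v * s ^ 2 / 2 : ℝ)))‖
      = Real.exp (v * s ^ 2 / 2) := by
    intro s
    rw [Complex.norm_exp]
    congr 1
    simp [← Complex.ofReal_pow]
  have hmv := Convex.norm_image_sub_le_of_norm_hasDerivWithin_le (f := ψ) (s := Set.uIcc 0 t)
    (x := 0) (y := t) (C := |t| * δ * Real.exp (v * t ^ 2 / 2))
    (fun s _ => (hψd s).hasDerivWithinAt) (fun s hs => by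
      rw [norm_mul, hne]
      have hst : |s| ≤ |t| := by
        rcases Set.mem_uIcc.1 hs with h | h
        · rw [abs_of_nonneg h.1, abs_of_nonneg (h.1.trans h.2)]; exact h.2
        · rw [abs_of_nonpos h.2, abs_of_nonpos (h.1.trans h.2)]; linarith [h.1]
      have hst2 : s ^ 2 ≤ t ^ 2 := sq_le_sq.2 hst
      refine mul_le_mul ((hnb s).trans (mul_le_mul_of_nonneg_right hst hδ0)) ?_
        (Real.exp_nonneg _) (by positivity)
      apply Real.exp_le_exp.2
      gcongr) (convex_uIcc 0 t) Set.left_mem_uIcc Set.right_mem_uIcc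
  have hψ0 : ψ 0 = 1 := by simp [hψ, hφ]
  rw [hψ0, sub_zero, Real.norm_eq_abs] at hmv
  have hfac : φ t - Complex.exp ((m * t : ℝ) * Complex.I - (v * t ^ 2 / 2 : ℝ)) =
      (ψ t - 1) * Complex.exp ((m * t : ℝ) * Complex.I - (v * t ^ 2 / 2 : ℝ)) := by
    rw [hψ, sub_mul, one_mul, mul_assoc, ← Complex.exp_add, neg_add_cancel, Complex.exp_zero, mul_one]
  have hne2 : ‖Complex.exp ((m * t : ℝ) * Complex.I - (v * t ^ 2 / 2 : ℝ))‖ =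
      (Real.exp (v * t ^ 2 / 2))⁻¹ := by
    rw [← hne t, Complex.exp_neg, norm_inv, inv_inv]
  change ‖φ t - _‖ ≤ _
  rw [hfac, norm_mul, hne2]
  calc _ ≤ |t| * δ * Real.exp (v * t ^ 2 / 2) * |t| * (Real.exp (v * t ^ 2 / 2))⁻¹ := by gcongr
    _ = |t| ^ 2 * δ := by field_simp
    _ = t ^ 2 * δ := by rw [sq_abs]

end HaarAux

namespace HaarAux
variable {n : ℕ}

lemma card_fix (s : Finset (Fin n)) :
    Fintype.card {σ : Equiv.Perm (Fin n) // ∀ i ∈ s, σ i = i} = (n - s.card).factorial := by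
  have e := Equiv.Perm.subtypeEquivSubtypePerm (fun i : Fin n => i ∉ s)
  have e2 : {f : Equiv.Perm (Fin n) // ∀ a, ¬ (a ∉ s) → f a = a} ≃
      {σ : Equiv.Perm (Fin n) // ∀ i ∈ s, σ i = i} :=
    Equiv.subtypeEquivRight (fun f => by simp)
  rw [← Fintype.card_congr (e.trans e2), Fintype.card_perm, Fintype.card_subtype_compl]
  simp

def f1 (σ : Equiv.Perm (Fin n)) : ℕ := (Finset.univ.filter fun i => σ i = i).card
def f2 (σ : Equiv.Perm (Fin n)) : ℕ := (Finset.univ.filter fun i => σ (σ i) = i).card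

lemma count_fix (s : Finset (Fin n)) :
    (Finset.univ.filter fun σ : Equiv.Perm (Fin n) => ∀ i ∈ s, σ i = i).card
      = (n - s.card).factorial := by
  rw [← card_fix s, Fintype.card_subtype]

lemma pgf (z : ℂ) : ∑ σ : Equiv.Perm (Fin n), z ^ f1 σ =
    n.factorial * ∑ j ∈ Finset.range (n + 1), (z - 1) ^ j / j.factorial := by
  have h1 : ∀ σ : Equiv.Perm (Fin n), z ^ f1 σ =
      ∑ s ∈ (Finset.univ : Finset (Fin n)).powerset,
        if (∀ i ∈ s, σ i = i) then (z - 1) ^ s.card else 0 := by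
    intro σ
    have h := Finset.sum_pow_mul_eq_add_pow (z - 1) 1 (Finset.univ.filter fun i => σ i = i)
    rw [sub_add_cancel] at h
    unfold f1
    rw [← h, ← Finset.sum_filter]
    refine Finset.sum_congr ?_ (by simp)
    ext s
    simp [Finset.subset_iff]
  simp only [h1]
  rw [Finset.sum_comm]
  have h2 : ∀ s : Finset (Fin n), ∑ σ : Equiv.Perm (Fin n),
      (if (∀ i ∈ s, σ i = i) then (z - 1) ^ s.card else 0) =
      (fun k => ((n - k).factorial : ℂ) * (z - 1) ^ k) s.card := by
    intro s
    rw [← Finset.sum_filter, Finset.sum_const, count_fix, nsmul_eq_mul]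
  simp only [h2]
  rw [Finset.sum_powerset_apply_card (fun k => ((n - k).factorial : ℂ) * (z - 1) ^ k)]
  rw [Finset.card_univ, Fintype.card_fin, Finset.mul_sum]
  refine Finset.sum_congr rfl fun k hk => ?_
  have hk' : k ≤ n := by simpa [Nat.lt_succ_iff] using hk
  have := Nat.choose_mul_factorial_mul_factorial hk'
  have hc : (n.choose k : ℂ) * k.factorial * (n - k).factorial = n.factorial := by exact_mod_cast this
  have hk0 : (k.factorial : ℂ) ≠ 0 := by exact_mod_cast k.factorial_ne_zero
  rw [nsmul_eq_mul, ← hc]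
  field_simp

lemma sum_f1 (hn : 1 ≤ n) : ∑ σ : Equiv.Perm (Fin n), f1 σ = n.factorial := by
  unfold f1
  simp only [Finset.card_filter]
  rw [Finset.sum_comm]
  have : ∀ i : Fin n, ∑ σ : Equiv.Perm (Fin n), (if σ i = i then 1 else 0) = (n - 1).factorial := by
    intro i
    rw [← Finset.card_filter]
    simpa using count_fix {i}
  simp only [this]
  simp [Nat.mul_factorial_pred (by omega : n ≠ 0)]

lemma sum_f2 (hn : 2 ≤ n) : ∑ σ : Equiv.Perm (Fin n), f2 σ = 2 * n.factorial := by
  unfold f2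
  simp only [Finset.card_filter]
  rw [Finset.sum_comm]
  have h1 : ∀ i j : Fin n, i ≠ j →
      ∑ σ : Equiv.Perm (Fin n), (if σ i = j ∧ σ j = i then 1 else 0) = (n - 2).factorial := by
    intro i j hij
    have h := count_fix {i, j}
    rw [Finset.card_pair hij] at h
    rw [← h, Finset.card_filter]
    refine Fintype.sum_equiv (Equiv.mulLeft (Equiv.swap i j)) _ _ fun σ => ?_
    congr 1
    simp [Equiv.swap_apply_eq_iff]
  have h0 : ∀ i : Fin n, ∑ σ : Equiv.Perm (Fin n), (if σ i = i ∧ σ i = i then 1 else 0)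
      = (n - 1).factorial := by
    intro i
    rw [← Finset.card_filter]
    simpa using count_fix {i}
  have h2 : ∀ i : Fin n, ∑ σ : Equiv.Perm (Fin n), (if σ (σ i) = i then 1 else 0) =
      2 * (n - 1).factorial := by
    intro i
    have e : ∀ σ : Equiv.Perm (Fin n), (if σ (σ i) = i then 1 else 0) =
        ∑ j, if σ i = j ∧ σ j = i then 1 else 0 := by
      intro σ
      simp [ite_and]
    simp only [e]
    rw [Finset.sum_comm, ← Finset.add_sum_erase _ _ (Finset.mem_univ i), h0,
      Finset.sum_congr rfl (fun j hj => h1 i j (Finset.ne_of_mem_erase hj).symm)]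
    simp only [Finset.sum_const, Finset.card_erase_of_mem (Finset.mem_univ i), Finset.card_univ,
      Fintype.card_fin, smul_eq_mul]
    have : (n - 1) * (n - 2).factorial = (n - 1).factorial := by
      have := Nat.mul_factorial_pred (by omega : n - 1 ≠ 0)
      rwa [Nat.sub_sub] at this
    omega
  simp only [h2]
  have := Nat.mul_factorial_pred (by omega : n ≠ 0)
  simp
  linarith

noncomputable def Sm (σ : Equiv.Perm (Fin n)) : Mat n :=
  (1 / 2 : ℝ) • (σ.permMatrix ℝ + (σ.permMatrix ℝ)ᵀ)

lemma Sm_sym (σ : Equiv.Perm (Fin n)) : (Sm σ)ᵀ = Sm σ := by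
  simp [Sm, add_comm]

lemma trace_perm (σ : Equiv.Perm (Fin n)) : trace (σ.permMatrix ℝ) = f1 σ := by
  simp [Matrix.trace, f1, Equiv.Perm.permMatrix, PEquiv.toMatrix_apply, eq_comm]

lemma trace_Sm (σ : Equiv.Perm (Fin n)) : trace (Sm σ) = f1 σ := by
  simp only [Sm, trace_smul, trace_add, trace_transpose, trace_perm, smul_eq_mul]
  ring

lemma trace_Sm_sq (σ : Equiv.Perm (Fin n)) : trace (Sm σ * Sm σ) = (n + f2 σ) / 2 := by
  have h1 : σ.permMatrix ℝ * σ.permMatrix ℝ = (σ * σ).permMatrix ℝ := by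
    rw [Matrix.permMatrix_mul]
  have h2 : trace (σ.permMatrix ℝ * σ.permMatrix ℝ) = f2 σ := by
    rw [h1, trace_perm]; rfl
  have h3 : (σ.permMatrix ℝ) * (σ.permMatrix ℝ)ᵀ = 1 := by
    rw [Matrix.transpose_permMatrix, ← Matrix.permMatrix_mul]; simp
  have h4 : (σ.permMatrix ℝ)ᵀ * (σ.permMatrix ℝ) = 1 := mul_eq_one_comm.mp h3
  have h5 : trace ((σ.permMatrix ℝ)ᵀ * (σ.permMatrix ℝ)ᵀ) = f2 σ := by
    rw [← transpose_mul, trace_transpose, h2]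
  simp only [Sm, smul_mul_smul_comm, trace_smul, add_mul, mul_add, trace_add, h2, h3, h4, h5,
    trace_one, smul_eq_mul, Fintype.card_fin]
  ring

lemma f1_le (σ : Equiv.Perm (Fin n)) : f1 σ ≤ n := by
  simpa [f1, f2] using Finset.card_filter_le (Finset.univ : Finset (Fin n)) (fun i => σ i = i)
lemma f2_le (σ : Equiv.Perm (Fin n)) : f2 σ ≤ n := by
  simpa [f1, f2] using Finset.card_filter_le (Finset.univ : Finset (Fin n)) (fun i => σ (σ i) = i)

lemma trace_A (σ : Equiv.Perm (Fin n)) (a : ℝ) (P : Fin n → Prop) [DecidablePred P] (M : Mat n) :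
    trace (Matrix.diagonal (fun i => if P i then a else 0) * M * σ.permMatrix ℝ * Mᵀ) =
      a * Wf (fun i => if P i then 1 else 0) (M * Sm σ * Mᵀ) := by
  have h1 : ∀ B : Mat n, trace (Matrix.diagonal (fun i => if P i then a else 0) * B) =
      a * Wf (fun i => if P i then 1 else 0) B := by
    intro B
    simp only [Matrix.trace, Matrix.diag, Matrix.diagonal_mul, Wf, Finset.mul_sum]
    refine Finset.sum_congr rfl fun i _ => ?_
    split_ifs <;> simp
  have h2 : M * Sm σ * Mᵀ = (1 / 2 : ℝ) • (M * σ.permMatrix ℝ * Mᵀ + (M * σ.permMatrix ℝ * Mᵀ)ᵀ) := by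
    simp [Sm, Matrix.mul_add, Matrix.add_mul, Matrix.transpose_mul, Matrix.mul_assoc]
  have h3 : ∀ B : Mat n, Wf (fun i => if P i then 1 else 0) ((1 / 2 : ℝ) • (B + Bᵀ)) =
      Wf (fun i => if P i then 1 else 0) B := by
    intro B
    unfold Wf
    refine Finset.sum_congr rfl fun i _ => ?_
    simp only [Matrix.smul_apply, Matrix.add_apply, Matrix.transpose_apply, smul_eq_mul]; ring
  rw [h2, h3, ← h1, Matrix.mul_assoc, Matrix.mul_assoc, Matrix.mul_assoc]

end HaarAux

namespace HaarAux

/-- The zero-one weights selecting the first `k` coordinates. -/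
def pk (n k : ℕ) : Fin n → ℝ := fun i => if (i : ℕ) < k then 1 else 0

lemma sum_pk {n k : ℕ} (h : k ≤ n) : ∑ i, pk n k i = k := by
  unfold pk
  rw [Fin.sum_univ_eq_sum_range (fun i => if i < k then (1 : ℝ) else 0) n, ← Finset.sum_filter]
  have : (Finset.range n).filter (fun i => i < k) = Finset.range k := by
    ext i; simp; omega
  rw [this]; simp

lemma delta_bound {n : ℕ} {μ : Measure (Mat n)} (hμ : IsHaarOrthogonal n μ) (k : ℕ) (hk : k ≤ n)
    (hn : 1 ≤ n) (r : ℝ) (hr : 0 < r) (hrn : r ^ 4 = n) (a v : ℝ) (σ : Equiv.Perm (Fin n)) :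
    ∫ M, |2 * a ^ 2 / n * Qf (pk n k) (M * Sm σ * Mᵀ) - v| ∂μ ≤
      8 * a ^ 2 / r * (1 + f1 σ) + |a ^ 2 * (k / n) * (1 - k / n) - v| + a ^ 2 * (f2 σ / n) := by
  haveI := hμ.isProb
  have hn0 : (0 : ℝ) < n := by exact_mod_cast hn
  have hp : ∀ c, pk n k c = 0 ∨ pk n k c = 1 := by
    intro c; unfold pk; split_ifs <;> simp
  have hkn : (k : ℝ) ≤ n := by exact_mod_cast hk
  have hf2 : (f2 σ : ℝ) ≤ n := by exact_mod_cast f2_le σ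
  set q : ℝ := (k : ℝ) * (n - k) * ((n + f2 σ) / 2) / n ^ 2 with hq
  have hm := mean_Q hμ hp (Sm σ) (Sm_sym σ) hn r hr hrn (by rw [trace_Sm]; positivity)
    (by rw [trace_Sm]; exact_mod_cast f1_le σ) (by rw [trace_Sm_sq]; linarith) q
    (by rw [sum_pk hk, trace_Sm_sq])
  rw [trace_Sm] at hm
  have e1 : 2 * a ^ 2 / n * q = a ^ 2 * (k / n) * (1 - k / n) * (1 + f2 σ / n) := by
    rw [hq]; field_simp
  have hκ0 : (0 : ℝ) ≤ k / n := by positivity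
  have hκ1 : (k : ℝ) / n ≤ 1 := by rw [div_le_one hn0]; exact hkn
  have hφ : (0 : ℝ) ≤ f2 σ / n := by positivity
  have e2 : |2 * a ^ 2 / n * q - v| ≤
      |a ^ 2 * (k / n) * (1 - k / n) - v| + a ^ 2 * (f2 σ / n) := by
    rw [e1]
    have : a ^ 2 * (k / n) * (1 - k / n) * (1 + f2 σ / n) - v =
      (a ^ 2 * (k / n) * (1 - k / n) - v) + a ^ 2 * (((k : ℝ) / n) * (1 - k / n) * (f2 σ / n)) := by
      ring
    rw [this]
    refine (abs_add_le _ _).trans ?_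
    gcongr
    rw [abs_of_nonneg (by have : (0:ℝ) ≤ 1 - k / n := by linarith
                          positivity)]
    gcongr
    have : (k : ℝ) / n * (1 - k / n) ≤ 1 := by nlinarith
    nlinarith
  have i1 : Integrable (fun M => |Qf (pk n k) (M * Sm σ * Mᵀ) - q|) μ :=
    integrable_cont hμ (by fun_prop)
  calc ∫ M, |2 * a ^ 2 / n * Qf (pk n k) (M * Sm σ * Mᵀ) - v| ∂μ
      ≤ ∫ M, (2 * a ^ 2 / n * |Qf (pk n k) (M * Sm σ * Mᵀ) - q| + |2 * a ^ 2 / n * q - v|) ∂μ := by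
        refine integral_mono (integrable_cont hμ (by fun_prop))
          ((i1.const_mul _).add (integrable_const _)) ?_
        intro M
        have : 2 * a ^ 2 / n * Qf (pk n k) (M * Sm σ * Mᵀ) - v =
          2 * a ^ 2 / n * (Qf (pk n k) (M * Sm σ * Mᵀ) - q) + (2 * a ^ 2 / n * q - v) := by ring
        simp only []
        rw [this]
        refine (abs_add_le _ _).trans ?_
        rw [abs_mul, abs_of_nonneg (by positivity : 0 ≤ 2 * a ^ 2 / (n : ℝ))]
    _ = 2 * a ^ 2 / n * ∫ M, |Qf (pk n k) (M * Sm σ * Mᵀ) - q| ∂μ + |2 * a ^ 2 / n * q - v| := by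
        rw [integral_add (i1.const_mul _) (integrable_const _), integral_const_mul]; simp
    _ ≤ 2 * a ^ 2 / n * (4 * r ^ 3 * (1 + f1 σ)) +
        (|a ^ 2 * (k / n) * (1 - k / n) - v| + a ^ 2 * (f2 σ / n)) := by
        gcongr
    _ = _ := by
        rw [← hrn]; field_simp; ring

lemma exp_diff (x y c : ℝ) (hc : 0 ≤ c) :
    ‖Complex.exp ((x : ℝ) * Complex.I - (c : ℝ)) -
      Complex.exp (-(c : ℂ)) * Complex.exp ((y : ℝ) * Complex.I)‖ ≤ |x - y| := by
  have : Complex.exp ((x : ℝ) * Complex.I - (c : ℝ)) -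
      Complex.exp (-(c : ℂ)) * Complex.exp ((y : ℝ) * Complex.I) =
      Complex.exp (((-c : ℝ) : ℂ)) * (Complex.exp ((y : ℝ) * Complex.I) *
        (Complex.exp (Complex.I * ((x - y : ℝ) : ℂ)) - 1)) := by
    rw [sub_eq_neg_add ((x : ℂ) * Complex.I) (c : ℂ), Complex.exp_add,
      show ((x : ℂ) * Complex.I) = (y : ℝ) * Complex.I + Complex.I * ((x - y : ℝ) : ℂ) by
        push_cast; ring, Complex.exp_add]
    push_cast
    ring
  rw [this, norm_mul, norm_mul, Complex.norm_exp_ofReal_mul_I, one_mul, Complex.norm_exp]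
  have h1 : Real.exp (((-c : ℝ) : ℂ)).re ≤ 1 := by
    rw [Complex.ofReal_re]; exact Real.exp_le_one_iff.2 (by linarith)
  calc _ ≤ 1 * ‖x - y‖ := by
        gcongr
        exact Real.norm_exp_I_mul_ofReal_sub_one_le
    _ = _ := by simp

lemma sigma_bound {n : ℕ} {μ : Measure (Mat n)} (hμ : IsHaarOrthogonal n μ) (k : ℕ) (hk : k ≤ n)
    (hn : 1 ≤ n) (r : ℝ) (hr : 0 < r) (hrn : r ^ 4 = n) (a v s : ℝ) (hv : 0 ≤ v)
    (σ : Equiv.Perm (Fin n)) (t : ℝ) :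
    ‖(∫ M, Complex.exp ((t * (a * Wf (pk n k) (M * Sm σ * Mᵀ)) : ℝ) * Complex.I) ∂μ) -
      Complex.exp (-((v * t ^ 2 / 2 : ℝ) : ℂ)) * Complex.exp ((s * t : ℝ) * Complex.I) ^ f1 σ‖ ≤
      t ^ 2 * (8 * a ^ 2 / r * (1 + f1 σ) + |a ^ 2 * (k / n) * (1 - k / n) - v|
        + a ^ 2 * (f2 σ / n)) + |t| * |a * (k / n) - s| * f1 σ := by
  have hn0 : (0 : ℝ) < n := by exact_mod_cast hn
  have hp : ∀ c, pk n k c = 0 ∨ pk n k c = 1 := by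
    intro c; unfold pk; split_ifs <;> simp
  have h1 := char_bound hμ hp (Sm σ) (Sm_sym σ) hn a v _ (a * (k / n) * f1 σ) hv
    (by rw [sum_pk hk, trace_Sm]; field_simp) (delta_bound hμ k hk hn r hr hrn a v σ) t
  have h2 := exp_diff (a * (k / n) * f1 σ * t) (s * t * f1 σ) (v * t ^ 2 / 2) (by positivity)
  have e : Complex.exp ((s * t * f1 σ : ℝ) * Complex.I) =
      Complex.exp ((s * t : ℝ) * Complex.I) ^ f1 σ := by
    rw [← Complex.exp_nat_mul]; congr 1; push_cast; ring
  rw [e] at h2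
  have e2 : |a * (k / n) * f1 σ * t - s * t * f1 σ| = |t| * |a * (k / n) - s| * f1 σ := by
    have : a * (k / n) * f1 σ * t - s * t * f1 σ = t * (a * (k / n) - s) * f1 σ := by ring
    rw [this, abs_mul, abs_mul, Nat.abs_cast]
  rw [e2] at h2
  exact (norm_sub_le_norm_sub_add_norm_sub _ _ _).trans (add_le_add h1 h2)

lemma avg_bound {n : ℕ} {μ : Measure (Mat n)} (hμ : IsHaarOrthogonal n μ) (k : ℕ) (hk : k ≤ n)
    (hn : 2 ≤ n) (r : ℝ) (hr : 0 < r) (hrn : r ^ 4 = n) (a v s : ℝ) (hv : 0 ≤ v) (t : ℝ) :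
    ‖(1 / (n.factorial : ℂ)) * (∑ σ : Equiv.Perm (Fin n),
        ∫ M, Complex.exp ((t * (a * Wf (pk n k) (M * Sm σ * Mᵀ)) : ℝ) * Complex.I) ∂μ) -
      Complex.exp (-((v * t ^ 2 / 2 : ℝ) : ℂ)) * ∑ j ∈ Finset.range (n + 1),
        (Complex.exp ((s * t : ℝ) * Complex.I) - 1) ^ j / j.factorial‖ ≤
      t ^ 2 * (16 * a ^ 2 / r + |a ^ 2 * (k / n) * (1 - k / n) - v|
        + 2 * a ^ 2 / n) + |t| * |a * (k / n) - s| := by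
  have hn0 : (0 : ℝ) < n := by exact_mod_cast (by omega : 0 < n)
  have hf : (n.factorial : ℂ) ≠ 0 := by exact_mod_cast n.factorial_ne_zero
  have hf' : (0 : ℝ) < n.factorial := by exact_mod_cast n.factorial_pos
  have e : ∑ j ∈ Finset.range (n + 1),
        (Complex.exp ((s * t : ℝ) * Complex.I) - 1) ^ j / (j.factorial : ℂ) =
      (1 / (n.factorial : ℂ)) * ∑ σ : Equiv.Perm (Fin n),
        Complex.exp ((s * t : ℝ) * Complex.I) ^ f1 σ := by
    rw [pgf]; field_simp
  rw [e, mul_left_comm, ← mul_sub, Finset.mul_sum, ← Finset.sum_sub_distrib, norm_mul]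
  have s1 : (∑ σ : Equiv.Perm (Fin n), (f1 σ : ℝ)) = n.factorial := by
    exact_mod_cast sum_f1 (n := n) (by omega)
  have s2 : (∑ σ : Equiv.Perm (Fin n), (f2 σ : ℝ)) = 2 * n.factorial := by
    exact_mod_cast sum_f2 (n := n) hn
  have s0 : (∑ σ : Equiv.Perm (Fin n), (1 : ℝ)) = n.factorial := by
    simp [Fintype.card_perm]
  have key : (∑ σ : Equiv.Perm (Fin n), (t ^ 2 * (8 * a ^ 2 / r * (1 + f1 σ) +
      |a ^ 2 * (k / n) * (1 - k / n) - v|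
        + a ^ 2 * (f2 σ / n)) + |t| * |a * (k / n) - s| * f1 σ)) =
      n.factorial * (t ^ 2 * (16 * a ^ 2 / r + |a ^ 2 * (k / n) * (1 - k / n) - v|
        + 2 * a ^ 2 / n) + |t| * |a * (k / n) - s|) := by
    set ε := |a ^ 2 * (k / n) * (1 - k / n) - v|
    set η := |a * (k / n) - s|
    have : ∀ σ : Equiv.Perm (Fin n), (t ^ 2 * (8 * a ^ 2 / r * (1 + f1 σ) + ε
        + a ^ 2 * (f2 σ / n)) + |t| * η * f1 σ) =
        (t ^ 2 * (8 * a ^ 2 / r + ε)) * 1 + (t ^ 2 * (8 * a ^ 2 / r) + |t| * η) * f1 σ +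
          (t ^ 2 * (a ^ 2 / n)) * f2 σ := by intro σ; ring
    simp_rw [this]
    rw [Finset.sum_add_distrib, Finset.sum_add_distrib, ← Finset.mul_sum, ← Finset.mul_sum,
      ← Finset.mul_sum, s0, s1, s2]
    ring
  have := (norm_sum_le _ _).trans (Finset.sum_le_sum fun σ (_ : σ ∈ Finset.univ) =>
    sigma_bound hμ k hk (by omega) r hr hrn a v s hv σ t)
  rw [key] at this
  calc _ ≤ ‖(1 / (n.factorial : ℂ))‖ * _ := mul_le_mul_of_nonneg_left this (norm_nonneg _)
    _ = _ := by
      simp only [norm_div, norm_one, Complex.norm_natCast]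
      field_simp

lemma char_tendsto (α : ℝ) (hα0 : 0 < α) (hα1 : α ≤ 1)
    (μ : ∀ n : ℕ, Measure (Matrix (Fin n) (Fin n) ℝ))
    (hμ : ∀ n, IsHaarOrthogonal n (μ n)) (t : ℝ) :
    Filter.Tendsto (fun n : ℕ => (1 / (n.factorial : ℂ)) * (∑ σ : Equiv.Perm (Fin n),
        ∫ M, Complex.exp ((t * ((Real.sqrt α)⁻¹ *
          Wf (pk n ⌊α * n⌋₊) (M * Sm σ * Mᵀ)) : ℝ) * Complex.I) ∂(μ n)))
      Filter.atTop (nhds (Complex.exp (-(((1 - α) * t ^ 2 / 2 : ℝ) : ℂ)) *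
        Complex.exp (Complex.exp ((Real.sqrt α * t : ℝ) * Complex.I) - 1))) := by
  set a := (Real.sqrt α)⁻¹ with ha
  set s := Real.sqrt α with hs
  have hs0 : 0 < s := Real.sqrt_pos.2 hα0
  have hs2 : s ^ 2 = α := Real.sq_sqrt hα0.le
  set z := Complex.exp ((s * t : ℝ) * Complex.I)
  have l1 : Filter.Tendsto (fun n : ℕ => Complex.exp (-(((1 - α) * t ^ 2 / 2 : ℝ) : ℂ)) *
      ∑ j ∈ Finset.range (n + 1), (z - 1) ^ j / (j.factorial : ℂ)) Filter.atTop
      (nhds (Complex.exp (-(((1 - α) * t ^ 2 / 2 : ℝ) : ℂ)) * Complex.exp (z - 1))) := by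
    refine Filter.Tendsto.const_mul _ ?_
    have := (NormedSpace.expSeries_div_hasSum_exp (𝔸 := ℂ) (z - 1)).tendsto_sum_nat
    rw [← Complex.exp_eq_exp_ℂ] at this
    exact this.comp (Filter.tendsto_add_atTop_nat 1)
  have hκ : Filter.Tendsto (fun n : ℕ => (⌊α * n⌋₊ : ℝ) / n) Filter.atTop (nhds α) :=
    (tendsto_nat_floor_mul_div_atTop hα0.le).comp tendsto_natCast_atTop_atTop
  have hr : Filter.Tendsto (fun n : ℕ => 16 * a ^ 2 / Real.sqrt (Real.sqrt n)) Filter.atTop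
      (nhds 0) :=
    tendsto_const_nhds.div_atTop
      (Real.tendsto_sqrt_atTop.comp (Real.tendsto_sqrt_atTop.comp tendsto_natCast_atTop_atTop))
  have hn : Filter.Tendsto (fun n : ℕ => 2 * a ^ 2 / (n : ℝ)) Filter.atTop (nhds 0) :=
    tendsto_const_nhds.div_atTop tendsto_natCast_atTop_atTop
  have l2 : Filter.Tendsto (fun n : ℕ => t ^ 2 * (16 * a ^ 2 / Real.sqrt (Real.sqrt n) +
      |a ^ 2 * (⌊α * n⌋₊ / n) * (1 - ⌊α * n⌋₊ / n) - (1 - α)|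
        + 2 * a ^ 2 / n) + |t| * |a * (⌊α * n⌋₊ / n) - s|) Filter.atTop (nhds 0) := by
    have h1 : Filter.Tendsto (fun n : ℕ => |a ^ 2 * ((⌊α * n⌋₊ : ℝ) / n) *
        (1 - (⌊α * n⌋₊ : ℝ) / n) - (1 - α)|) Filter.atTop (nhds 0) := by
      have := (((hκ.const_mul (a ^ 2)).mul (hκ.const_sub 1)).sub_const (1 - α)).abs
      convert this using 2
      have : a ^ 2 * α = 1 := by rw [ha, ← hs2]; field_simp
      rw [this]; simp
    have h2 : Filter.Tendsto (fun n : ℕ => |a * ((⌊α * n⌋₊ : ℝ) / n) - s|) Filter.atTop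
        (nhds 0) := by
      have := ((hκ.const_mul a).sub_const s).abs
      convert this using 2
      have : a * α = s := by rw [ha, ← hs2]; field_simp
      rw [this]; simp
    have := (((hr.add h1).add hn).const_mul (t ^ 2)).add (h2.const_mul |t|)
    simpa using this
  have l3 := squeeze_zero_norm' (f := fun n : ℕ => (1 / (n.factorial : ℂ)) *
    (∑ σ : Equiv.Perm (Fin n), ∫ M, Complex.exp ((t * (a *
          Wf (pk n ⌊α * n⌋₊) (M * Sm σ * Mᵀ)) : ℝ) * Complex.I) ∂(μ n)) -
    Complex.exp (-(((1 - α) * t ^ 2 / 2 : ℝ) : ℂ)) *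
      ∑ j ∈ Finset.range (n + 1), (z - 1) ^ j / (j.factorial : ℂ)) ?_ l2
  · have := l3.add l1
    simpa using this
  · filter_upwards [Filter.eventually_ge_atTop 2] with n hn2
    have hn0 : (0 : ℝ) < n := by exact_mod_cast (by omega : 0 < n)
    refine avg_bound (hμ n) ⌊α * n⌋₊ ?_ hn2 (Real.sqrt (Real.sqrt n))
      (Real.sqrt_pos.2 (Real.sqrt_pos.2 hn0)) ?_ a (1 - α) s (by linarith) t
    · exact Nat.floor_le_of_le (by nlinarith)
    · rw [show 4 = 2 * 2 from rfl, pow_mul, Real.sq_sqrt (Real.sqrt_nonneg _),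
        Real.sq_sqrt hn0.le]

lemma charFun_limit (α : ℝ) (hα1 : α ≤ 1) (t : ℝ) :
    charFun (((gaussianReal 0 (Real.toNNReal (1 - α))).prod (poissonMeasure 1)).map
      (fun p : ℝ × ℕ => p.1 + Real.sqrt α * p.2)) t =
    Complex.exp (-(((1 - α) * t ^ 2 / 2 : ℝ) : ℂ)) *
        Complex.exp (Complex.exp ((Real.sqrt α * t : ℝ) * Complex.I) - 1) := by
  have hm : Measurable (fun p : ℝ × ℕ => p.1 + Real.sqrt α * p.2) := by fun_prop
  rw [charFun_apply_real, integral_map hm.aemeasurable (by fun_prop)]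
  have : ∀ p : ℝ × ℕ, Complex.exp (t * ((p.1 + Real.sqrt α * p.2 : ℝ) : ℂ) * Complex.I) =
      Complex.exp (t * p.1 * Complex.I) *
        Complex.exp (((Real.sqrt α * t : ℝ) : ℂ) * ((p.2 : ℝ) : ℂ) * Complex.I) := by
    intro p; rw [← Complex.exp_add]; congr 1; push_cast; ring
  simp_rw [this]
  rw [integral_prod_mul (fun x : ℝ => Complex.exp (t * x * Complex.I))
    (fun y : ℕ => Complex.exp (((Real.sqrt α * t : ℝ) : ℂ) * ((y : ℝ) : ℂ) * Complex.I)),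
    ← charFun_apply_real, charFun_gaussianReal]
  have h2 := charFun_map_cast_poissonMeasure 1 (Real.sqrt α * t)
  rw [charFun_apply_real, integral_map (by fun_prop) (by fun_prop)] at h2
  rw [h2]
  congr 1
  · congr 1
    rw [Real.coe_toNNReal _ (by linarith)]
    push_cast; ring
  · simp

/-- The law of the trace under the uniform mixture over permutations. -/
noncomputable def law (n : ℕ) (μ : Measure (Mat n)) (W : Equiv.Perm (Fin n) → Mat n → ℝ) :
    Measure ℝ :=
  ((n.factorial : NNReal)⁻¹) • ∑ σ : Equiv.Perm (Fin n), μ.map (W σ)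

lemma law_prob {n : ℕ} {μ : Measure (Mat n)} (hμ : IsHaarOrthogonal n μ)
    (W : Equiv.Perm (Fin n) → Mat n → ℝ) (hW : ∀ σ, Continuous (W σ)) :
    IsProbabilityMeasure (law n μ W) := by
  haveI := hμ.isProb
  haveI : ∀ σ, IsProbabilityMeasure (μ.map (W σ)) :=
    fun σ => Measure.isProbabilityMeasure_map (hW σ).measurable.aemeasurable
  constructor
  unfold law
  rw [Measure.smul_apply, Measure.finsetSum_apply]
  simp only [measure_univ, Finset.sum_const, Finset.card_univ, Fintype.card_perm, Fintype.card_fin]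
  rw [ENNReal.smul_def, ENNReal.coe_inv (by exact_mod_cast n.factorial_ne_zero)]
  simp only [nsmul_eq_mul, mul_one, smul_eq_mul, ENNReal.coe_natCast]
  exact ENNReal.inv_mul_cancel (by exact_mod_cast n.factorial_ne_zero) (by simp)

lemma law_integral {E : Type*} [NormedAddCommGroup E] [NormedSpace ℝ E] [MeasurableSpace E]
    [BorelSpace E] [SecondCountableTopology E] {n : ℕ} {μ : Measure (Mat n)}
    (hμ : IsHaarOrthogonal n μ)
    (W : Equiv.Perm (Fin n) → Mat n → ℝ) (hW : ∀ σ, Continuous (W σ)) (f : ℝ → E)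
    (hf : Continuous f) :
    ∫ x, f x ∂(law n μ W) = (1 / (n.factorial : ℝ)) • ∑ σ, ∫ M, f (W σ M) ∂μ := by
  haveI := hμ.isProb
  have hi : ∀ σ, Integrable f (μ.map (W σ)) := fun σ =>
    (integrable_map_measure hf.aestronglyMeasurable (hW σ).measurable.aemeasurable).2
      (integrable_cont hμ (hf.comp (hW σ)))
  unfold law
  rw [integral_smul_nnreal_measure, integral_finsetSum_measure (fun σ _ => hi σ)]
  rw [NNReal.smul_def]
  congr 1
  · simp
  · refine Finset.sum_congr rfl fun σ _ => ?_
    exact integral_map (hW σ).measurable.aemeasurable hf.aestronglyMeasurable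

theorem main (α : ℝ) (hα0 : 0 < α) (hα1 : α ≤ 1)
    (μ : ∀ n : ℕ, Measure (Matrix (Fin n) (Fin n) ℝ))
    (hμ : ∀ n, IsHaarOrthogonal n (μ n)) (g : ℝ →ᵇ ℝ) :
      Filter.Tendsto
        (fun n => (1 / (Nat.factorial n : ℝ)) *
          ∑ σ : Equiv.Perm (Fin n),
            ∫ M, g ((Real.sqrt α)⁻¹ * Wf (pk n ⌊α * n⌋₊) (M * Sm σ * Mᵀ)) ∂(μ n))
        Filter.atTop
        (nhds (∫ p : ℝ × ℕ, g (p.1 + Real.sqrt α * p.2)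
          ∂((gaussianReal 0 (Real.toNNReal (1 - α))).prod (poissonMeasure 1)))) := by
  let W : ∀ n, Equiv.Perm (Fin n) → Mat n → ℝ := fun n σ M =>
    (Real.sqrt α)⁻¹ * Wf (pk n ⌊α * n⌋₊) (M * Sm σ * Mᵀ)
  have hW : ∀ n σ, Continuous (W n σ) := fun n σ => by
    simp only [W]; fun_prop
  have hm : Measurable (fun p : ℝ × ℕ => p.1 + Real.sqrt α * p.2) := by fun_prop
  let ν : ℕ → ProbabilityMeasure ℝ := fun n => ⟨law n (μ n) (W n), law_prob (hμ n) _ (hW n)⟩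
  let ν₀ : ProbabilityMeasure ℝ :=
    ⟨((gaussianReal 0 (Real.toNNReal (1 - α))).prod (poissonMeasure 1)).map
      (fun p : ℝ × ℕ => p.1 + Real.sqrt α * p.2),
      Measure.isProbabilityMeasure_map hm.aemeasurable⟩
  have h : Filter.Tendsto ν Filter.atTop (nhds ν₀) := by
    refine ProbabilityMeasure.tendsto_of_tendsto_charFun fun t => ?_
    have h1 := char_tendsto α hα0 hα1 μ hμ t
    rw [← charFun_limit α hα1 t] at h1
    refine h1.congr fun n => ?_
    change _ = charFun (law n (μ n) (W n)) t
    rw [charFun_apply_real, law_integral (hμ n) _ (hW n) _ (by fun_prop), Complex.real_smul]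
    simp only [W]
    push_cast
    rfl
  have := ProbabilityMeasure.tendsto_iff_forall_integral_tendsto.1 h g
  have e : ∫ x, g x ∂(ν₀ : Measure ℝ) = ∫ p : ℝ × ℕ, g (p.1 + Real.sqrt α * p.2)
          ∂((gaussianReal 0 (Real.toNNReal (1 - α))).prod (poissonMeasure 1)) :=
    integral_map hm.aemeasurable g.continuous.aestronglyMeasurable
  rw [e] at this
  refine this.congr fun n => ?_
  exact law_integral (hμ n) _ (hW n) _ g.continuous

end HaarAux

/-- for `0 < α ≤ 1` and `A_n` diagonal with `A_{ii} = 1/√α` for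
`i ≤ ⌊αn⌋` and `0` otherwise, `Tr(A_n M P Mᵀ)` (with `M` Haar orthogonal and `P` an
independent uniform random permutation matrix, the law being the uniform mixture over
`σ ∈ S_n`) converges in distribution to `Z + √α·Y` with `Z ~ N(0, 1 − α)` and
`Y ~ Poisson(1)` independent. -/
theorem stmt19 (α : ℝ) (hα0 : 0 < α) (hα1 : α ≤ 1)
    (μ : ∀ n : ℕ, Measure (Matrix (Fin n) (Fin n) ℝ))
    (hμ : ∀ n, IsHaarOrthogonal n (μ n)) :
    let A : ∀ n : ℕ, Matrix (Fin n) (Fin n) ℝ := fun n =>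
      Matrix.diagonal fun i => if (i : ℕ) < ⌊α * n⌋₊ then (Real.sqrt α)⁻¹ else 0
    ∀ g : ℝ →ᵇ ℝ,
      Filter.Tendsto
        (fun n => (1 / (Nat.factorial n : ℝ)) *
          ∑ σ : Equiv.Perm (Fin n),
            ∫ M, g (Matrix.trace (A n * M * σ.permMatrix ℝ * Mᵀ)) ∂(μ n))
        Filter.atTop
        (nhds (∫ p : ℝ × ℕ, g (p.1 + Real.sqrt α * p.2)
          ∂((gaussianReal 0 (Real.toNNReal (1 - α))).prod (poissonMeasure 1)))) := by
  intro A g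
  refine (HaarAux.main α hα0 hα1 μ hμ g).congr fun n => ?_
  refine congrArg _ (Finset.sum_congr rfl fun σ _ => integral_congr_ae (ae_of_all _ fun M => ?_))
  exact congrArg g (HaarAux.trace_A σ (Real.sqrt α)⁻¹ (fun i => (i : ℕ) < ⌊α * n⌋₊) M).symm
end
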